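/- arXiv:0806.2788 — 2 statements merged into one kernel-verified Lean document; each statement's English description precedes it below -/
import Mathlib

section
/- Measurable free indecomposability is a measure equivalence invariant: if countable groups Γ and Λ are measure equivalent, then Γ is measurably freely indecomposable if and only if Λ is measurably freely indecomposable. -/
open MeasureTheory

/-- A countable Borel equivalence relation on `X`, defined on a Borel domain `dom`:
it is Borel as a subset of `X × X`, is an equivalence relation on `dom`, and has
countable classes. -/
structure CBER (X : Type) [MeasurableSpace X] where
  dom : Set X
  dom_meas : MeasurableSet dom
  rel : X → X → Prop
  rel_meas : MeasurableSet {p : X × X | rel p.1 p.2}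
  rel_dom : ∀ {x y : X}, rel x y → x ∈ dom ∧ y ∈ dom
  refl : ∀ x ∈ dom, rel x x
  symm : ∀ {x y : X}, rel x y → rel y x
  trans : ∀ {x y z : X}, rel x y → rel y z → rel x z
  countable_classes : ∀ x : X, {y | rel x y}.Countable

/-- The class of `x`. -/
def CBER.cls {X : Type} [MeasurableSpace X] (R : CBER X) (x : X) : Set X := {y | R.rel x y}

/-- The `R`-saturation of a set `A`: the union of the `R`-classes meeting `A`. -/
def CBER.sat {X : Type} [MeasurableSpace X] (R : CBER X) (A : Set X) : Set X :=
  {y | ∃ x ∈ A, R.rel x y}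

/-- A complete section: a Borel subset of the domain meeting every class. -/
def CBER.IsCompleteSection {X : Type} [MeasurableSpace X] (R : CBER X) (A : Set X) : Prop :=
  MeasurableSet A ∧ A ⊆ R.dom ∧ ∀ x ∈ R.dom, ∃ y ∈ A, R.rel x y

/-- A smooth CBER: one admitting a Borel fundamental domain (a Borel set meeting
every class exactly once). -/
def CBER.Smooth {X : Type} [MeasurableSpace X] (R : CBER X) : Prop :=
  ∃ D : Set X, MeasurableSet D ∧ D ⊆ R.dom ∧ ∀ x ∈ R.dom, ∃! y, y ∈ D ∧ R.rel x y

/-- Smoothness of the restriction `R|A`. -/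
def CBER.SmoothOn {X : Type} [MeasurableSpace X] (R : CBER X) (A : Set X) : Prop :=
  ∃ D : Set X, MeasurableSet D ∧ D ⊆ A ∧ ∀ x ∈ R.dom ∩ A, ∃! y, y ∈ D ∧ R.rel x y

/-- All classes are finite. -/
def CBER.FiniteClasses {X : Type} [MeasurableSpace X] (R : CBER X) : Prop :=
  ∀ x ∈ R.dom, (R.cls x).Finite

/-- Aperiodic: all classes are infinite (on the domain). -/
def CBER.Aperiodic {X : Type} [MeasurableSpace X] (R : CBER X) : Prop :=
  ∀ x ∈ R.dom, (R.cls x).Infinite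

/-- Trivial: all classes are singletons. -/
def CBER.TrivialClasses {X : Type} [MeasurableSpace X] (R : CBER X) : Prop :=
  ∀ x y, R.rel x y → x = y

/-- The restriction `R|U` of `R` to a Borel set `U`. -/
def CBER.restrict {X : Type} [MeasurableSpace X] (R : CBER X) (U : Set X)
    (hU : MeasurableSet U) : CBER X where
  dom := R.dom ∩ U
  dom_meas := R.dom_meas.inter hU
  rel x y := R.rel x y ∧ x ∈ U ∧ y ∈ U
  rel_meas := by
    have h : {p : X × X | R.rel p.1 p.2 ∧ p.1 ∈ U ∧ p.2 ∈ U} =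
        {p : X × X | R.rel p.1 p.2} ∩ (Prod.fst ⁻¹' U ∩ Prod.snd ⁻¹' U) := by
      ext p
      simp only [Set.mem_setOf_eq, Set.mem_inter_iff, Set.mem_preimage, and_assoc]
    rw [h]
    exact R.rel_meas.inter ((measurable_fst hU).inter (measurable_snd hU))
  rel_dom := fun h => ⟨⟨(R.rel_dom h.1).1, h.2.1⟩, ⟨(R.rel_dom h.1).2, h.2.2⟩⟩
  refl := fun x hx => ⟨R.refl x hx.1, hx.2, hx.2⟩
  symm := fun h => ⟨R.symm h.1, h.2.2, h.2.1⟩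
  trans := fun h h' => ⟨R.trans h.1 h'.1, h.2.1, h'.2.2⟩
  countable_classes := fun x =>
    Set.Countable.mono (fun y hy => hy.1) (R.countable_classes x)

/-- `S` is a subrelation of `R`. -/
def CBER.IsSubrelOf {X : Type} [MeasurableSpace X] (S R : CBER X) : Prop :=
  S.dom ⊆ R.dom ∧ ∀ x y, S.rel x y → R.rel x y

/-- A partial Borel isomorphism between Borel subsets `src` and `tgt` of `X`. -/
structure PBI (X : Type) [MeasurableSpace X] where
  src : Set X
  tgt : Set X
  src_meas : MeasurableSet src
  tgt_meas : MeasurableSet tgt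
  toFun : X → X
  invFun : X → X
  meas_toFun : Measurable toFun
  meas_invFun : Measurable invFun
  mapsTo : Set.MapsTo toFun src tgt
  mapsTo_inv : Set.MapsTo invFun tgt src
  left_inv : ∀ x ∈ src, invFun (toFun x) = x
  right_inv : ∀ y ∈ tgt, toFun (invFun y) = y

/-- Membership in the full pseudogroup `[[R]]`: a partial Borel isomorphism whose
graph is contained in `R`. -/
def CBER.InPseudogroup {X : Type} [MeasurableSpace X] (R : CBER X) (φ : PBI X) : Prop :=
  φ.src ⊆ R.dom ∧ ∀ x ∈ φ.src, R.rel x (φ.toFun x)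

/-- Two subrelations `S₁`, `S₂` of `R` are inner conjugate in `R` if some element of the
full pseudogroup of `R` with domain `D(S₂)` and target `D(S₁)` conjugates one to the other. -/
def InnerConjugate {X : Type} [MeasurableSpace X] (R S₁ S₂ : CBER X) : Prop :=
  ∃ φ : PBI X, R.InPseudogroup φ ∧ φ.src = S₂.dom ∧ φ.tgt = S₁.dom ∧
    ∀ x ∈ φ.src, ∀ y ∈ φ.src, (S₂.rel x y ↔ S₁.rel (φ.toFun x) (φ.toFun y))

/-- `R` preserves the measure `μ`: every element of its full pseudogroup preserves `μ`. -/
def CBER.IsPMP {X : Type} [MeasurableSpace X] (R : CBER X) (μ : Measure X) : Prop :=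
  ∀ φ : PBI X, R.InPseudogroup φ → ∀ A : Set X, A ⊆ φ.src → MeasurableSet A →
    μ (φ.toFun '' A) = μ A

/-- Free independence of a family of equivalence relations: any cycle alternating
nontrivially among the factors must have two consecutive steps in the same factor. -/
def FreelyIndep {X : Type} [MeasurableSpace X] {ι : Type} (Rf : ι → CBER X) : Prop :=
  ∀ (n : ℕ) (x : ℕ → X) (i : ℕ → ι), 2 ≤ n → x n = x 0 →
    (∀ j < n, x j ≠ x (j + 1)) → (∀ j < n, (Rf (i j)).rel (x j) (x (j + 1))) →
    ∃ j, j + 1 < n ∧ i j = i (j + 1)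

/-- `R` is the free product of the family `Rf`: the family is freely independent and `R`
is the smallest equivalence relation on the union of the domains containing every `Rf i`. -/
def IsFreeProduct {X : Type} [MeasurableSpace X] {ι : Type} (R : CBER X)
    (Rf : ι → CBER X) : Prop :=
  FreelyIndep Rf ∧ R.dom = (⋃ i, (Rf i).dom) ∧
    ∀ x y, R.rel x y ↔
      (x ∈ R.dom ∧ Relation.EqvGen (fun a b => ∃ i, (Rf i).rel a b) x y)

/-- The partition `U = ⊔ⱼ Uⱼ` trivializes the free product decomposition `R = *ⱼ Rf j`:
`U` is a complete section for `R`, the partition is `R|U`-invariant, and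
`R|Uⱼ = (Rf j)|Uⱼ` for every `j`. -/
def Trivializes {X : Type} [MeasurableSpace X] {ι : Type}
    (R : CBER X) (Rf : ι → CBER X) (U : ι → Set X) : Prop :=
  (∀ j, MeasurableSet (U j)) ∧ (∀ j, U j ⊆ R.dom) ∧
  Pairwise (Function.onFun Disjoint U) ∧
  (∀ x ∈ R.dom, ∃ y ∈ ⋃ j, U j, R.rel x y) ∧
  (∀ i j : ι, ∀ x ∈ U i, ∀ y ∈ U j, R.rel x y → i = j) ∧
  (∀ j, ∀ x ∈ U j, ∀ y ∈ U j, (R.rel x y ↔ (Rf j).rel x y))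

/-- A free product decomposition is inessential if it admits a trivialization. -/
def Inessential {X : Type} [MeasurableSpace X] {ι : Type}
    (R : CBER X) (Rf : ι → CBER X) : Prop :=
  ∃ U : ι → Set X, Trivializes R Rf U

/-- Freely indecomposable (Borel context): every free product decomposition is inessential. -/
def FreelyIndecomposable {X : Type} [MeasurableSpace X] (R : CBER X) : Prop :=
  ∀ (ι : Type) (_ : Countable ι) (Rf : ι → CBER X), IsFreeProduct R Rf → Inessential R Rf

/-- Inessential decomposition in the measured context: a trivialization up to `μ`-null sets. -/
def InessentialMod {X : Type} [MeasurableSpace X] (μ : Measure X) {ι : Type}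
    (R : CBER X) (Rf : ι → CBER X) : Prop :=
  ∃ (U : ι → Set X) (C : Set X),
    (∀ j, MeasurableSet (U j)) ∧ (∀ j, U j ⊆ R.dom) ∧
    Pairwise (Function.onFun Disjoint U) ∧
    MeasurableSet C ∧ μ Cᶜ = 0 ∧
    (∀ x ∈ R.dom ∩ C, ∃ y ∈ ⋃ j, U j, R.rel x y) ∧
    (∀ i j : ι, ∀ x ∈ U i ∩ C, ∀ y ∈ U j ∩ C, R.rel x y → i = j) ∧
    (∀ j, ∀ x ∈ U j ∩ C, ∀ y ∈ U j ∩ C, (R.rel x y ↔ (Rf j).rel x y))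

/-- Freely indecomposable (measured context): every free product decomposition is
inessential up to `μ`-null sets. -/
def FreelyIndecomposableMod {X : Type} [MeasurableSpace X] (μ : Measure X)
    (R : CBER X) : Prop :=
  ∀ (ι : Type) (_ : Countable ι) (Rf : ι → CBER X), IsFreeProduct R Rf →
    InessentialMod μ R Rf

/-- One step of a word in a graphing: apply `φ` (if `e = true`) or `φ⁻¹` (if `e = false`). -/
def PBIStep {X : Type} [MeasurableSpace X] (φ : PBI X) : Bool → X → X → Prop
  | true, a, b => a ∈ φ.src ∧ φ.toFun a = b
  | false, a, b => a ∈ φ.tgt ∧ φ.invFun a = b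

/-- A treeing: any cyclic word in the generators and their inverses admits a reduction. -/
def IsTreeing {X : Type} [MeasurableSpace X] {ι : Type} (Φ : ι → PBI X) : Prop :=
  ∀ (n : ℕ) (i : ℕ → ι) (ε : ℕ → Bool) (x : ℕ → X),
    0 < n → x n = x 0 → (∀ j < n, PBIStep (Φ (i j)) (ε j) (x j) (x (j + 1))) →
    ∃ j, j + 1 < n ∧ i j = i (j + 1) ∧ ε j ≠ ε (j + 1)

/-- The graphing `Φ` generates `R`: `R` is the smallest equivalence relation on the union of
the sources and targets containing the graphs of the `Φ i`. -/
def GeneratesCBER {X : Type} [MeasurableSpace X] {ι : Type} (Φ : ι → PBI X)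
    (R : CBER X) : Prop :=
  R.dom = (⋃ i, ((Φ i).src ∪ (Φ i).tgt)) ∧ (∀ i, R.InPseudogroup (Φ i)) ∧
    ∀ x y, R.rel x y ↔ (x ∈ R.dom ∧
      Relation.EqvGen (fun a b => ∃ i, a ∈ (Φ i).src ∧ (Φ i).toFun a = b) x y)

/-- Treeable: generated by some (countable) treeing. -/
def CBER.Treeable {X : Type} [MeasurableSpace X] (R : CBER X) : Prop :=
  ∃ Φ : ℕ → PBI X, IsTreeing Φ ∧ GeneratesCBER Φ R

/-- Hyperfinite: increasing union of finite Borel subrelations. -/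
def CBER.Hyperfinite {X : Type} [MeasurableSpace X] (R : CBER X) : Prop :=
  ∃ S : ℕ → CBER X, (∀ n, (S n).IsSubrelOf R) ∧ (∀ n, (S n).FiniteClasses) ∧
    (∀ n, (S n).dom = R.dom) ∧ (∀ n, ∀ x y, (S n).rel x y → (S (n + 1)).rel x y) ∧
    ∀ x y, R.rel x y → ∃ n, (S n).rel x y

/-- Ergodicity of a measured CBER: every invariant Borel set is null or conull. -/
def ErgodicCBER {X : Type} [MeasurableSpace X] (R : CBER X) (μ : Measure X) : Prop :=
  ∀ A : Set X, MeasurableSet A → (∀ x ∈ A, ∀ y, R.rel x y → y ∈ A) →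
    μ A = 0 ∨ μ Aᶜ = 0

/-- A stable orbit equivalence between measured CBERs: a Borel isomorphism between
complete sections (mod null sets), sending the normalized measure to the normalized
measure, and preserving the relations a.e. -/
structure SOEquiv {X Y : Type} [MeasurableSpace X] [MeasurableSpace Y]
    (R : CBER X) (μ : Measure X) (S : CBER Y) (ν : Measure Y) where
  A : Set X
  B : Set Y
  toFun : X → Y
  invFun : Y → X
  measA : MeasurableSet A
  measB : MeasurableSet B
  A_sub : A ⊆ R.dom
  B_sub : B ⊆ S.dom
  A_pos : 0 < μ A
  B_pos : 0 < ν B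
  A_section : ∀ᵐ x ∂μ, x ∈ R.dom → ∃ y ∈ A, R.rel x y
  B_section : ∀ᵐ y ∂ν, y ∈ S.dom → ∃ z ∈ B, S.rel y z
  meas_toFun : Measurable toFun
  meas_invFun : Measurable invFun
  mapsTo : Set.MapsTo toFun A B
  mapsTo_inv : Set.MapsTo invFun B A
  left_inv : ∀ x ∈ A, invFun (toFun x) = x
  right_inv : ∀ y ∈ B, toFun (invFun y) = y
  measure_eq : ∀ E : Set X, E ⊆ A → MeasurableSet E →
    (μ A)⁻¹ * μ E = (ν B)⁻¹ * ν (toFun '' E)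
  rel_iff : ∃ C : Set X, MeasurableSet C ∧ μ (A \ C) = 0 ∧
    ∀ x ∈ A ∩ C, ∀ y ∈ A ∩ C, (R.rel x y ↔ S.rel (toFun x) (toFun y))

/-- Stable orbit equivalence. -/
def SOE {X Y : Type} [MeasurableSpace X] [MeasurableSpace Y]
    (R : CBER X) (μ : Measure X) (S : CBER Y) (ν : Measure Y) : Prop :=
  Nonempty (SOEquiv R μ S ν)

/-- Orbit equivalence: a stable orbit equivalence where one can take the complete
sections to be the full spaces. -/
def OE {X Y : Type} [MeasurableSpace X] [MeasurableSpace Y]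
    (R : CBER X) (μ : Measure X) (S : CBER Y) (ν : Measure Y) : Prop :=
  ∃ E : SOEquiv R μ S ν, E.A = Set.univ ∧ E.B = Set.univ

/-- A probability measure preserving action of a group `G` on a measured space. -/
structure PMPAction (G : Type) [Group G] (X : Type) [MeasurableSpace X]
    (μ : Measure X) where
  act : G → X → X
  act_one : ∀ x, act 1 x = x
  act_mul : ∀ g h x, act (g * h) x = act g (act h x)
  measurePreserving : ∀ g, MeasurePreserving (act g) μ μ

/-- Essential freeness: a.e. point has trivial stabilizer. -/
def PMPAction.IsFree {G X : Type} [Group G] [MeasurableSpace X] {μ : Measure X}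
    (α : PMPAction G X μ) : Prop :=
  ∀ᵐ x ∂μ, ∀ g : G, α.act g x = x → g = 1

/-- `R` is the orbit equivalence relation of the action `α` restricted to the subgroup `H`. -/
def IsOrbitRel {G X : Type} [Group G] [MeasurableSpace X] {μ : Measure X}
    (α : PMPAction G X μ) (H : Subgroup G) (R : CBER X) : Prop :=
  R.dom = Set.univ ∧ ∀ x y, (R.rel x y ↔ ∃ g ∈ H, α.act g x = y)

/-- A countable group is measurably freely indecomposable (MFI) if the orbit equivalence
relation of every free p.m.p. action of it on a standard probability space is freely
indecomposable. -/
def MFI (G : Type) [Group G] [Countable G] : Prop :=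
  ∀ (X : Type) [MeasurableSpace X] [StandardBorelSpace X]
    (μ : Measure X) [IsProbabilityMeasure μ]
    (α : PMPAction G X μ) (R : CBER X),
    α.IsFree → IsOrbitRel α ⊤ R → FreelyIndecomposableMod μ R

/-- `G` is the internal free product of the family of subgroups `H`. -/
def IsFreeProductOf (G : Type) [Group G] {ι : Type} (H : ι → Subgroup G) : Prop :=
  Function.Bijective (Monoid.CoprodI.lift fun i => (H i).subtype)

/-- A Borel fundamental domain for an action, of the coupling kind: meets a.e. orbit,
and meets each orbit at most once mod null. -/
def IsFundamentalDomainFor {G : Type} [Group G] {Ω : Type} [MeasurableSpace Ω]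
    (ν : Measure Ω) (a : G → Ω → Ω) (D : Set Ω) : Prop :=
  MeasurableSet D ∧ (∀ᵐ x ∂ν, ∃ g : G, a g x ∈ D) ∧
    ∀ g : G, g ≠ 1 → ν (D ∩ a g ⁻¹' D) = 0

/-- A measure equivalence coupling between `G` and `H`: a standard σ-finite measure space
with commuting measure-preserving essentially free actions of `G` and `H`, each admitting
a Borel fundamental domain of finite positive measure. -/
structure MECoupling (G : Type) [Group G] (H : Type) [Group H] where
  (Ω : Type)
  [mΩ : MeasurableSpace Ω]
  [sbΩ : StandardBorelSpace Ω]
  (ν : Measure Ω)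
  sigmaFinite : SigmaFinite ν
  aG : G → Ω → Ω
  aH : H → Ω → Ω
  DG : Set Ω
  DH : Set Ω
  aG_one : ∀ x, aG 1 x = x
  aG_mul : ∀ g g' x, aG (g * g') x = aG g (aG g' x)
  aH_one : ∀ x, aH 1 x = x
  aH_mul : ∀ h h' x, aH (h * h') x = aH h (aH h' x)
  comm : ∀ g h x, aG g (aH h x) = aH h (aG g x)
  mp_aG : ∀ g, MeasurePreserving (aG g) ν ν
  mp_aH : ∀ h, MeasurePreserving (aH h) ν ν
  free_aG : ∀ᵐ x ∂ν, ∀ g, aG g x = x → g = 1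
  free_aH : ∀ᵐ x ∂ν, ∀ h, aH h x = x → h = 1
  fund_DG : IsFundamentalDomainFor ν aG DG
  fund_DH : IsFundamentalDomainFor ν aH DH
  DG_pos : 0 < ν DG
  DG_fin : ν DG < ⊤
  DH_pos : 0 < ν DH
  DH_fin : ν DH < ⊤

/-- The generalized index (compression constant) of a measure equivalence coupling. -/
noncomputable def MECoupling.index {G : Type} [Group G] {H : Type} [Group H]
    (c : MECoupling G H) : ENNReal :=
  c.ν c.DH / c.ν c.DG

/-- Measure equivalence of countable groups. -/
def MeasureEquivalent (G : Type) [Group G] (H : Type) [Group H] : Prop :=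
  Nonempty (MECoupling G H)

/-- Measure equivalence with a prescribed generalized index. -/
def MEwithIndex (G : Type) [Group G] (H : Type) [Group H] (κ : ENNReal) : Prop :=
  ∃ c : MECoupling G H, c.index = κ

section Combinatorics

/-- Free independence of a family of relations on a set. -/
def IndepRel {X ι : Type} (r : ι → X → X → Prop) : Prop :=
  ∀ (n : ℕ) (x : ℕ → X) (i : ℕ → ι), 2 ≤ n → x n = x 0 →
    (∀ j < n, x j ≠ x (j + 1)) → (∀ j < n, r (i j) (x j) (x (j + 1))) →
    ∃ j, j + 1 < n ∧ i j = i (j + 1)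

/-- `ReducedPath r c x y γ o`: there is a reduced path from `x` to `y` with steps in the
relations `r i`, whose `c`-product is `γ` and whose first step has type `o`. -/
inductive ReducedPath {X ι F : Type} [Group F] (r : ι → X → X → Prop) (c : ι → X → X → F) :
    X → X → F → Option ι → Prop
  | nil (x : X) : ReducedPath r c x x 1 none
  | cons {i : ι} {x y z : X} {γ : F} {o : Option ι} : r i x y → x ≠ y →
      ReducedPath r c y z γ o → o ≠ some i → ReducedPath r c x z (c i x y * γ) (some i)

variable {X ι F : Type} [Group F] {r : ι → X → X → Prop} {c : ι → X → X → F}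

theorem ReducedPath.exists_cons (heq : ∀ i, Equivalence (r i))
    (hc : ∀ i x y z, r i x y → r i y z → c i x y * c i y z = c i x z)
    {i : ι} {x y z : X} {γ : F} {o : Option ι} (hxy : r i x y) (h : ReducedPath r c y z γ o) :
    ∃ o', ReducedPath r c x z (c i x y * γ) o' := by
  have hc1 : ∀ i x, r i x x → c i x x = 1 := fun i x hx => by
    have := hc i x x x hx hx
    simpa using this
  by_cases hne : x = y
  · subst hne
    exact ⟨o, by rwa [hc1 i x hxy, one_mul]⟩
  by_cases ho : o = some i
  · subst ho
    cases h with
    | @cons _ _ y' _ γ' o' hyy' _ hp ho' =>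
      rw [← mul_assoc, hc i x y y' hxy hyy']
      by_cases hx : x = y'
      · subst hx
        exact ⟨o', by rwa [hc1 i x ((heq i).refl x), one_mul]⟩
      · exact ⟨_, .cons ((heq i).trans hxy hyy') hx hp ho'⟩
  · exact ⟨_, .cons hxy hne h ho⟩

theorem ReducedPath.exists_seq {x y : X} {γ : F} {o : Option ι} (h : ReducedPath r c x y γ o)
    {i : ι} (ho : o = some i) :
    ∃ (n : ℕ) (s : ℕ → X) (t : ℕ → ι), 0 < n ∧ s 0 = x ∧ s n = y ∧ t 0 = i ∧
      (∀ j < n, s j ≠ s (j + 1)) ∧ (∀ j < n, r (t j) (s j) (s (j + 1))) ∧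
      (∀ j, j + 1 < n → t j ≠ t (j + 1)) := by
  induction h generalizing i with
  | nil x => exact absurd ho (by simp)
  | @cons k x y z γ o hxy hne hp hok ih =>
    obtain rfl : k = i := by simpa using ho
    cases o with
    | none =>
      cases hp
      refine ⟨1, fun m => if m = 0 then x else y, fun _ => k, one_pos, by simp, by simp, rfl,
        ?_, ?_, ?_⟩
      · intro j hj
        obtain rfl : j = 0 := by omega
        simpa using hne
      · intro j hj
        obtain rfl : j = 0 := by omega
        simpa using hxy
      · intro j hj
        omega
    | some i' =>
      obtain ⟨n, s, t, hn, hs0, hsn, ht0, h1, h2, h3⟩ := ih rfl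
      refine ⟨n + 1, fun m => Nat.casesOn m x s, fun m => Nat.casesOn m k t, by omega, rfl, hsn,
        rfl, ?_, ?_, ?_⟩
      · rintro (_ | j) hj
        · simpa [hs0] using hne
        · exact h1 j (by omega)
      · rintro (_ | j) hj
        · simpa [hs0] using hxy
        · exact h2 j (by omega)
      · rintro (_ | j) hj
        · intro hk
          exact hok (by rw [← ht0]; exact congrArg some hk.symm)
        · exact h3 j (by omega)

theorem ReducedPath.eq_one_of_closed (hr : IndepRel r) {x : X} {γ : F} {o : Option ι}
    (h : ReducedPath r c x x γ o) : γ = 1 := by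
  cases o with
  | none => cases h; rfl
  | some i =>
    exfalso
    obtain ⟨n, s, t, hn, hs0, hsn, -, h1, h2, h3⟩ := h.exists_seq rfl
    have hn2 : 2 ≤ n := by
      by_contra hlt
      obtain rfl : n = 1 := by omega
      exact h1 0 one_pos (by rw [hs0, zero_add, hsn])
    obtain ⟨j, hj, hj'⟩ := hr n s t hn2 (by rw [hs0, hsn]) h1 h2
    exact h3 j hj hj'

/-- A path with steps in the relations `r i` and `c`-product `γ`. -/
inductive CocyclePath (r : ι → X → X → Prop) (c : ι → X → X → F) : X → X → F → Prop
  | nil (x : X) : CocyclePath r c x x 1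
  | cons {i : ι} {x y z : X} {γ : F} : r i x y → CocyclePath r c y z γ →
      CocyclePath r c x z (c i x y * γ)

theorem CocyclePath.trans {x y z : X} {γ δ : F} (h : CocyclePath r c x y γ)
    (h' : CocyclePath r c y z δ) : CocyclePath r c x z (γ * δ) := by
  induction h with
  | nil x => simpa using h'
  | cons hxy _ ih => rw [mul_assoc]; exact .cons hxy (ih h')

theorem CocyclePath.symm (heq : ∀ i, Equivalence (r i))
    (hc : ∀ i x y z, r i x y → r i y z → c i x y * c i y z = c i x z)
    {x y : X} {γ : F} (h : CocyclePath r c x y γ) : CocyclePath r c y x γ⁻¹ := by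
  induction h with
  | nil x => simpa using CocyclePath.nil x
  | @cons i x y z γ hxy _ ih =>
    have hyx := (heq i).symm hxy
    have h1 : c i y x = (c i x y)⁻¹ := by
      have h2 := hc i x x x ((heq i).refl x) ((heq i).refl x)
      have h3 := hc i x y x hxy hyx
      have h4 : c i x x = 1 := by simpa using h2
      rw [h4] at h3
      exact eq_inv_of_mul_eq_one_right h3
    have := ih.trans (.cons hyx (.nil x))
    rwa [mul_one, h1, ← mul_inv_rev] at this

theorem CocyclePath.eq_one_of_closed (hr : IndepRel r) (heq : ∀ i, Equivalence (r i))
    (hc : ∀ i x y z, r i x y → r i y z → c i x y * c i y z = c i x z)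
    {x : X} {γ : F} (h : CocyclePath r c x x γ) : γ = 1 := by
  have key : ∀ {x y : X} {γ : F}, CocyclePath r c x y γ → ∃ o, ReducedPath r c x y γ o := by
    intro x y γ h
    induction h with
    | nil x => exact ⟨_, .nil x⟩
    | cons hxy _ ih =>
      obtain ⟨o, ho⟩ := ih
      exact ho.exists_cons heq hc hxy
  obtain ⟨o, ho⟩ := key h
  exact ho.eq_one_of_closed hr

/-- Cocycles on the factors of a free product extend to a coboundary on each class. -/
theorem IndepRel.exists_potential (hr : IndepRel r) (heq : ∀ i, Equivalence (r i))
    (hc : ∀ i x y z, r i x y → r i y z → c i x y * c i y z = c i x z) :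
    ∃ b : X → F, ∀ i x y, r i x y → c i x y = b x * (b y)⁻¹ := by
  let s : Setoid X :=
    { r := fun x y => ∃ γ, CocyclePath r c x y γ
      iseqv := ⟨fun x => ⟨1, .nil x⟩, fun ⟨γ, h⟩ => ⟨γ⁻¹, h.symm heq hc⟩,
        fun ⟨γ, h⟩ ⟨δ, h'⟩ => ⟨γ * δ, h.trans h'⟩⟩ }
  have hout : ∀ x, ∃ γ, CocyclePath r c x (Quotient.mk s x).out γ := fun x =>
    s.iseqv.symm (Quotient.exact (Quotient.out_eq (Quotient.mk s x)))
  choose b hb using hout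
  refine ⟨b, fun i x y hxy => ?_⟩
  have hx := hb x
  have hq : Quotient.mk s x = Quotient.mk s y :=
    Quotient.sound ⟨_, .cons hxy (.nil y)⟩
  rw [hq] at hx
  have := (CocyclePath.cons hxy ((hb y).trans (hx.symm heq hc))).eq_one_of_closed hr heq hc
  rw [← mul_assoc] at this
  have h2 := eq_inv_of_mul_eq_one_left this
  rw [inv_inv] at h2
  exact eq_mul_inv_of_mul_eq h2

/-- A family of relations is freely independent as soon as some function into a free product of
groups turns nontrivial steps into nontrivial letters. -/
theorem IndepRel.of_coprodI {Γ : Type} [Group Γ]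
    (b : X → Monoid.CoprodI fun _ : ι => Γ)
    (hb : ∀ i x y, r i x y → x ≠ y →
      ∃ γ : Γ, γ ≠ 1 ∧ b x * (b y)⁻¹ = Monoid.CoprodI.of (M := fun _ : ι => Γ) (i := i) γ) :
    IndepRel r := by
  intro n x i hn hclosed hne hr
  by_contra hcon
  push Not at hcon
  have key : ∀ m, m < n → ∃ w : Monoid.CoprodI.NeWord (fun _ : ι => Γ) (i 0) (i m),
      w.prod = b (x 0) * (b (x (m + 1)))⁻¹ := by
    intro m
    induction m with
    | zero =>
      intro h
      obtain ⟨γ, hγ, hb'⟩ := hb _ _ _ (hr 0 h) (hne 0 h)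
      exact ⟨.singleton γ hγ, by simp [hb']⟩
    | succ m ih =>
      intro h
      obtain ⟨w, hw⟩ := ih (by omega)
      obtain ⟨γ, hγ, hb'⟩ := hb _ _ _ (hr _ h) (hne _ h)
      refine ⟨w.append (hcon m h) (.singleton γ hγ), ?_⟩
      rw [Monoid.CoprodI.NeWord.append_prod, hw, Monoid.CoprodI.NeWord.prod_singleton, ← hb']
      group
  obtain ⟨w, hw⟩ := key (n - 1) (by omega)
  rw [show n - 1 + 1 = n by omega, hclosed, mul_inv_cancel] at hw
  have h1 : w.toWord.prod =
      (Monoid.CoprodI.Word.empty : Monoid.CoprodI.Word fun _ : ι => Γ).prod := by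
    rw [Monoid.CoprodI.Word.prod_empty]
    exact hw
  classical
  have h2 : w.toWord = Monoid.CoprodI.Word.empty := Monoid.CoprodI.Word.equiv.symm.injective h1
  exact w.toList_ne_nil (congrArg Monoid.CoprodI.Word.toList h2)

end Combinatorics

section Amplification

/-- The basis element attached to `u` in the free abelian group on `U`, written multiplicatively. -/
noncomputable def basisElt {U : Type} (u : U) : Multiplicative (U →₀ ℤ) :=
  Multiplicative.ofAdd (Finsupp.single u 1)

theorem basisElt_injective {U : Type} : Function.Injective (basisElt (U := U)) := fun _ _ h =>
  Finsupp.single_left_injective one_ne_zero (Multiplicative.ofAdd.injective h)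

theorem basisElt_mul_inv_ne_one {U : Type} {u v : U} (h : u ≠ v) :
    basisElt u * (basisElt v)⁻¹ ≠ 1 := fun h' =>
  h (basisElt_injective (mul_inv_eq_one.mp h'))

variable {W Y ι : Type}

/-- The family of relations on `W` induced by a family `r` on `Y` through `p : W → Y`: the factor
`i₀` contains the fibres of `p`, the other factors live on the transversal `Z`. -/
def amplified (E : W → W → Prop) (p : W → Y) (Z : Set W) (i₀ : ι) (r : ι → Y → Y → Prop) (i : ι)
    (w w' : W) : Prop :=
  w = w' ∨ (E w w' ∧ r i (p w) (p w') ∧ (i = i₀ ∨ (w ∈ Z ∧ w' ∈ Z)))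

variable {E : W → W → Prop} {p : W → Y} {Z : Set W} {i₀ : ι} {r : ι → Y → Y → Prop}

theorem amplified_equivalence (hE : Equivalence E) (heq : ∀ i, Equivalence (r i)) (i : ι) :
    Equivalence (amplified E p Z i₀ r i) where
  refl _ := Or.inl rfl
  symm := by
    rintro x y (h | ⟨h1, h2, h3⟩)
    · exact Or.inl h.symm
    · exact Or.inr ⟨hE.symm h1, (heq i).symm h2, h3.imp id And.symm⟩
  trans := by
    rintro x y z (rfl | ⟨h1, h2, h3⟩) (rfl | ⟨h1', h2', h3'⟩)
    · exact Or.inl rfl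
    · exact Or.inr ⟨h1', h2', h3'⟩
    · exact Or.inr ⟨h1, h2, h3⟩
    · refine Or.inr ⟨hE.trans h1 h1', (heq i).trans h2 h2', ?_⟩
      tauto

theorem amplified_indepRel (hr : IndepRel r) (heq : ∀ i, Equivalence (r i))
    (hZ : ∀ w ∈ Z, ∀ w' ∈ Z, E w w' → p w = p w' → w = w') :
    IndepRel (amplified E p Z i₀ r) := by
  classical
  let of : ι → Multiplicative ((Y ⊕ W) →₀ ℤ) →*
      Monoid.CoprodI fun _ : ι => Multiplicative ((Y ⊕ W) →₀ ℤ) :=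
    fun i => Monoid.CoprodI.of (M := fun _ : ι => Multiplicative ((Y ⊕ W) →₀ ℤ)) (i := i)
  obtain ⟨b, hb⟩ := hr.exists_potential heq
    (c := fun i y y' => of i (basisElt (Sum.inl y) * (basisElt (Sum.inl y'))⁻¹)) (by
      intro i x y z _ _
      rw [← map_mul]
      congr 1
      group)
  let u : W → Y ⊕ W := fun w => if w ∈ Z then Sum.inl (p w) else Sum.inr w
  refine IndepRel.of_coprodI
    (fun w => of i₀ (basisElt (u w) * (basisElt (Sum.inl (p w)))⁻¹) * b (p w)) ?_
  rintro i w w' (h | ⟨hE, hri, hi⟩) hne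
  · exact absurd h hne
  have hbb := hb i _ _ hri
  have huu : u w ≠ u w' := by
    simp only [u]
    split_ifs with h1 h2 h2
    · exact fun h => hne (hZ w h1 w' h2 hE (Sum.inl_injective h))
    · simp
    · simp
    · exact fun h => hne (Sum.inr_injective h)
  have hcalc : ∀ s s' : Monoid.CoprodI fun _ : ι => Multiplicative ((Y ⊕ W) →₀ ℤ),
      s * b (p w) * (s' * b (p w'))⁻¹ = s * (b (p w) * (b (p w'))⁻¹) * s'⁻¹ := by
    intro s s'
    group
  refine ⟨basisElt (u w) * (basisElt (u w'))⁻¹, basisElt_mul_inv_ne_one huu, ?_⟩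
  rw [hcalc, ← hbb]
  rcases hi with rfl | ⟨h1, h2⟩
  · change _ = of i _
    rw [← map_mul, ← map_inv, ← map_mul]
    congr 1
    rw [mul_inv_rev, inv_inv, mul_assoc, mul_assoc, mul_assoc]
    simp
  · simp only [u, h1, h2, if_true, mul_inv_cancel, map_one, one_mul, inv_one, mul_one]
    rfl

theorem amplified_generates (hE : Equivalence E) (heq : ∀ i, Equivalence (r i))
    (hcov : ∀ w, ∃ z ∈ Z, E w z ∧ p z = p w)
    (hlift : ∀ i w y, r i (p w) y → ∃ w', E w w' ∧ p w' = y)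
    (hgen : ∀ w w', E w w' → Relation.EqvGen (fun a b => ∃ i, r i a b) (p w) (p w'))
    {w w' : W} (h : E w w') :
    Relation.EqvGen (fun a b => ∃ i, amplified E p Z i₀ r i a b) w w' := by
  have hfib : ∀ a b, E a b → p a = p b →
      Relation.EqvGen (fun a b => ∃ i, amplified E p Z i₀ r i a b) a b := fun a b hab hp =>
    .rel _ _ ⟨i₀, Or.inr ⟨hab, hp ▸ (heq i₀).refl _, Or.inl rfl⟩⟩
  have hstep : ∀ i a b, E a b → r i (p a) (p b) →
      Relation.EqvGen (fun a b => ∃ i, amplified E p Z i₀ r i a b) a b := by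
    intro i a b hab hi
    obtain ⟨a', ha', hEa, hpa⟩ := hcov a
    obtain ⟨b', hb', hEb, hpb⟩ := hcov b
    refine .trans _ _ _ (hfib a a' hEa hpa.symm) (.trans _ _ _ (.rel _ _ ⟨i, Or.inr ⟨?_, ?_,
      Or.inr ⟨ha', hb'⟩⟩⟩) (hfib b' b (hE.symm hEb) hpb))
    · exact hE.trans (hE.symm hEa) (hE.trans hab hEb)
    · rwa [hpa, hpb]
  have hpath : ∀ y y', Relation.EqvGen (fun a b => ∃ i, r i a b) y y' → (∀ a, p a = y →
      ∃ b, E a b ∧ p b = y' ∧ Relation.EqvGen (fun a b => ∃ i, amplified E p Z i₀ r i a b) a b) ∧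
      (∀ a, p a = y' →
      ∃ b, E a b ∧ p b = y ∧ Relation.EqvGen (fun a b => ∃ i, amplified E p Z i₀ r i a b) a b) := by
    intro y y' hy
    induction hy with
    | rel y y' h =>
      obtain ⟨i, hi⟩ := h
      constructor
      · rintro a rfl
        obtain ⟨b, hab, rfl⟩ := hlift i a y' hi
        exact ⟨b, hab, rfl, hstep i a b hab hi⟩
      · rintro a rfl
        obtain ⟨b, hab, rfl⟩ := hlift i a y ((heq i).symm hi)
        exact ⟨b, hab, rfl, hstep i a b hab ((heq i).symm hi)⟩
    | refl y =>
      exact ⟨fun a ha => ⟨a, hE.refl a, ha, .refl a⟩, fun a ha => ⟨a, hE.refl a, ha, .refl a⟩⟩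
    | symm y y' _ ih => exact ⟨ih.2, ih.1⟩
    | trans x y z _ _ ih1 ih2 =>
      constructor
      · intro a ha
        obtain ⟨b, hab, hb, hab'⟩ := ih1.1 a ha
        obtain ⟨d, hbd, hd, hbd'⟩ := ih2.1 b hb
        exact ⟨d, hE.trans hab hbd, hd, .trans _ _ _ hab' hbd'⟩
      · intro a ha
        obtain ⟨b, hab, hb, hab'⟩ := ih2.2 a ha
        obtain ⟨d, hbd, hd, hbd'⟩ := ih1.2 b hb
        exact ⟨d, hE.trans hab hbd, hd, .trans _ _ _ hab' hbd'⟩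
  obtain ⟨b, hwb, hb, hwb'⟩ := (hpath _ _ (hgen w w' h)).1 w rfl
  exact .trans _ _ _ hwb' (hfib b w' (hE.trans (hE.symm hwb) h) hb)

end Amplification

section Selection

theorem exists_measurable_selection {β W : Type} [MeasurableSpace W] [Countable β] [Nonempty β]
    (P : β → Set W) (hP : ∀ b, MeasurableSet (P b)) :
    ∃ s : W → β, (∀ b, MeasurableSet {w | s w = b}) ∧ (∀ w, (∃ b, w ∈ P b) → w ∈ P (s w)) ∧
      ∀ w w', (∀ b, w ∈ P b ↔ w' ∈ P b) → s w = s w' := by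
  classical
  let _ := Encodable.ofCountable β
  have hS : ∀ T : Set β, ∃ b, T.Nonempty → b ∈ T ∧
      ∀ b' ∈ T, Encodable.encode b ≤ Encodable.encode b' := by
    intro T
    by_cases hT : T.Nonempty
    · have hex : ∃ n, ∃ b ∈ T, Encodable.encode b = n := ⟨_, hT.some, hT.some_mem, rfl⟩
      obtain ⟨b, hb, hbn⟩ := Nat.find_spec hex
      exact ⟨b, fun _ => ⟨hb, fun b' hb' => hbn ▸ Nat.find_min' hex ⟨b', hb', rfl⟩⟩⟩
    · exact ⟨Classical.arbitrary β, fun h => absurd h hT⟩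
  choose S hS using hS
  refine ⟨fun w => S {b | w ∈ P b}, fun b => ?_, fun w hw => (hS {b | w ∈ P b} hw).1,
    fun w w' h => congrArg S (Set.ext h)⟩
  have : {w | S {b | w ∈ P b} = b} =
      (P b ∩ ⋂ b', ⋂ (_ : Encodable.encode b' < Encodable.encode b), (P b')ᶜ) ∪
      ((⋂ b', (P b')ᶜ) ∩ {_w | S ∅ = b}) := by
    ext w
    simp only [Set.mem_ofPred_eq, Set.mem_union, Set.mem_inter_iff, Set.mem_iInter,
      Set.mem_compl_iff]
    by_cases hT : ({b | w ∈ P b} : Set β).Nonempty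
    · have h := hS _ hT
      constructor
      · rintro rfl
        exact Or.inl ⟨h.1, fun b' hb' hw => absurd (h.2 b' hw) (by omega)⟩
      · rintro (⟨h1, h2⟩ | ⟨h1, _⟩)
        · have h3 := h.2 b h1
          have h4 : ¬ Encodable.encode (S {b | w ∈ P b}) < Encodable.encode b :=
            fun hlt => h2 _ hlt h.1
          exact Encodable.encode_injective (by omega)
        · exact absurd hT.some_mem (h1 _)
    · have hT' := Set.not_nonempty_iff_eq_empty.mp hT
      rw [hT']
      constructor
      · exact fun h => Or.inr ⟨fun b' hb' => hT ⟨b', hb'⟩, h⟩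
      · rintro (⟨h1, _⟩ | ⟨_, h⟩)
        · exact absurd ⟨b, h1⟩ hT
        · exact h
  rw [this]
  refine ((hP b).inter (.iInter fun b' => .iInter fun _ => (hP b').compl)).union
    ((MeasurableSet.iInter fun b' => (hP b').compl).inter ?_)
  exact .const _

theorem exists_least_nat {P : ℕ → Prop} (h : ∃ n, P n) : ∃ n, P n ∧ ∀ m < n, ¬ P m := by
  classical
  exact ⟨Nat.find h, Nat.find_spec h, fun m hm => Nat.find_min h hm⟩

theorem measurable_countable_choice {β W V : Type} [MeasurableSpace W] [MeasurableSpace V]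
    [Countable β] {s : W → β} (hs : ∀ b, MeasurableSet {w | s w = b}) {g : β → W → V}
    (hg : ∀ b, Measurable (g b)) : Measurable fun w => g (s w) w := by
  intro B hB
  have : (fun w => g (s w) w) ⁻¹' B = ⋃ b, {w | s w = b} ∩ g b ⁻¹' B := by
    ext w
    simp
  rw [this]
  exact .iUnion fun b => (hs b).inter (hg b hB)

end Selection

section Forest

variable {W ι K : Type} [MeasurableSpace W] [StandardBorelSpace W] [Countable ι] [Nonempty ι]
  [Group K] [Countable K] [MulAction K W] [MeasurableConstSMul K W]

/-- The measurable set where a Borel relation holds between two measurable functions. -/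
theorem measurableSet_rel {V U : Type} [MeasurableSpace V] [MeasurableSpace U] {e : V → V → Prop}
    (he : MeasurableSet {p : V × V | e p.1 p.2}) {g g' : U → V} (hg : Measurable g)
    (hg' : Measurable g') : MeasurableSet {u | e (g u) (g' u)} :=
  (hg.prodMk hg') he

/-- A Borel forest with steps in the factors of a free product, rooted at a complete section. -/
theorem exists_forest {e : ι → W → W → Prop} (heq : ∀ i, Equivalence (e i))
    (hem : ∀ i, MeasurableSet {p : W × W | e i p.1 p.2})
    (hK : ∀ i w w', e i w w' → ∃ k : K, k • w = w')
    (hconn : ∀ w (k : K), Relation.EqvGen (fun a b => ∃ i, e i a b) w (k • w))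
    {A : Set W} (hA : MeasurableSet A) (hcov : ∀ w, ∃ k : K, k • w ∈ A) :
    ∃ (j : W → ι) (q f : W → W) (ℓ : W → K), (∀ i, MeasurableSet {w | j w = i}) ∧ Measurable f ∧
      (∀ k, MeasurableSet {w | ℓ w = k}) ∧ (∀ w, f w ∈ A) ∧ (∀ w, ℓ w • w = f w) ∧
      (∀ a ∈ A, f a = a) ∧
      (∀ w ∉ A, e (j w) w (q w) ∧ f (q w) = f w ∧ (q w ∈ A ∨ j (q w) ≠ j w)) ∧
      (∀ {F : Type} (b : W → F), (∀ w ∉ A, b w = b (q w)) → ∀ w, b w = b (f w)) := by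
  classical
  let D : ℕ → Set W := fun n =>
    Nat.rec A (fun _ S => {w | ∃ i, ∃ k : K, e i w (k • w) ∧ k • w ∈ S}) n
  have hD0 : D 0 = A := rfl
  have hDs : ∀ n w, w ∈ D (n + 1) ↔ ∃ i, ∃ k : K, e i w (k • w) ∧ k • w ∈ D n := fun n w => Iff.rfl
  have hem' : ∀ i (k : K), MeasurableSet {w | e i w (k • w)} := fun i k =>
    measurableSet_rel (hem i) measurable_id (measurable_const_smul k)
  have hDm : ∀ n, MeasurableSet (D n) := by
    intro n
    induction n with
    | zero => exact hA
    | succ n ih =>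
      have : D (n + 1) = ⋃ i, ⋃ k : K, {w | e i w (k • w)} ∩ (fun w => k • w) ⁻¹' D n := by
        ext w
        simp [hDs]
      rw [this]
      exact .iUnion fun i => .iUnion fun k => (hem' i k).inter (measurable_const_smul k ih)
  have hDe : ∀ i w w', e i w w' → (∃ n, w ∈ D n) → ∃ n, w' ∈ D n := by
    rintro i w w' h ⟨n, hn⟩
    obtain ⟨k, rfl⟩ := hK i w w' h
    exact ⟨n + 1, i, k⁻¹, by simpa using (heq i).symm h, by simpa using hn⟩
  have hDall : ∀ w, ∃ n, w ∈ D n := by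
    have key : ∀ x y, Relation.EqvGen (fun a b => ∃ i, e i a b) x y →
        ((∃ n, x ∈ D n) ↔ ∃ n, y ∈ D n) := by
      intro x y h
      induction h with
      | rel x y h =>
        obtain ⟨i, hi⟩ := h
        exact ⟨hDe i x y hi, hDe i y x ((heq i).symm hi)⟩
      | refl => rfl
      | symm _ _ _ ih => exact ih.symm
      | trans _ _ _ _ _ ih1 ih2 => exact ih1.trans ih2
    intro w
    obtain ⟨k, hk⟩ := hcov w
    exact (key _ _ (hconn w k)).mpr ⟨0, hk⟩
  let P : ι × K → Set W := fun a =>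
    {w | e a.1 w (a.2 • w) ∧ ∃ m, a.2 • w ∈ D m ∧ ∀ m' ≤ m, w ∉ D m'}
  have hPm : ∀ a, MeasurableSet (P a) := by
    intro a
    have : P a = {w | e a.1 w (a.2 • w)} ∩ ⋃ m, ((fun w => a.2 • w) ⁻¹' D m ∩
        ⋂ m', ⋂ (_ : m' ≤ m), (D m')ᶜ) := by
      ext w
      simp [P]
    rw [this]
    exact (hem' _ _).inter (.iUnion fun m => (measurable_const_smul _ (hDm m)).inter
      (.iInter fun m' => .iInter fun _ => (hDm m').compl))
  obtain ⟨s, hsm, hsP, -⟩ := exists_measurable_selection P hPm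
  have hsP' : ∀ w ∉ A, w ∈ P (s w) := by
    intro w hw
    refine hsP w ?_
    obtain ⟨n₀, hspec, hmin⟩ := exists_least_nat (hDall w)
    obtain ⟨n, rfl⟩ : ∃ n, n₀ = n + 1 :=
      Nat.exists_eq_succ_of_ne_zero fun h0 => hw (by rw [h0] at hspec; exact hspec)
    obtain ⟨i, k, h1, h2⟩ := hspec
    exact ⟨(i, k), h1, n, h2, fun m' hm' => hmin m' (by omega)⟩
  let q : W → W := fun w => if w ∈ A then w else (s w).2 • w
  have hqA : ∀ w ∈ A, q w = w := fun w hw => if_pos hw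
  have hqnA : ∀ w, w ∉ A → q w = (s w).2 • w := fun w hw => if_neg hw
  have hqm : Measurable q :=
    Measurable.ite hA measurable_id (measurable_countable_choice hsm
      (g := fun a w => a.2 • w) fun a => measurable_const_smul a.2)
  have hqK : ∀ w, ∃ k : K, k • w = q w := by
    intro w
    by_cases hw : w ∈ A
    · exact ⟨1, by rw [hqA w hw, one_smul]⟩
    · exact ⟨_, (hqnA w hw).symm⟩
  have hreach : ∀ n, ∀ w ∈ D n, ∃ m, q^[m] w ∈ A := by
    intro n
    induction n using Nat.strong_induction_on with
    | _ n ih =>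
      intro w hw
      by_cases hwA : w ∈ A
      · exact ⟨0, hwA⟩
      · obtain ⟨-, m, hm, hm'⟩ := hsP' w hwA
        have hlt : m < n := by
          by_contra hge
          exact hm' n (by omega) hw
        obtain ⟨t, ht⟩ := ih m hlt (q w) (by rw [hqnA w hwA]; exact hm)
        exact ⟨t + 1, by rwa [Function.iterate_succ_apply]⟩
  have hfix : ∀ w m, q^[m] w ∈ A → ∀ t, q^[m + t] w = q^[m] w := by
    intro w m hm t
    rw [add_comm, Function.iterate_add_apply]
    exact Function.iterate_fixed (hqA _ hm) t
  have huniq : ∀ w m t, q^[m] w ∈ A → q^[t] w ∈ A → q^[m] w = q^[t] w := by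
    intro w m t hm ht
    rw [← hfix w m hm t, ← hfix w t ht m, add_comm]
  obtain ⟨N, hNm, hN, -⟩ := exists_measurable_selection (fun n => q^[n] ⁻¹' A)
    (fun n => (hqm.iterate n) hA)
  have hN' : ∀ w, q^[N w] w ∈ A := fun w => hN w (hreach _ w (hDall w).choose_spec)
  let f : W → W := fun w => q^[N w] w
  have hfm : Measurable f := measurable_countable_choice hNm (g := fun n => q^[n])
    fun n => hqm.iterate n
  have hiterK : ∀ n w, ∃ k : K, k • w = q^[n] w := by
    intro n
    induction n with
    | zero => exact fun w => ⟨1, one_smul _ _⟩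
    | succ n ih =>
      intro w
      obtain ⟨k, hk⟩ := hqK w
      obtain ⟨k', hk'⟩ := ih (q w)
      exact ⟨k' * k, by rw [mul_smul, hk, hk', Function.iterate_succ_apply]⟩
  obtain ⟨ℓ, hℓm, hℓ, -⟩ := exists_measurable_selection (fun k : K => {w | k • w = f w})
    (fun k => measurableSet_eq_fun (measurable_const_smul k) hfm)
  refine ⟨fun w => (s w).1, q, f, ℓ, fun i => ?_, hfm, hℓm, hN', fun w => hℓ w (hiterK _ w),
    fun a ha => huniq a _ 0 (hN' a) ha, fun w hw => ⟨?_, ?_, ?_⟩, fun b hb w => ?_⟩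
  · have : {w | (s w).1 = i} = ⋃ k, {w | s w = (i, k)} := by
      ext w
      simp [Prod.ext_iff]
    rw [this]
    exact .iUnion fun k => hsm _
  · rw [hqnA w hw]
    exact (hsP' w hw).1
  · exact huniq w (N (q w) + 1) (N w) (by rw [Function.iterate_succ_apply]; exact hN' _) (hN' w)
  · by_contra hcon
    push Not at hcon
    obtain ⟨hq, hj⟩ := hcon
    obtain ⟨h1, m1, h1m, h1'⟩ := hsP' w hw
    obtain ⟨h2, m2, h2m, h2'⟩ := hsP' (q w) hq
    rw [← hqnA w hw] at h1 h1m
    have hw2 : w ∈ D (m2 + 1) := by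
      refine ⟨(s w).1, (s (q w)).2 * (s w).2, ?_, ?_⟩
      · rw [mul_smul, ← hqnA w hw]
        rw [hj] at h2
        exact (heq _).trans h1 h2
      · rw [mul_smul, ← hqnA w hw]
        exact h2m
    have h3 : ¬ m2 + 1 ≤ m1 := fun h => h1' _ h hw2
    have h4 : ¬ m1 ≤ m2 := fun h => h2' _ h h1m
    omega
  · have hbq : ∀ w, b w = b (q w) := fun w => by
      by_cases hw : w ∈ A
      · rw [hqA w hw]
      · exact hb w hw
    have : ∀ n w, b w = b (q^[n] w) := by
      intro n
      induction n with
      | zero => exact fun w => rfl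
      | succ n ih => exact fun w => by rw [Function.iterate_succ_apply, ← ih, ← hbq]
    exact this _ w

end Forest

section SepBit

variable {W : Type}

/-- `a` and `a'` first differ at the bit `nb.1`, where `a` has the value `nb.2`. -/
def SepBit (β : W → ℕ → Bool) (nb : ℕ × Bool) (a a' : W) : Prop :=
  β a nb.1 = nb.2 ∧ β a' nb.1 ≠ nb.2 ∧ ∀ m < nb.1, β a m = β a' m

theorem SepBit.unique {β : W → ℕ → Bool} {nb nb' : ℕ × Bool} {a a' : W} (h : SepBit β nb a a')
    (h' : SepBit β nb' a a') : nb = nb' := by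
  obtain ⟨n, b⟩ := nb
  obtain ⟨n', b'⟩ := nb'
  obtain ⟨h1, h2, h3⟩ := h
  obtain ⟨h1', h2', h3'⟩ := h'
  simp only at *
  have hn : n = n' := by
    rcases lt_trichotomy n n' with hlt | rfl | hlt
    · exact absurd (h3' n hlt) (fun h => h2 (h ▸ h1))
    · rfl
    · exact absurd (h3 n' hlt) (fun h => h2' (h ▸ h1'))
  subst hn
  rw [← h1, ← h1']

theorem exists_sepBit {β : W → ℕ → Bool} (hβ : Function.Injective β) {a a' : W} (h : a ≠ a') :
    ∃ nb, SepBit β nb a a' := by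
  obtain ⟨n, hn, hmin⟩ := exists_least_nat (Function.ne_iff.mp (hβ.ne h))
  exact ⟨(n, β a n), rfl, fun h => hn h.symm, fun m hm => not_not.mp (hmin m hm)⟩

end SepBit

section Kurosh

variable {W ι K : Type} [MeasurableSpace W] [Group K] [MulAction K W]

/-- The Borel data used to restrict a free product with factors `e i` to a complete section `A`:
a retraction `f` onto `A` with displacement `ℓ`, sections `X i` of `e i`, retractions `t i` onto
them along the edges of a forest, and a base point `ρ i w` in the trace of every class on `X i`. -/
structure KuroshData (K : Type) [Group K] [MulAction K W] (e : ι → W → W → Prop) (A : Set W) where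
  f : W → W
  ℓ : W → K
  X : ι → Set W
  t : ι → W → W
  ρ : ι → W → W
  κ : ι → W → K
  f_meas : Measurable f
  ℓ_meas : ∀ k, MeasurableSet {w | ℓ w = k}
  X_meas : ∀ i, MeasurableSet (X i)
  ρ_meas : ∀ i, Measurable (ρ i)
  κ_meas : ∀ i k, MeasurableSet {w | κ i w = k}
  f_mem : ∀ w, f w ∈ A
  ℓ_smul : ∀ w, ℓ w • w = f w
  f_id : ∀ a ∈ A, f a = a
  t_mem : ∀ i w, t i w ∈ X i
  t_rel : ∀ i w, e i w (t i w)
  t_id : ∀ i, ∀ w ∈ X i, t i w = w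
  f_t : ∀ i w, f (t i w) = f w
  ρ_mem : ∀ i w, ρ i w ∈ X i
  ρ_rel : ∀ i w, e i w (ρ i w)
  ℓ_ρ : ∀ i w, ℓ (ρ i w) = κ i w
  κ_inv : ∀ i w w', e i w w' → κ i w = κ i w'
  ρ_id : ∀ i, ∀ w ∈ X i, ℓ w = κ i w → ρ i w = w
  descend : ∀ {F : Type} (b : W → F), (∀ i w, b w = b (t i w)) → ∀ w, b w = b (f w)

theorem exists_kuroshData [StandardBorelSpace W] [Countable ι] [Nonempty ι] [Countable K]
    [MeasurableConstSMul K W] {e : ι → W → W → Prop} (heq : ∀ i, Equivalence (e i))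
    (hem : ∀ i, MeasurableSet {p : W × W | e i p.1 p.2})
    (hK : ∀ i w w', e i w w' → ∃ k : K, k • w = w')
    (hconn : ∀ w (k : K), Relation.EqvGen (fun a b => ∃ i, e i a b) w (k • w))
    {A : Set W} (hA : MeasurableSet A) (hcov : ∀ w, ∃ k : K, k • w ∈ A) :
    Nonempty (KuroshData K e A) := by
  classical
  obtain ⟨j, q, f, ℓ, hj, hf, hℓ, hfA, hℓf, hfid, hq, hdesc⟩ :=
    exists_forest heq hem hK hconn hA hcov
  let X : ι → Set W := fun i => {w | w ∈ A ∨ j w ≠ i}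
  have hX : ∀ i, MeasurableSet (X i) := fun i => hA.union (hj i).compl
  have hem' : ∀ i (k : K), MeasurableSet {w | e i w (k • w)} := fun i k =>
    measurableSet_rel (hem i) measurable_id (measurable_const_smul k)
  let t : ι → W → W := fun i w => if w ∈ X i then w else q w
  have ht_pos : ∀ i, ∀ w ∈ X i, t i w = w := fun i w hw => if_pos hw
  have ht_neg : ∀ i w, w ∉ X i → t i w = q w := fun i w hw => if_neg hw
  have hXn : ∀ i w, w ∉ X i → w ∉ A ∧ j w = i := fun i w hw => by
    simpa [X, not_or] using hw
  have htX : ∀ i w, t i w ∈ X i := by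
    intro i w
    by_cases hw : w ∈ X i
    · rwa [ht_pos i w hw]
    · obtain ⟨h1, rfl⟩ := hXn i w hw
      rw [ht_neg _ w hw]
      exact (hq w h1).2.2
  have htR : ∀ i w, e i w (t i w) := by
    intro i w
    by_cases hw : w ∈ X i
    · rw [ht_pos i w hw]
      exact (heq i).refl w
    · obtain ⟨h1, rfl⟩ := hXn i w hw
      rw [ht_neg _ w hw]
      exact (hq w h1).1
  let Q : ι → K → Set W := fun i k => {w | ∃ m : K, e i w (m • w) ∧ m • w ∈ X i ∧ ℓ (m • w) = k}
  have hQm : ∀ i k, MeasurableSet (Q i k) := by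
    intro i k
    have : Q i k = ⋃ m : K, {w | e i w (m • w)} ∩ (fun w => m • w) ⁻¹' (X i ∩ {w | ℓ w = k}) := by
      ext w
      simp [Q]
    rw [this]
    exact .iUnion fun m => (hem' i m).inter (measurable_const_smul m ((hX i).inter (hℓ k)))
  have hQex : ∀ i w, ∃ k, w ∈ Q i k := by
    intro i w
    obtain ⟨m, hm⟩ := hK i w _ (htR i w)
    exact ⟨_, m, hm ▸ htR i w, hm ▸ htX i w, rfl⟩
  have hQinv : ∀ i w w', e i w w' → ∀ k, w ∈ Q i k → w' ∈ Q i k := by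
    rintro i w w' h k ⟨m, h1, h2, h3⟩
    obtain ⟨k', rfl⟩ := hK i _ _ h
    exact ⟨m * k'⁻¹, by simpa [mul_smul] using (heq i).trans ((heq i).symm h) h1,
      by simpa [mul_smul] using h2, by simpa [mul_smul] using h3⟩
  choose κ hκm hκQ hκc using fun i => exists_measurable_selection (Q i) (hQm i)
  let M : ι → K → Set W := fun i m =>
    {w | e i w (m • w) ∧ m • w ∈ X i ∧ ∃ k, ℓ (m • w) = k ∧ κ i w = k}
  have hMm : ∀ i m, MeasurableSet (M i m) := by
    intro i m
    have : M i m = {w | e i w (m • w)} ∩ ((fun w => m • w) ⁻¹' X i ∩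
        ⋃ k, ((fun w => m • w) ⁻¹' {w | ℓ w = k} ∩ {w | κ i w = k})) := by
      ext w
      simp [M]
    rw [this]
    exact (hem' i m).inter ((measurable_const_smul m (hX i)).inter
      (.iUnion fun k => (measurable_const_smul m (hℓ k)).inter (hκm i k)))
  choose s hsm hsM _ using fun i => exists_measurable_selection (M i) (hMm i)
  have hs : ∀ i w, w ∈ M i (s i w) := by
    intro i w
    refine hsM i w ?_
    obtain ⟨m, h1, h2, h3⟩ := hκQ i w (hQex i w)
    exact ⟨m, h1, h2, _, h3, rfl⟩
  let T : ι → Set W := fun i => X i ∩ {w | ∃ k, ℓ w = k ∧ κ i w = k}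
  have hT : ∀ i, MeasurableSet (T i) := by
    intro i
    have : T i = X i ∩ ⋃ k, ({w | ℓ w = k} ∩ {w | κ i w = k}) := by
      ext w
      simp [T]
    rw [this]
    exact (hX i).inter (.iUnion fun k => (hℓ k).inter (hκm i k))
  let ρ : ι → W → W := fun i w => if w ∈ T i then w else s i w • w
  have hρ_pos : ∀ i, ∀ w ∈ T i, ρ i w = w := fun i w hw => if_pos hw
  have hρ_neg : ∀ i w, w ∉ T i → ρ i w = s i w • w := fun i w hw => if_neg hw
  have hρ : ∀ i w, e i w (ρ i w) ∧ ρ i w ∈ X i ∧ ℓ (ρ i w) = κ i w := by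
    intro i w
    by_cases hw : w ∈ T i
    · rw [hρ_pos i w hw]
      obtain ⟨h1, k, h2, h3⟩ := hw
      exact ⟨(heq i).refl w, h1, h2.trans h3.symm⟩
    · rw [hρ_neg i w hw]
      obtain ⟨h1, h2, k, h3, h4⟩ := hs i w
      exact ⟨h1, h2, h3.trans h4.symm⟩
  exact ⟨{
    f := f, ℓ := ℓ, X := X, t := t, ρ := ρ, κ := κ
    f_meas := hf, ℓ_meas := hℓ, X_meas := hX, κ_meas := hκm
    ρ_meas := fun i => Measurable.ite (hT i) measurable_id (measurable_countable_choice (hsm i)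
      (g := fun k w => k • w) fun k => measurable_const_smul k)
    f_mem := hfA, ℓ_smul := hℓf, f_id := hfid, t_mem := htX, t_rel := htR, t_id := ht_pos
    f_t := fun i w => by
      by_cases hw : w ∈ X i
      · rw [ht_pos i w hw]
      · rw [ht_neg i w hw]
        exact (hq w (hXn i w hw).1).2.1
    ρ_mem := fun i w => (hρ i w).2.1
    ρ_rel := fun i w => (hρ i w).1
    ℓ_ρ := fun i w => (hρ i w).2.2
    κ_inv := fun i w w' h => hκc i w w' fun k =>
      ⟨hQinv i w w' h k, hQinv i w' w ((heq i).symm h) k⟩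
    ρ_id := fun i w hw h => hρ_pos i w ⟨hw, _, h, rfl⟩
    descend := fun b hb => hdesc b fun w hw => by
      rw [hb (j w) w, ht_neg]
      simpa [X] using hw }⟩

theorem KuroshData.ρ_ρ {e : ι → W → W → Prop} {A : Set W} (d : KuroshData K e A) (i : ι) (w : W) :
    d.ρ i (d.ρ i w) = d.ρ i w :=
  d.ρ_id i _ (d.ρ_mem i w) (by rw [d.ℓ_ρ, d.κ_inv i _ _ (d.ρ_rel i w)])

theorem KuroshData.f_inv_smul {e : ι → W → W → Prop} {A : Set W} (d : KuroshData K e A) {k : K}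
    {a : W} (h : d.ℓ (k⁻¹ • a) = k) : d.f (k⁻¹ • a) = a := by
  rw [← d.ℓ_smul, h, smul_inv_smul]

end Kurosh

section KuroshFactors

variable {W ι K : Type} [MeasurableSpace W] [Group K] [MulAction K W] {e : ι → W → W → Prop}
  {A : Set W}

/-- The points moved by a gluing map. -/
def KuroshData.glueSet (d : KuroshData K e A) (β : W → ℕ → Bool) (c : ι × K × (ℕ × Bool)) : Set W :=
  {a | c.2.1⁻¹ • a ∈ d.X c.1 ∧ d.ℓ (c.2.1⁻¹ • a) = c.2.1 ∧
    SepBit β c.2.2 a (d.f (d.ρ c.1 (c.2.1⁻¹ • a)))}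

open Classical in
/-- A gluing map sends a point of `A` to the base point of the corresponding class. -/
noncomputable def KuroshData.glue (d : KuroshData K e A) (β : W → ℕ → Bool)
    (c : ι × K × (ℕ × Bool)) (a : W) : W :=
  if a ∈ d.glueSet β c then d.f (d.ρ c.1 (c.2.1⁻¹ • a)) else a

/-- The domain of a vertex factor of the restricted decomposition. -/
def KuroshData.vertexSet (d : KuroshData K e A) (c : ι × K) : Set W :=
  {a | c.2⁻¹ • a ∈ d.X c.1 ∧ d.ℓ (c.2⁻¹ • a) = c.2 ∧ d.κ c.1 (c.2⁻¹ • a) = c.2}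

/-- The factors of the restricted decomposition: vertex factors and gluing factors. -/
def KuroshData.fac (d : KuroshData K e A) (β : W → ℕ → Bool) :
    (ι × K) ⊕ (ι × K × (ℕ × Bool)) → W → W → Prop
  | .inl c, a, b => a ∈ d.vertexSet c ∧ b ∈ d.vertexSet c ∧ e c.1 (c.2⁻¹ • a) (c.2⁻¹ • b)
  | .inr c, a, b => d.glue β c a = d.glue β c b

/-- The domains of the factors of the restricted decomposition. -/
def KuroshData.facDom (d : KuroshData K e A) : (ι × K) ⊕ (ι × K × (ℕ × Bool)) → Set W
  | .inl c => d.vertexSet c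
  | .inr _ => Set.univ

variable {d : KuroshData K e A} {β : W → ℕ → Bool}

theorem KuroshData.glue_of_mem {c : ι × K × (ℕ × Bool)} {a : W} (h : a ∈ d.glueSet β c) :
    d.glue β c a = d.f (d.ρ c.1 (c.2.1⁻¹ • a)) := if_pos h

theorem KuroshData.glue_of_notMem {c : ι × K × (ℕ × Bool)} {a : W} (h : a ∉ d.glueSet β c) :
    d.glue β c a = a := if_neg h

theorem KuroshData.glue_glue (c : ι × K × (ℕ × Bool)) (a : W) :
    d.glue β c (d.glue β c a) = d.glue β c a := by
  by_cases h : a ∈ d.glueSet β c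
  · refine glue_of_notMem fun h' => ?_
    rw [glue_of_mem h] at h'
    exact h.2.2.2.1 h'.2.2.1
  · rw [glue_of_notMem h, glue_of_notMem h]

theorem KuroshData.exists_smul_eq_glue (hK : ∀ i w w', e i w w' → ∃ k : K, k • w = w')
    (c : ι × K × (ℕ × Bool)) (a : W) : ∃ k : K, k • a = d.glue β c a := by
  by_cases h : a ∈ d.glueSet β c
  · rw [glue_of_mem h, ← d.ℓ_smul]
    obtain ⟨k, hk⟩ := hK _ _ _ (d.ρ_rel c.1 (c.2.1⁻¹ • a))
    exact ⟨d.ℓ (d.ρ c.1 (c.2.1⁻¹ • a)) * k * c.2.1⁻¹, by rw [mul_smul, mul_smul, hk]⟩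
  · exact ⟨1, by rw [glue_of_notMem h, one_smul]⟩

theorem KuroshData.exists_smul_eq_of_fac (hK : ∀ i w w', e i w w' → ∃ k : K, k • w = w')
    {α : (ι × K) ⊕ (ι × K × (ℕ × Bool))} {a a' : W} (h : d.fac β α a a') :
    ∃ k : K, k • a = a' := by
  cases α with
  | inl c =>
    obtain ⟨k, hk⟩ := hK _ _ _ h.2.2
    exact ⟨c.2 * k * c.2⁻¹, by rw [mul_smul, mul_smul, hk, smul_inv_smul]⟩
  | inr c =>
    obtain ⟨k, hk⟩ := exists_smul_eq_glue (d := d) (β := β) hK c a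
    obtain ⟨k', hk'⟩ := exists_smul_eq_glue (d := d) (β := β) hK c a'
    refine ⟨k'⁻¹ * k, ?_⟩
    rw [mul_smul, hk, show d.glue β c a = d.glue β c a' from h, ← hk', inv_smul_smul]

theorem KuroshData.exists_glue_eq (hβ : Function.Injective β) (i : ι) {w : W} (hw : w ∈ d.X i) :
    ∃ c, d.fac β (.inr c) (d.f w) (d.f (d.ρ i w)) := by
  by_cases hne : d.f w = d.f (d.ρ i w)
  · exact ⟨(i, 1, 0, true), by rw [hne]; rfl⟩
  · obtain ⟨nb, hnb⟩ := exists_sepBit hβ hne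
    have hz : (d.ℓ w)⁻¹ • d.f w = w := by rw [← d.ℓ_smul, inv_smul_smul]
    have hmem : d.f w ∈ d.glueSet β (i, d.ℓ w, nb) := by
      refine ⟨?_, ?_, ?_⟩ <;> simp only [hz]
      · exact hw
      · exact hnb
    refine ⟨(i, d.ℓ w, nb), ?_⟩
    have h1 := glue_of_mem hmem
    simp only [hz] at h1
    have h2 := glue_glue (d := d) (β := β) (i, d.ℓ w, nb) (d.f w)
    rw [h1] at h2
    exact h1.trans h2.symm

theorem KuroshData.fac_indepRel (heq : ∀ i, Equivalence (e i)) (hr : IndepRel e) :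
    IndepRel fun α (a a' : A) => d.fac β α a a' := by
  classical
  let 𝒜 : Type := (ι × K) ⊕ (ι × K × (ℕ × Bool))
  let of : 𝒜 → Multiplicative (W →₀ ℤ) →* Monoid.CoprodI fun _ : 𝒜 => Multiplicative (W →₀ ℤ) :=
    fun α => Monoid.CoprodI.of (M := fun _ : 𝒜 => Multiplicative (W →₀ ℤ)) (i := α)
  let lab : W → W → ℕ × Bool := fun a a' =>
    if h : ∃ nb, SepBit β nb a a' then h.choose else (0, true)
  have hlab : ∀ {nb a a'}, SepBit β nb a a' → lab a a' = nb := fun {nb a a'} h => by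
    have hex : ∃ nb, SepBit β nb a a' := ⟨nb, h⟩
    exact (dif_pos hex).trans (hex.choose_spec.unique h)
  let s : ι → W → Monoid.CoprodI fun _ : 𝒜 => Multiplicative (W →₀ ℤ) := fun i z =>
    of (.inr (i, d.ℓ z, lab (d.f z) (d.f (d.ρ i z))))
      (basisElt (d.f z) * (basisElt (d.f (d.ρ i z)))⁻¹)
  have hs1 : ∀ i z, d.ρ i z = z → s i z = 1 := fun i z h => by
    simp only [s, h, mul_inv_cancel, map_one]
  obtain ⟨b, hb⟩ := hr.exists_potential heq
    (c := fun i z z' => s i (d.t i z) * of (.inl (i, d.κ i z))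
      (basisElt (d.f (d.ρ i (d.t i z))) * (basisElt (d.f (d.ρ i (d.t i z'))))⁻¹) *
      (s i (d.t i z'))⁻¹) (by
      intro i x y z hxy _
      simp only [d.κ_inv i x y hxy, map_mul, map_inv]
      group)
  have hbt : ∀ i w, b w = b (d.t i w) := fun i w => by
    have h := hb i w (d.t i w) (d.t_rel i w)
    rw [d.t_id i _ (d.t_mem i w)] at h
    simp only [mul_inv_cancel, map_one, mul_one] at h
    exact (mul_inv_eq_one.mp h.symm)
  have hbf : ∀ w, b w = b (d.f w) := d.descend b hbt
  have hvertex : ∀ (c : ι × K) (a a' : W), d.fac β (.inl c) a a' →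
      b a * (b a')⁻¹ = of (.inl c) (basisElt a * (basisElt a')⁻¹) := by
    rintro ⟨i, k⟩ a a' ⟨⟨h1, h2, h3⟩, ⟨h1', h2', h3'⟩, h⟩
    simp only at *
    have h4 := d.ρ_id i _ h1 (h2.trans h3.symm)
    have h4' := d.ρ_id i _ h1' (h2'.trans h3'.symm)
    have h5 := hb i _ _ h
    simp only [d.t_id i _ h1, d.t_id i _ h1', hs1 i _ h4, hs1 i _ h4', h4, h4', h3,
      d.f_inv_smul h2, d.f_inv_smul h2', hbf (k⁻¹ • a), hbf (k⁻¹ • a'), one_mul, inv_one,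
      mul_one] at h5
    exact h5.symm
  have hglue : ∀ (c : ι × K × (ℕ × Bool)) (a : W),
      b a * (b (d.glue β c a))⁻¹ = of (.inr c) (basisElt a * (basisElt (d.glue β c a))⁻¹) := by
    rintro ⟨i, l, nb⟩ a
    by_cases hm : a ∈ d.glueSet β (i, l, nb)
    · rw [glue_of_mem hm]
      obtain ⟨h1, h2, h3⟩ := hm
      simp only at *
      have h5 := hb i _ _ (d.ρ_rel i (l⁻¹ • a))
      simp only [d.t_id i _ h1, d.t_id i _ (d.ρ_mem i _), d.ρ_ρ, mul_inv_cancel, map_one, mul_one,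
        hs1 i _ (d.ρ_ρ i _), inv_one] at h5
      rw [hbf (l⁻¹ • a), d.f_inv_smul h2, hbf (d.ρ i _)] at h5
      rw [← h5]
      simp only [s, d.f_inv_smul h2, h2, hlab h3]
    · rw [glue_of_notMem hm]
      simp
  refine IndepRel.of_coprodI (Γ := Multiplicative (W →₀ ℤ)) (fun a : A => b a) ?_
  intro α a a' h hne
  refine ⟨_, basisElt_mul_inv_ne_one (Subtype.coe_injective.ne hne), ?_⟩
  cases α with
  | inl c => exact hvertex c a a' h
  | inr c =>
    have h1 := hglue c a
    have h2 := hglue c a'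
    rw [show d.glue β c a = d.glue β c a' from h] at h1
    have h3 : b a * (b a')⁻¹ =
        (b a * (b (d.glue β c a'))⁻¹) * (b a' * (b (d.glue β c a'))⁻¹)⁻¹ := by
      group
    refine h3.trans ?_
    rw [h1, h2]
    change _ = of (.inr c) _
    simp only [map_mul, map_inv]
    group

theorem KuroshData.fac_generates (heq : ∀ i, Equivalence (e i)) (hβ : Function.Injective β)
    (hconn : ∀ w (k : K), Relation.EqvGen (fun a b => ∃ i, e i a b) w (k • w)) {a a' : A} {k : K}
    (h : k • (a : W) = a') : Relation.EqvGen (fun x y : A => ∃ α, d.fac β α x y) a a' := by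
  have hglue : ∀ i, ∀ w ∈ d.X i, Relation.EqvGen (fun x y : A => ∃ α, d.fac β α x y)
      ⟨d.f w, d.f_mem w⟩ ⟨d.f (d.ρ i w), d.f_mem _⟩ := fun i w hw => by
    obtain ⟨c, hc⟩ := exists_glue_eq (d := d) hβ i hw
    exact .rel _ _ ⟨.inr c, hc⟩
  have hft : ∀ i w, (⟨d.f (d.t i w), d.f_mem _⟩ : A) = ⟨d.f w, d.f_mem w⟩ := fun i w =>
    Subtype.ext (d.f_t i w)
  have hv : ∀ i w, d.f (d.ρ i w) ∈ d.vertexSet (i, d.κ i w) ∧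
      (d.κ i w)⁻¹ • d.f (d.ρ i w) = d.ρ i w := fun i w => by
    have hz : (d.κ i w)⁻¹ • d.f (d.ρ i w) = d.ρ i w := by
      rw [← d.ℓ_smul, d.ℓ_ρ, inv_smul_smul]
    refine ⟨⟨?_, ?_, ?_⟩, hz⟩ <;> simp only [hz]
    · exact d.ρ_mem i w
    · exact d.ℓ_ρ i w
    · exact (d.κ_inv i _ _ (d.ρ_rel i w)).symm
  have hstep : ∀ i w w', e i w w' → Relation.EqvGen (fun x y : A => ∃ α, d.fac β α x y)
      ⟨d.f w, d.f_mem w⟩ ⟨d.f w', d.f_mem w'⟩ := by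
    intro i w w' hww'
    have hw := hglue i _ (d.t_mem i w)
    have hw' := hglue i _ (d.t_mem i w')
    rw [hft] at hw hw'
    refine .trans _ _ _ hw (.trans _ _ _ (.rel _ _ ⟨.inl (i, d.κ i (d.t i w)), ?_⟩) (.symm _ _ hw'))
    have htt : e i (d.t i w) (d.t i w') :=
      (heq i).trans ((heq i).symm (d.t_rel i w)) ((heq i).trans hww' (d.t_rel i w'))
    have h1 := hv i (d.t i w)
    have h2 := hv i (d.t i w')
    rw [← d.κ_inv i _ _ htt] at h2
    refine ⟨h1.1, h2.1, ?_⟩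
    simp only [h1.2, h2.2]
    exact (heq i).trans ((heq i).symm (d.ρ_rel i _)) ((heq i).trans htt (d.ρ_rel i _))
  have key : ∀ w w', Relation.EqvGen (fun a b => ∃ i, e i a b) w w' →
      Relation.EqvGen (fun x y : A => ∃ α, d.fac β α x y) ⟨d.f w, d.f_mem w⟩
        ⟨d.f w', d.f_mem w'⟩ := by
    intro w w' h
    induction h with
    | rel x y h => exact hstep _ _ _ h.choose_spec
    | refl => exact .refl _
    | symm _ _ _ ih => exact .symm _ _ ih
    | trans _ _ _ _ _ ih1 ih2 => exact .trans _ _ _ ih1 ih2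
  have h1 := key _ _ (hconn a k)
  have h2 : (⟨d.f a, d.f_mem a⟩ : A) = a := Subtype.ext (d.f_id a a.2)
  have h3 : (⟨d.f (k • (a : W)), d.f_mem _⟩ : A) = a' :=
    Subtype.ext (by rw [h]; exact d.f_id a' a'.2)
  rwa [h2, h3] at h1

end KuroshFactors

section KuroshRestriction

variable {W ι K : Type} [MeasurableSpace W] [Group K] [MulAction K W] [MeasurableConstSMul K W]
  {e : ι → W → W → Prop} {A : Set W} {β : W → ℕ → Bool}

theorem measurableSet_sepBit {V W : Type} [MeasurableSpace V] [MeasurableSpace W]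
    {β : W → ℕ → Bool} (hβ : Measurable β) (nb : ℕ × Bool) {g g' : V → W} (hg : Measurable g)
    (hg' : Measurable g') : MeasurableSet {v | SepBit β nb (g v) (g' v)} := by
  have hbit : ∀ n, Measurable fun w => β w n := fun n => (measurable_pi_apply n).comp hβ
  have : {v | SepBit β nb (g v) (g' v)} = {v | β (g v) nb.1 = nb.2} ∩ ({v | β (g' v) nb.1 = nb.2}ᶜ ∩
      ⋂ m, ⋂ (_ : m < nb.1), {v | β (g v) m = β (g' v) m}) := by
    ext v
    simp [SepBit]
  rw [this]
  exact (measurableSet_eq_fun ((hbit _).comp hg) measurable_const).inter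
    ((measurableSet_eq_fun ((hbit _).comp hg') measurable_const).compl.inter
      (.iInter fun m => .iInter fun _ =>
        measurableSet_eq_fun ((hbit _).comp hg) ((hbit _).comp hg')))

theorem KuroshData.measurable_glue (d : KuroshData K e A) (hβ : Measurable β)
    (c : ι × K × (ℕ × Bool)) : Measurable (d.glue β c) := by
  classical
  have hm : Measurable fun a => d.f (d.ρ c.1 (c.2.1⁻¹ • a)) :=
    d.f_meas.comp ((d.ρ_meas _).comp (measurable_const_smul _))
  refine Measurable.ite ?_ hm measurable_id
  exact (measurable_const_smul c.2.1⁻¹ (d.X_meas c.1)).inter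
    ((measurable_const_smul c.2.1⁻¹ (d.ℓ_meas c.2.1)).inter
      (measurableSet_sepBit hβ _ measurable_id hm))

theorem KuroshData.measurableSet_vertexSet (d : KuroshData K e A) (c : ι × K) :
    MeasurableSet (d.vertexSet c) :=
  (measurable_const_smul c.2⁻¹ (d.X_meas c.1)).inter
    ((measurable_const_smul c.2⁻¹ (d.ℓ_meas c.2)).inter
      (measurable_const_smul c.2⁻¹ (d.κ_meas c.1 c.2)))

variable [StandardBorelSpace W] [Countable K]

/-- The factors of the restricted decomposition as countable Borel equivalence relations. -/
def KuroshData.factor (d : KuroshData K e A) (hβ : Measurable β) (heq : ∀ i, Equivalence (e i))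
    (hem : ∀ i, MeasurableSet {p : W × W | e i p.1 p.2})
    (hK : ∀ i w w', e i w w' → ∃ k : K, k • w = w') (α : (ι × K) ⊕ (ι × K × (ℕ × Bool))) :
    CBER A where
  dom := {a | (a : W) ∈ d.facDom α}
  dom_meas := measurable_subtype_coe (by
    cases α with
    | inl c => exact d.measurableSet_vertexSet c
    | inr c => exact .univ)
  rel x y := d.fac β α x y
  rel_meas := by
    have h1 : Measurable fun p : A × A => (p.1 : W) := measurable_subtype_coe.comp measurable_fst
    have h2 : Measurable fun p : A × A => (p.2 : W) := measurable_subtype_coe.comp measurable_snd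
    cases α with
    | inl c =>
      exact (h1 (d.measurableSet_vertexSet c)).inter ((h2 (d.measurableSet_vertexSet c)).inter
        (measurableSet_rel (hem c.1) ((measurable_const_smul c.2⁻¹).comp h1)
          ((measurable_const_smul c.2⁻¹).comp h2)))
    | inr c =>
      exact measurableSet_eq_fun ((d.measurable_glue hβ c).comp h1)
        ((d.measurable_glue hβ c).comp h2)
  rel_dom := by
    intro x y h
    cases α with
    | inl c => exact ⟨h.1, h.2.1⟩
    | inr c => exact ⟨trivial, trivial⟩
  refl := by
    intro x hx
    cases α with
    | inl c => exact ⟨hx, hx, (heq c.1).refl _⟩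
    | inr c => exact rfl
  symm := by
    intro x y h
    cases α with
    | inl c => exact ⟨h.2.1, h.1, (heq c.1).symm h.2.2⟩
    | inr c => exact Eq.symm h
  trans := by
    intro x y z h h'
    cases α with
    | inl c => exact ⟨h.1, h'.2.1, (heq c.1).trans h.2.2 h'.2.2⟩
    | inr c => exact Eq.trans h h'
  countable_classes := fun x => by
    refine Set.countable_of_injective_of_countable_image Subtype.val_injective.injOn ?_
    refine (Set.countable_range fun k : K => k • (x : W)).mono ?_
    rintro _ ⟨y, hy, rfl⟩
    exact d.exists_smul_eq_of_fac hK hy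

/-- Restriction of a free product to a complete section `A`: the restricted relation is a free
product of factors such that every trivialization of the restricted decomposition induces one of
the original decomposition. -/
theorem exists_restricted_decomposition [Countable ι] [Nonempty ι] (heq : ∀ i, Equivalence (e i))
    (hem : ∀ i, MeasurableSet {p : W × W | e i p.1 p.2})
    (hK : ∀ i w w', e i w w' → ∃ k : K, k • w = w') (hr : IndepRel e)
    (hconn : ∀ w (k : K), Relation.EqvGen (fun a b => ∃ i, e i a b) w (k • w))
    (hA : MeasurableSet A) (hcov : ∀ w, ∃ k : K, k • w ∈ A)
    (R : CBER A) (hRdom : R.dom = Set.univ)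
    (hR : ∀ a a' : A, R.rel a a' ↔ ∃ k : K, k • (a : W) = a') :
    ∃ (𝒜 : Type) (_ : Countable 𝒜) (S : 𝒜 → CBER A), IsFreeProduct R S ∧
      ∀ (U : 𝒜 → Set A) (C : Set A), (∀ α, MeasurableSet (U α)) → MeasurableSet C →
        (∀ a ∈ C, ∀ a', R.rel a a' → a' ∈ C) →
        (∀ x ∈ C, ∃ y ∈ ⋃ α, U α, R.rel x y) →
        (∀ α α', ∀ x ∈ U α ∩ C, ∀ y ∈ U α' ∩ C, R.rel x y → α = α') →
        (∀ α, ∀ x ∈ U α ∩ C, ∀ y ∈ U α ∩ C, R.rel x y → (S α).rel x y) →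
        ∃ V : ι → Set W, (∀ i, MeasurableSet (V i)) ∧
          (∀ i j w w', w ∈ V i → w' ∈ V j → (∃ k : K, k • w = w') → i = j ∧ e i w w') ∧
          ∀ a : A, a ∈ C → ∃ (k : K) (i : ι), k • (a : W) ∈ V i := by
  obtain ⟨d⟩ := exists_kuroshData heq hem hK hconn hA hcov
  obtain ⟨β, hβm, hβ⟩ := MeasurableSpace.measurable_injection_nat_bool_of_countablySeparated W
  refine ⟨(ι × K) ⊕ (ι × K × (ℕ × Bool)), inferInstance, d.factor hβm heq hem hK,
    ⟨d.fac_indepRel heq hr, ?_, ?_⟩, ?_⟩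
  · rw [hRdom, eq_comm, Set.eq_univ_iff_forall]
    exact fun x => Set.mem_iUnion.mpr ⟨.inr (Classical.arbitrary ι, 1, 0, true), trivial⟩
  · intro x y
    rw [hRdom]
    refine ⟨fun h => ⟨trivial, ?_⟩, fun h => ?_⟩
    · obtain ⟨k, hk⟩ := (hR x y).mp h
      exact d.fac_generates heq hβ hconn hk
    · replace h := h.2
      induction h with
      | rel x y h => exact (hR x y).mpr (d.exists_smul_eq_of_fac hK h.choose_spec)
      | refl x => exact R.refl x (hRdom ▸ trivial)
      | symm x y _ ih => exact R.symm ih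
      | trans x y z _ _ ih1 ih2 => exact R.trans ih1 ih2
  · intro U C hU hC hCinv hmeet hdisj hrel
    let U' : (ι × K) ⊕ (ι × K × (ℕ × Bool)) → Set W := fun α => (↑) '' (U α ∩ C)
    have hU' : ∀ α, MeasurableSet (U' α) := fun α => hA.subtype_image ((hU α).inter hC)
    have hU'rel : ∀ {α α' w w'}, w ∈ U' α → w' ∈ U' α' → (∃ k : K, k • w = w') →
        α = α' ∧ d.fac β α w w' := by
      rintro α α' _ _ ⟨a, ha, rfl⟩ ⟨a', ha', rfl⟩ hk
      have h := (hR a a').mpr hk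
      obtain rfl := hdisj α α' a ha a' ha' h
      exact ⟨rfl, hrel α a ha a' ha' h⟩
    have hvert : ∀ {c w}, w ∈ U' (.inl c) → w ∈ d.vertexSet c := fun {c w} hw =>
      (hU'rel hw hw ⟨1, one_smul _ _⟩).2.1
    let V : ι → Set W := fun i => (⋃ k : K, {w | d.ℓ w = k} ∩ d.f ⁻¹' U' (.inl (i, k))) ∪
      ⋃ c : K × (ℕ × Bool), ⋃ k : K, (fun w => k • w) ⁻¹' U' (.inr (i, c)) ∩
        {w | d.glue β (i, c) (k • w) = w}
    have hVel : ∀ {i w}, w ∈ V i → (∃ k a, w = k⁻¹ • a ∧ a ∈ U' (.inl (i, k))) ∨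
        ∃ c a, a ∈ U' (.inr (i, c)) ∧ w = d.glue β (i, c) a := by
      intro i w hw
      rcases hw with hw | hw
      · obtain ⟨k, rfl, hk⟩ := Set.mem_iUnion.mp hw
        exact Or.inl ⟨_, _, by rw [← d.ℓ_smul, inv_smul_smul], hk⟩
      · simp only [Set.mem_iUnion] at hw
        obtain ⟨c, k, h1, h2⟩ := hw
        exact Or.inr ⟨c, _, h1, h2.symm⟩
    have hVorb : ∀ {i w}, w ∈ V i → ∃ α a, a ∈ U' α ∧ (∃ k : K, k • w = a) ∧
        ((∃ k, α = .inl (i, k) ∧ w = k⁻¹ • a) ∨ ∃ c, α = .inr (i, c) ∧ w = d.glue β (i, c) a) := by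
      intro i w hw
      rcases hVel hw with ⟨k, a, hwa, ha⟩ | ⟨c, a, ha, hwa⟩
      · exact ⟨_, a, ha, ⟨k, by rw [hwa, smul_inv_smul]⟩, Or.inl ⟨k, rfl, hwa⟩⟩
      · obtain ⟨k, hk⟩ := d.exists_smul_eq_glue (β := β) hK (i, c) a
        exact ⟨_, a, ha, ⟨k⁻¹, by rw [hwa, ← hk, inv_smul_smul]⟩, Or.inr ⟨c, rfl, hwa⟩⟩
    refine ⟨V, fun i => ?_, ?_, ?_⟩
    · refine (MeasurableSet.iUnion fun k => (d.ℓ_meas k).inter (d.f_meas (hU' _))).union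
        (.iUnion fun c => .iUnion fun k => (measurable_const_smul k (hU' _)).inter
          (measurableSet_eq_fun ((d.measurable_glue hβm _).comp (measurable_const_smul k))
            measurable_id))
    · rintro i j w w' hw hw' ⟨k, hk⟩
      obtain ⟨α, a, ha, ⟨k₁, hk₁⟩, h⟩ := hVorb hw
      obtain ⟨α', a', ha', ⟨k₂, hk₂⟩, h'⟩ := hVorb hw'
      obtain ⟨hα, hfac⟩ := hU'rel ha ha'
        ⟨k₂ * k * k₁⁻¹, by rw [← hk₁, mul_smul, mul_smul, inv_smul_smul, hk, hk₂]⟩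
      rcases h with ⟨l, rfl, rfl⟩ | ⟨c, rfl, rfl⟩ <;> rcases h' with ⟨l', rfl, rfl⟩ | ⟨c', rfl, rfl⟩
      · obtain ⟨rfl, rfl⟩ : i = j ∧ l = l' := by simpa using hα
        exact ⟨rfl, hfac.2.2⟩
      · cases hα
      · cases hα
      · obtain ⟨rfl, rfl⟩ : i = j ∧ c = c' := by simpa using hα
        refine ⟨rfl, ?_⟩
        rw [show d.glue β (i, c) a = d.glue β (i, c) a' from hfac]
        exact (heq i).refl _
    · intro a ha
      obtain ⟨y, hy, hay⟩ := hmeet a ha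
      obtain ⟨α, hα⟩ := Set.mem_iUnion.mp hy
      obtain ⟨k, hk⟩ := (hR a y).mp hay
      have hyU : (y : W) ∈ U' α := ⟨y, ⟨hα, hCinv a ha y hay⟩, rfl⟩
      match α, hyU with
      | .inl (i, l), hyU =>
        have hv := hvert hyU
        refine ⟨l⁻¹ * k, i, Or.inl (Set.mem_iUnion.mpr ⟨l, ?_, ?_⟩)⟩ <;> rw [mul_smul, hk]
        · exact hv.2.1
        · rwa [Set.mem_preimage, d.f_inv_smul hv.2.1]
      | .inr (i, c), hyU =>
        obtain ⟨k', hk'⟩ := d.exists_smul_eq_glue (β := β) hK (i, c) y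
        refine ⟨k' * k, i, Or.inr (Set.mem_iUnion.mpr ⟨c, Set.mem_iUnion.mpr ⟨k'⁻¹, ?_, ?_⟩⟩)⟩ <;>
          rw [mul_smul, hk]
        · rwa [Set.mem_preimage, inv_smul_smul]
        · rw [Set.mem_ofPred_eq, inv_smul_smul, hk']

end KuroshRestriction

section StarAction

open scoped Pointwise

variable {W G H : Type} [MeasurableSpace W] [Group G] [Group H] [Countable H] [MulAction G W]
  [MulAction H W] [MeasurableConstSMul H W]

/-- A measurable retraction onto a strict fundamental domain along the orbits. -/
theorem exists_retraction {A : Set W} (hA : MeasurableSet A) (hfund : ∀ w, ∃! h : H, h • w ∈ A) :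
    ∃ σ : W → W, Measurable σ ∧ (∀ w, σ w ∈ A) ∧ (∀ w, ∃ h : H, h • w = σ w) ∧
      (∀ a ∈ A, σ a = a) ∧ ∀ (h : H) w, σ (h • w) = σ w := by
  choose s hs hsu using hfund
  replace hs : ∀ w, s w • w ∈ A := hs
  have huniq : ∀ w (h h' : H), h • w ∈ A → h' • w ∈ A → h = h' := fun w h h' h1 h2 =>
    (hsu w h h1).trans (hsu w h' h2).symm
  refine ⟨fun w => s w • w, measurable_countable_choice (g := fun h w => h • w) (fun h => ?_)
    (fun h => measurable_const_smul h), hs, fun w => ⟨s w, rfl⟩, fun a ha => ?_, fun h w => ?_⟩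
  · have : {w | s w = h} = (fun w => h • w) ⁻¹' A := by
      ext w
      exact ⟨fun hw => hw ▸ hs w, fun hw => huniq w _ _ (hs w) hw⟩
    rw [this]
    exact measurable_const_smul h hA
  · have : s a = 1 := huniq a _ _ (hs a) (by rwa [one_smul])
    simp only [this, one_smul]
  · have h1 := hs (h • w)
    rw [← mul_smul] at h1
    simp only [← mul_smul, huniq w _ _ h1 (hs w)]

variable [SMulCommClass G H W] [MeasurableConstSMul G W] (m : Measure W)
  [SMulInvariantMeasure G W m] [SMulInvariantMeasure H W m]

theorem smul_star_measure {A : Set W} (hA : MeasurableSet A) (hfund : ∀ w, ∃! h : H, h • w ∈ A)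
    {B : Set W} (hB : MeasurableSet B) (hBH : ∀ (h : H) w, h • w ∈ B ↔ w ∈ B) (g : G) :
    m ((fun w => g • w) ⁻¹' B ∩ A) = m (B ∩ A) := by
  have hF : IsFundamentalDomain H A m := .mk' hA.nullMeasurableSet hfund
  have h1 := hF.measure_set_eq (hF.smul_of_comm g) hB (fun h => Set.ext fun w => hBH h w)
  rw [h1, ← measure_preimage_smul m g (B ∩ g • A)]
  congr 1
  ext w
  simp [Set.smul_mem_smul_set_iff]

/-- A free product decomposition of the orbit relation of `G × H`, where `H` has a fundamental
domain of finite measure, is inessential as soon as `G` is measurably freely indecomposable. -/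
theorem exists_trivialization_of_MFI [StandardBorelSpace W] [Countable G] (hMFI : MFI G)
    {ι : Type} [Countable ι] [Nonempty ι] {e : ι → W → W → Prop} (heq : ∀ i, Equivalence (e i))
    (hem : ∀ i, MeasurableSet {p : W × W | e i p.1 p.2})
    (hK : ∀ i w w', e i w w' → ∃ (g : G) (h : H), g • h • w = w') (hr : IndepRel e)
    (hconn : ∀ (w : W) (g : G) (h : H), Relation.EqvGen (fun a b => ∃ i, e i a b) w (g • h • w))
    {A : Set W} (hA : MeasurableSet A) (hfund : ∀ w, ∃! h : H, h • w ∈ A) (hpos : m A ≠ 0)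
    (hfin : m A ≠ ⊤) (hfree : ∀ (w : W) (g : G) (h : H), g • h • w = w → g = 1) :
    ∃ V : ι → Set W, (∀ i, MeasurableSet (V i)) ∧
      (∀ i j w w', w ∈ V i → w' ∈ V j → (∃ (g : G) (h : H), g • h • w = w') → i = j ∧ e i w w') ∧
      ∀ᵐ w ∂m, ∃ (g : G) (h : H) (i : ι), g • h • w ∈ V i := by
  obtain ⟨σ, hσm, hσA, hσH, hσid, hσinv⟩ := exists_retraction hA hfund
  let _ : MulAction (G × H) W := MulAction.prodOfSMulCommClass G H W
  have hsmul : ∀ (k : G × H) (w : W), k • w = k.1 • k.2 • w := fun _ _ => rfl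
  have : MeasurableConstSMul (G × H) W :=
    ⟨fun k => (measurable_const_smul k.1).comp (measurable_const_smul k.2)⟩
  have : StandardBorelSpace A := hA.standardBorel
  let μ : Measure A := (m A)⁻¹ • m.comap (↑)
  have hμ : ∀ B : Set A, μ B = (m A)⁻¹ * m ((↑) '' B) := fun B => by
    simp only [μ, Measure.smul_apply, smul_eq_mul, comap_subtype_coe_apply hA]
  have hμprob : IsProbabilityMeasure μ := ⟨by
    rw [hμ, Set.image_univ, Subtype.range_coe]
    exact ENNReal.inv_mul_cancel hpos hfin⟩
  let act : G → A → A := fun g x => ⟨σ (g • (x : W)), hσA _⟩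
  have hact : ∀ g x, (act g x : W) = σ (g • (x : W)) := fun _ _ => rfl
  have hactm : ∀ g, Measurable (act g) := fun g =>
    (hσm.comp ((measurable_const_smul g).comp measurable_subtype_coe)).subtype_mk
  let α : PMPAction G A μ :=
    { act := act
      act_one := fun x => Subtype.ext (by rw [hact, one_smul, hσid x x.2])
      act_mul := fun g g' x => Subtype.ext (by
        obtain ⟨h, hh⟩ := hσH (g' • (x : W))
        rw [hact, hact, hact, ← hh, smul_comm g h, hσinv, mul_smul])
      measurePreserving := fun g => ⟨hactm g, by
        ext B hB
        rw [Measure.map_apply (hactm g) hB, hμ, hμ]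
        congr 1
        have hB' : MeasurableSet (σ ⁻¹' ((↑) '' B)) := hσm (hA.subtype_image hB)
        have h1 := smul_star_measure m hA hfund hB' (fun h w => by
          rw [Set.mem_preimage, hσinv, Set.mem_preimage]) g
        have h2 : (fun w => g • w) ⁻¹' (σ ⁻¹' ((↑) '' B)) ∩ A = (↑) '' (act g ⁻¹' B) := by
          ext w
          constructor
          · rintro ⟨⟨b, hb, hbw⟩, hw⟩
            refine ⟨⟨w, hw⟩, ?_, rfl⟩
            rw [Set.mem_preimage]
            convert hb
            exact Subtype.ext hbw.symm
          · rintro ⟨x, hx, rfl⟩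
            exact ⟨⟨act g x, hx, rfl⟩, x.2⟩
        have h3 : σ ⁻¹' ((↑) '' B) ∩ A = (↑) '' B := by
          ext w
          constructor
          · rintro ⟨h, hw⟩
            rwa [Set.mem_preimage, hσid w hw] at h
          · rintro ⟨x, hx, rfl⟩
            exact ⟨⟨x, hx, (hσid x x.2).symm⟩, x.2⟩
        rw [← h2, h1, h3]⟩ }
  have horb : ∀ x y : A, (∃ g, act g x = y) ↔ ∃ k : G × H, k • (x : W) = y := by
    intro x y
    constructor
    · rintro ⟨g, rfl⟩
      obtain ⟨h, hh⟩ := hσH (g • (x : W))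
      exact ⟨(g, h), by rw [hsmul, hact, ← hh, smul_comm]⟩
    · rintro ⟨⟨g, h⟩, hk⟩
      exact ⟨g, Subtype.ext (by
        rw [hact, ← hσid y y.2, ← hk, hsmul, smul_comm, hσinv])⟩
  let R : CBER A :=
    { dom := Set.univ
      dom_meas := .univ
      rel := fun x y => ∃ k : G × H, k • (x : W) = y
      rel_meas := by
        have : {p : A × A | ∃ k : G × H, k • (p.1 : W) = p.2} =
            ⋃ k : G × H, {p : A × A | k • (p.1 : W) = p.2} := by
          ext p
          simp only [Set.mem_ofPred_eq, Set.mem_iUnion]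
        rw [this]
        exact .iUnion fun k => measurableSet_eq_fun
          ((measurable_const_smul k).comp (measurable_subtype_coe.comp measurable_fst))
          (measurable_subtype_coe.comp measurable_snd)
      rel_dom := fun _ => ⟨trivial, trivial⟩
      refl := fun x _ => ⟨1, one_smul _ _⟩
      symm := fun ⟨k, hk⟩ => ⟨k⁻¹, by rw [← hk, inv_smul_smul]⟩
      trans := fun ⟨k, hk⟩ ⟨k', hk'⟩ => ⟨k' * k, by rw [mul_smul, hk, hk']⟩
      countable_classes := fun x => by
        refine Set.countable_of_injective_of_countable_image Subtype.val_injective.injOn ?_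
        refine (Set.countable_range fun k : G × H => k • (x : W)).mono ?_
        rintro _ ⟨y, hy, rfl⟩
        exact hy }
  have hαfree : α.IsFree := .of_forall fun x g hg => by
    obtain ⟨h, hh⟩ := hσH (g • (x : W))
    refine hfree x g h ?_
    rw [smul_comm, hh]
    exact congrArg Subtype.val hg
  have hαorb : IsOrbitRel α ⊤ R := ⟨rfl, fun x y => by
    simp only [Subgroup.mem_top, true_and]
    exact (horb x y).symm⟩
  obtain ⟨𝒜, _, S, hfp, hS⟩ := exists_restricted_decomposition (K := G × H) heq hem
    (fun i w w' h => by
      obtain ⟨g, h', h1⟩ := hK i w w' h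
      exact ⟨(g, h'), h1⟩) hr (fun w k => hconn w k.1 k.2) hA
    (fun w => by
      obtain ⟨h, hh, -⟩ := hfund w
      exact ⟨(1, h), by rwa [hsmul, one_smul]⟩) R rfl (fun _ _ => Iff.rfl)
  obtain ⟨U, C, hU, -, -, hC, hCnull, hmeet, hdisj, hrel⟩ :=
    hMFI A μ α R hαfree hαorb 𝒜 inferInstance S hfp
  let C' : Set A := ⋂ g : G, act g ⁻¹' C
  have hC'm : MeasurableSet C' := .iInter fun g => hactm g hC
  have hC'C : C' ⊆ C := fun x hx => by
    have h1 := Set.mem_iInter.mp hx 1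
    rwa [Set.mem_preimage, show act 1 x = x from α.act_one x] at h1
  have hC'inv : ∀ a ∈ C', ∀ a', R.rel a a' → a' ∈ C' := by
    intro a ha a' haa'
    obtain ⟨g, rfl⟩ := (horb a a').mpr haa'
    refine Set.mem_iInter.mpr fun g' => ?_
    have h1 := Set.mem_iInter.mp ha (g' * g)
    rwa [Set.mem_preimage, show act (g' * g) a = act g' (act g a) from α.act_mul g' g a] at h1
  have hC'null : μ C'ᶜ = 0 := by
    rw [Set.compl_iInter, measure_iUnion_null_iff]
    intro g
    rw [← Set.preimage_compl]
    exact ((α.measurePreserving g).measure_preimage hC.compl.nullMeasurableSet).trans hCnull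
  obtain ⟨V, hVm, hV1, hV2⟩ := hS U C' hU hC'm hC'inv (fun x hx => hmeet x ⟨trivial, hC'C hx⟩)
    (fun α α' x hx y hy => hdisj α α' x ⟨hx.1, hC'C hx.2⟩ y ⟨hy.1, hC'C hy.2⟩)
    (fun α x hx y hy h => (hrel α x ⟨hx.1, hC'C hx.2⟩ y ⟨hy.1, hC'C hy.2⟩).mp h)
  refine ⟨V, hVm, fun i j w w' hw hw' ⟨g, h, hgh⟩ => hV1 i j w w' hw hw' ⟨(g, h), hgh⟩, ?_⟩
  have hN : m ((↑) '' C'ᶜ) = 0 := by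
    have h1 := hC'null
    rw [hμ, mul_eq_zero] at h1
    exact h1.resolve_left (ENNReal.inv_ne_zero.mpr hfin)
  have hN' : m (⋃ h : H, (fun w => h • w) ⁻¹' ((↑) '' C'ᶜ)) = 0 := by
    rw [measure_iUnion_null_iff]
    exact fun h => by rw [measure_preimage_smul, hN]
  refine Filter.mem_of_superset (compl_mem_ae_iff.mpr hN') fun w hw => ?_
  obtain ⟨h, hh⟩ := hσH w
  have hmem : (⟨σ w, hσA w⟩ : A) ∈ C' := by
    by_contra hcon
    exact hw (Set.mem_iUnion.mpr ⟨h, ⟨σ w, hσA w⟩, hcon, hh.symm⟩)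
  obtain ⟨⟨g, h'⟩, i, hi⟩ := hV2 _ hmem
  refine ⟨g, h' * h, i, ?_⟩
  rw [mul_smul, hh]
  exact hi

end StarAction

section ProductCoupling

variable {Ω Y G H : Type} [MeasurableSpace Ω] [MeasurableSpace Y] [Group G] [Group H]
  [MulAction G Ω] [MulAction H Ω] [MulAction H Y]

/-- The action of `G` on the first factor of an invariant subset of a product. -/
abbrev subtypeLeftAction {S : Set (Ω × Y)} (hS : ∀ (g : G), ∀ t ∈ S, (g • t.1, t.2) ∈ S) :
    MulAction G S where
  smul g w := ⟨(g • w.1.1, w.1.2), hS g w.1 w.2⟩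
  one_smul _ := Subtype.ext (Prod.ext (one_smul G _) rfl)
  mul_smul g g' w := Subtype.ext (Prod.ext (mul_smul g g' w.1.1) rfl)

/-- The diagonal action of `H` on an invariant subset of a product. -/
abbrev subtypeDiagAction {S : Set (Ω × Y)} (hS : ∀ (h : H), ∀ t ∈ S, (h • t.1, h • t.2) ∈ S) :
    MulAction H S where
  smul h w := ⟨(h • w.1.1, h • w.1.2), hS h w.1 w.2⟩
  one_smul _ := Subtype.ext (Prod.ext (one_smul H _) (one_smul H _))
  mul_smul h h' w := Subtype.ext (Prod.ext (mul_smul h h' w.1.1) (mul_smul h h' w.1.2))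

variable [MeasurableConstSMul G Ω] [MeasurableConstSMul H Ω] [MeasurableConstSMul H Y]
  (ν : Measure Ω) [SigmaFinite ν] [SMulInvariantMeasure G Ω ν] [SMulInvariantMeasure H Ω ν]
  (μ : Measure Y) [SigmaFinite μ] [SMulInvariantMeasure H Y μ]

theorem measurePreserving_smul_prod (g : G) (h : H) :
    MeasurePreserving (fun t : Ω × Y => (g • h • t.1, h • t.2)) (ν.prod μ) (ν.prod μ) :=
  ((measurePreserving_smul g ν).comp (measurePreserving_smul h ν)).prod
    (measurePreserving_smul h μ)

variable [SMulCommClass G H Ω] [Countable G] [Countable H]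

/-- An almost everywhere property holds on a conull invariant Borel set. -/
theorem exists_invariant_conull {P : Ω × Y → Prop} (hP : ∀ᵐ t ∂ν.prod μ, P t) :
    ∃ S : Set (Ω × Y), MeasurableSet S ∧ ν.prod μ Sᶜ = 0 ∧
      (∀ (g : G) (h : H), ∀ t ∈ S, (g • h • t.1, h • t.2) ∈ S) ∧ ∀ t ∈ S, P t := by
  have hmp := measurePreserving_smul_prod (G := G) (H := H) ν μ
  let N : Set (Ω × Y) := toMeasurable (ν.prod μ) {t | ¬ P t}
  have hNm : MeasurableSet N := measurableSet_toMeasurable _ _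
  have hN : ν.prod μ N = 0 := (measure_toMeasurable _).trans hP
  let S : Set (Ω × Y) := ⋂ (g : G), ⋂ (h : H), (fun t => (g • h • t.1, h • t.2)) ⁻¹' Nᶜ
  have hmem : ∀ {t}, t ∈ S ↔ ∀ (g : G) (h : H), (g • h • t.1, h • t.2) ∉ N := by
    simp [S]
  refine ⟨S, .iInter fun g => .iInter fun h => (hmp g h).measurable hNm.compl, ?_, ?_, ?_⟩
  · simp only [S, Set.compl_iInter, measure_iUnion_null_iff]
    intro g h
    rw [← Set.preimage_compl, compl_compl, (hmp g h).measure_preimage hNm.nullMeasurableSet, hN]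
  · intro g h t ht
    rw [hmem] at ht ⊢
    intro g' h'
    have h1 := ht (g' * g) (h' * h)
    simpa only [mul_smul, smul_comm g h'] using h1
  · intro t ht
    by_contra hcon
    have h1 := hmem.mp ht 1 1
    simp only [one_smul] at h1
    exact h1 (subset_toMeasurable _ _ hcon)

theorem smulInvariantMeasure_subtype {T K : Type} [MeasurableSpace T] [Group K] {m : Measure T}
    {S : Set T} (hS : MeasurableSet S) [MulAction K S] (φ : K → T → T)
    (hφ : ∀ k, MeasurePreserving (φ k) m m) (hφS : ∀ (k : K) (w : S), φ k w = (k • w : S))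
    (hinv : ∀ k t, φ k t ∈ S → t ∈ S) : SMulInvariantMeasure K S (m.comap (↑)) where
  measure_preimage_smul k B hB := by
    rw [comap_subtype_coe_apply hS, comap_subtype_coe_apply hS,
      ← (hφ k).measure_preimage (hS.subtype_image hB).nullMeasurableSet]
    congr 1
    ext t
    constructor
    · rintro ⟨w, hw, rfl⟩
      exact ⟨k • w, hw, (hφS k w).symm⟩
    · rintro ⟨w, hw, hwt⟩
      have ht : t ∈ S := hinv k t (hwt ▸ w.2)
      refine ⟨⟨t, ht⟩, ?_, rfl⟩
      have : k • (⟨t, ht⟩ : S) = w := Subtype.ext (by rw [← hφS, ← hwt])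
      rwa [Set.mem_preimage, this]

variable [StandardBorelSpace Ω] [StandardBorelSpace Y]

/-- A free product decomposition of the orbit relation of `H` on `Y` is trivialized after taking
the product with a coupling of `H` with a measurably freely indecomposable group. -/
theorem exists_product_trivialization [IsProbabilityMeasure μ] (hMFI : MFI G) {DG DH : Set Ω}
    (hDG : MeasurableSet DG) (hDH : MeasurableSet DH)
    (hfreeG : ∀ᵐ ω ∂ν, ∀ g : G, g • ω = ω → g = 1) (hfreeY : ∀ᵐ y ∂μ, ∀ h : H, h • y = y → h = 1)
    (hDG1 : ∀ᵐ ω ∂ν, ∃ g : G, g • ω ∈ DG)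
    (hDG2 : ∀ᵐ ω ∂ν, ∀ g : G, ω ∈ DG → g • ω ∈ DG → g = 1)
    (hDH1 : ∀ᵐ ω ∂ν, ∃ h : H, h • ω ∈ DH)
    (hDH2 : ∀ᵐ ω ∂ν, ∀ h : H, ω ∈ DH → h • ω ∈ DH → h = 1)
    (hpos : ν DH ≠ 0) (hfin : ν DH ≠ ⊤) {ι : Type} [Countable ι] [Nonempty ι]
    {r : ι → Y → Y → Prop} (heq : ∀ i, Equivalence (r i))
    (hrm : ∀ i, MeasurableSet {p : Y × Y | r i p.1 p.2})
    (hrH : ∀ i y y', r i y y' → ∃ h : H, h • y = y') (hr : IndepRel r)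
    (hgen : ∀ y (h : H), Relation.EqvGen (fun a b => ∃ i, r i a b) y (h • y)) :
    ∃ V : ι → Set (Ω × Y), (∀ i, MeasurableSet (V i)) ∧
      (∀ i j ω y (g : G) (h : H), (ω, y) ∈ V i → (g • h • ω, h • y) ∈ V j →
        i = j ∧ r i y (h • y)) ∧
      ∀ᵐ t ∂ν.prod μ, ∃ (g : G) (h : H) (i : ι), (g • h • t.1, h • t.2) ∈ V i := by
  have hfst := Measure.quasiMeasurePreserving_fst (μ := ν) (ν := μ)
  have hsnd := Measure.quasiMeasurePreserving_snd (μ := ν) (ν := μ)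
  obtain ⟨S, hSm, hSnull, hSinv, hSP⟩ := exists_invariant_conull (G := G) (H := H) ν μ
    ((hfst.ae hfreeG).and <| (hsnd.ae hfreeY).and <| (hfst.ae hDG1).and <| (hfst.ae hDG2).and <|
      (hfst.ae hDH1).and <| hfst.ae hDH2)
  have hSG : ∀ (g : G), ∀ t ∈ S, (g • t.1, t.2) ∈ S := fun g t ht => by
    simpa using hSinv g 1 t ht
  have hSH : ∀ (h : H), ∀ t ∈ S, (h • t.1, h • t.2) ∈ S := fun h t ht => by
    simpa using hSinv 1 h t ht
  have : StandardBorelSpace S := hSm.standardBorel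
  let _ : MulAction G S := subtypeLeftAction hSG
  let _ : MulAction H S := subtypeDiagAction hSH
  have hGval : ∀ (g : G) (w : S), ((g • w : S) : Ω × Y) = (g • w.1.1, w.1.2) := fun _ _ => rfl
  have hHval : ∀ (h : H) (w : S), ((h • w : S) : Ω × Y) = (h • w.1.1, h • w.1.2) := fun _ _ => rfl
  have : SMulCommClass G H S := ⟨fun g h w => Subtype.ext (Prod.ext (smul_comm g h w.1.1) rfl)⟩
  have hΩ : Measurable fun w : S => w.1.1 := measurable_fst.comp measurable_subtype_coe
  have hY : Measurable fun w : S => w.1.2 := measurable_snd.comp measurable_subtype_coe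
  have : MeasurableConstSMul G S :=
    ⟨fun g => (((measurable_const_smul g).comp hΩ).prodMk hY).subtype_mk⟩
  have : MeasurableConstSMul H S :=
    ⟨fun h => (((measurable_const_smul h).comp hΩ).prodMk
      ((measurable_const_smul h).comp hY)).subtype_mk⟩
  let m : Measure S := (ν.prod μ).comap (↑)
  have : SMulInvariantMeasure G S m := smulInvariantMeasure_subtype hSm
    (fun g t => (g • t.1, t.2))
    (fun g => (measurePreserving_smul g ν).prod (MeasurePreserving.id μ)) (fun _ _ => rfl)
    (fun g t ht => by simpa using hSG g⁻¹ _ ht)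
  have : SMulInvariantMeasure H S m := smulInvariantMeasure_subtype hSm
    (fun h t => (h • t.1, h • t.2))
    (fun h => (measurePreserving_smul h ν).prod (measurePreserving_smul h μ)) (fun _ _ => rfl)
    (fun h t ht => by simpa using hSH h⁻¹ _ ht)
  let A : Set S := (fun w => w.1.1) ⁻¹' DH
  let Z : Set S := (fun w => w.1.1) ⁻¹' DG
  have hmA : m A = ν DH := by
    have h1 : ((↑) '' A : Set (Ω × Y)) = DH ×ˢ Set.univ ∩ S := by
      ext t
      constructor
      · rintro ⟨w, hw, rfl⟩
        exact ⟨⟨hw, trivial⟩, w.2⟩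
      · rintro ⟨h, ht⟩
        exact ⟨⟨t, ht⟩, h.1, rfl⟩
    rw [comap_subtype_coe_apply hSm, h1, measure_inter_conull hSnull, Measure.prod_prod,
      measure_univ, mul_one]
  let E : S → S → Prop := fun w w' => ∃ (g : G) (h : H), g • h • w = w'
  have hE : Equivalence E :=
    { refl := fun w => ⟨1, 1, by simp⟩
      symm := by
        rintro w w' ⟨g, h, rfl⟩
        exact ⟨g⁻¹, h⁻¹, by rw [smul_comm g h, inv_smul_smul, inv_smul_smul]⟩
      trans := by
        rintro w w' w'' ⟨g, h, rfl⟩ ⟨g', h', rfl⟩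
        exact ⟨g' * g, h' * h, by rw [mul_smul, mul_smul, smul_comm g h']⟩ }
  let p : S → Y := fun w => w.1.2
  have hpval : ∀ (g : G) (h : H) (w : S), p (g • h • w) = h • p w := fun _ _ _ => rfl
  have hEm : MeasurableSet {q : S × S | E q.1 q.2} := by
    have : {q : S × S | E q.1 q.2} = ⋃ (g : G), ⋃ (h : H), {q : S × S | g • h • q.1 = q.2} := by
      ext q
      simp [E]
    rw [this]
    exact .iUnion fun g => .iUnion fun h => measurableSet_eq_fun ((measurable_const_smul g).comp
      ((measurable_const_smul h).comp measurable_fst)) measurable_snd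
  obtain ⟨i₀⟩ := ‹Nonempty ι›
  have hfreeS : ∀ (w : S) (g : G) (h : H), p (g • h • w) = p w → h = 1 := fun w g h hw =>
    (hSP w w.2).2.1 h hw
  obtain ⟨V, hVm, hV1, hV2⟩ := exists_trivialization_of_MFI (G := G) (H := H) m hMFI
    (e := amplified E p Z i₀ r) (amplified_equivalence hE heq) (fun i => by
      refine (measurableSet_eq_fun measurable_fst measurable_snd).union (hEm.inter
        ((measurableSet_rel (hrm i) (hY.comp measurable_fst) (hY.comp measurable_snd)).inter
          (MeasurableSet.union (.const _) ((measurable_fst (hΩ hDG)).inter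
            (measurable_snd (hΩ hDG)))))))
    (by
      rintro i w w' (rfl | h)
      · exact ⟨1, 1, by simp⟩
      · exact h.1)
    (amplified_indepRel hr heq (by
      rintro w hw w' hw' ⟨g, h, rfl⟩ hpw
      obtain rfl := hfreeS w g h hpw.symm
      rw [one_smul] at hw' ⊢
      rw [(hSP w w.2).2.2.2.1 g hw hw', one_smul]))
    (fun w g h => amplified_generates hE heq
      (fun w => by
        obtain ⟨g, hg⟩ := (hSP w w.2).2.2.1
        exact ⟨g • w, hg, ⟨g, 1, by rw [one_smul]⟩, rfl⟩)
      (fun i w y hy => by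
        obtain ⟨h, rfl⟩ := hrH _ _ _ hy
        exact ⟨h • w, ⟨1, h, one_smul _ _⟩, rfl⟩)
      (by
        rintro w _ ⟨g, h, rfl⟩
        exact hgen (p w) h) ⟨g, h, rfl⟩)
    (A := A) (hΩ hDH)
    (fun w => by
      obtain ⟨h, hh⟩ := (hSP w w.2).2.2.2.2.1
      refine ⟨h, hh, fun h' hh' => ?_⟩
      have h1 := (hSP _ (h • w).2).2.2.2.2.2 (h' * h⁻¹) hh (by
        rw [hHval]
        have h2 : h' • w.1.1 ∈ DH := hh'
        simpa [mul_smul] using h2)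
      exact mul_inv_eq_one.mp h1)
    (hmA ▸ hpos) (hmA ▸ hfin)
    (fun w g h hw => by
      obtain rfl := hfreeS w g h (by rw [hw])
      rw [one_smul] at hw
      exact (hSP w w.2).1 g (congrArg (fun w : S => w.1.1) hw))
  refine ⟨fun i => (↑) '' V i, fun i => hSm.subtype_image (hVm i), ?_, ?_⟩
  · rintro i j ω y g h ⟨w, hw, hwy⟩ ⟨w', hw', hwy'⟩
    have hww' : g • h • w = w' := Subtype.ext (by
      rw [hwy', hGval, hHval, hwy])
    obtain ⟨hij, hamp⟩ := hV1 i j w w' hw hw' ⟨g, h, hww'⟩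
    refine ⟨hij, ?_⟩
    have hpw : p w = y := congrArg Prod.snd hwy
    have hpw' : p w' = h • y := congrArg Prod.snd hwy'
    rw [← hpw', ← hpw]
    rcases hamp with rfl | hamp
    · exact (heq i).refl _
    · exact hamp.2.1
  · rw [ae_iff, comap_subtype_coe_apply hSm] at hV2
    have hnull : ν.prod μ
        (Sᶜ ∪ (↑) '' {w : S | ¬ ∃ (g : G) (h : H) (i : ι), g • h • w ∈ V i}) = 0 :=
      measure_union_null hSnull hV2
    refine Filter.mem_of_superset (compl_mem_ae_iff.mpr hnull) fun t ht => ?_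
    by_contra hcon
    refine ht ?_
    by_cases htS : t ∈ S
    · refine Or.inr ⟨⟨t, htS⟩, fun ⟨g, h, i, hi⟩ => hcon ⟨g, h, i, _, hi, rfl⟩, rfl⟩
    · exact Or.inl htS

end ProductCoupling

section FiniteCosets

variable {Y ι H : Type}

/-- A step in one of the relations `r k`, other than a step of `r i` inside the `r i`-class
of `x`. -/
def AvoidingStep (r : ι → Y → Y → Prop) (i : ι) (x a b : Y) : Prop :=
  ∃ k, r k a b ∧ ¬ (k = i ∧ r i x a)

variable {r : ι → Y → Y → Prop}

theorem IndepRel.eq_of_avoiding (hr : IndepRel r) (heq : ∀ i, Equivalence (r i)) {i j : ι}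
    {x x' z z' : Y} (hx : r i x x') (hz : r j z z') (hne : ¬ (j = i ∧ r i x z))
    (h : Relation.ReflTransGen (AvoidingStep r i x) x z)
    (h' : Relation.ReflTransGen (AvoidingStep r i x') x' z') : x = x' := by
  classical
  let c : ι → Y → Y → Multiplicative (Y →₀ ℤ) := fun k a b =>
    if k = i ∧ r i x a then basisElt a * (basisElt b)⁻¹ else 1
  obtain ⟨b, hb⟩ := hr.exists_potential (c := c) heq (by
    intro k u v w huv hvw
    by_cases hk : k = i ∧ r i x u
    · obtain ⟨rfl, hu⟩ := hk
      simp [c, hu, (heq k).trans hu huv]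
    · have hk' : ¬ (k = i ∧ r i x v) := by
        rintro ⟨rfl, hv⟩
        exact hk ⟨rfl, (heq k).trans hv ((heq k).symm huv)⟩
      simp [c, hk, hk'])
  have hstep : ∀ k u v, r k u v → ¬ (k = i ∧ r i x u) → b u = b v := by
    intro k u v huv hk
    have h1 := hb k u v huv
    simp only [c, if_neg hk] at h1
    exact mul_inv_eq_one.mp h1.symm
  have hpath : ∀ {x₁ z₁}, r i x x₁ → Relation.ReflTransGen (AvoidingStep r i x₁) x₁ z₁ →
      b x₁ = b z₁ := by
    intro x₁ z₁ hx₁ hp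
    induction hp with
    | refl => rfl
    | tail _ hs ih =>
      obtain ⟨k, hk, hk'⟩ := hs
      exact ih.trans (hstep k _ _ hk fun hcon =>
        hk' ⟨hcon.1, (heq i).trans ((heq i).symm hx₁) hcon.2⟩)
  have h1 : b x = b x' := by
    rw [hpath ((heq i).refl x) h, hpath hx h', hstep j z z' hz hne]
  by_contra hxx
  have h2 := hb i x x' hx
  simp only [c, if_pos (And.intro rfl ((heq i).refl x)), h1, mul_inv_cancel] at h2
  exact basisElt_mul_inv_ne_one hxx h2

theorem exists_exit_point (heq : ∀ i, Equivalence (r i)) {x z : Y} (i : ι)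
    (h : Relation.EqvGen (fun a b => ∃ k, r k a b) x z) :
    ∃ x', r i x x' ∧ Relation.ReflTransGen (AvoidingStep r i x') x' z := by
  have hsymm : Std.Symm (fun a b => ∃ k, r k a b) := ⟨fun a b ⟨k, hk⟩ => ⟨k, (heq k).symm hk⟩⟩
  have h' : Relation.ReflTransGen (fun a b => ∃ k, r k a b) x z := by
    induction h with
    | rel _ _ h => exact .single h
    | refl => exact .refl
    | symm _ _ _ ih => exact Relation.ReflTransGen.stdSymm.symm _ _ ih
    | trans _ _ _ _ _ ih ih' => exact ih.trans ih'
  clear h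
  induction h' with
  | refl => exact ⟨x, (heq i).refl x, .refl⟩
  | @tail p p' _ hs ih =>
    obtain ⟨k, hk⟩ := hs
    obtain ⟨x', hx', hp⟩ := ih
    by_cases hkp : k = i ∧ r i x' p
    · obtain ⟨rfl, hkp⟩ := hkp
      exact ⟨p', (heq k).trans hx' ((heq k).trans hkp hk), .refl⟩
    · exact ⟨x', hx', hp.tail ⟨k, hk, hkp⟩⟩

variable [MeasurableSpace Y] [StandardBorelSpace Y] [Countable ι] [Group H] [Countable H]
  [MulAction H Y] [MeasurableConstSMul H Y]

theorem measurableSet_avoiding (hrm : ∀ i, MeasurableSet {p : Y × Y | r i p.1 p.2})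
    (hrH : ∀ i y y', r i y y' → ∃ h : H, h • y = y') (heq : ∀ i, Equivalence (r i)) (i : ι) :
    MeasurableSet {p : Y × Y | Relation.ReflTransGen (AvoidingStep r i p.1) p.1 p.2} := by
  let S : ℕ → Set (Y × Y) := fun n => Nat.rec {p | p.1 = p.2} (fun _ T => {p |
    ∃ (h : H) (k : ι), (p.1, h • p.2) ∈ T ∧ r k (h • p.2) p.2 ∧ ¬ (k = i ∧ r i p.1 (h • p.2))}) n
  have hS : ∀ n, MeasurableSet (S n) := by
    intro n
    induction n with
    | zero => exact measurableSet_eq_fun measurable_fst measurable_snd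
    | succ n ih =>
      have h2 : ∀ h : H, Measurable fun p : Y × Y => h • p.2 := fun h =>
        (measurable_const_smul h).comp measurable_snd
      have : S (n + 1) = ⋃ (h : H), ⋃ (k : ι), (fun p : Y × Y => (p.1, h • p.2)) ⁻¹' S n ∩
          ({p | r k (h • p.2) p.2} ∩ {p | k = i ∧ r i p.1 (h • p.2)}ᶜ) := by
        ext p
        simp [S]
      rw [this]
      exact .iUnion fun h => .iUnion fun k => (measurable_fst.prodMk (h2 h) ih).inter
        ((measurableSet_rel (hrm k) (h2 h) measurable_snd).inter
          ((MeasurableSet.const _).inter (measurableSet_rel (hrm i) measurable_fst (h2 h))).compl)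
  have : {p : Y × Y | Relation.ReflTransGen (AvoidingStep r i p.1) p.1 p.2} = ⋃ n, S n := by
    ext ⟨x, z⟩
    simp only [Set.mem_ofPred_eq, Set.mem_iUnion]
    constructor
    · intro h
      induction h with
      | refl => exact ⟨0, rfl⟩
      | @tail p p' _ hs ih =>
        obtain ⟨n, hn⟩ := ih
        obtain ⟨k, hk, hk'⟩ := hs
        obtain ⟨h, rfl⟩ := hrH k _ _ ((heq k).symm hk)
        exact ⟨n + 1, h, k, hn, hk, hk'⟩
    · rintro ⟨n, hn⟩
      induction n generalizing z with
      | zero =>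
        obtain rfl : x = z := hn
        exact .refl
      | succ n ih =>
        obtain ⟨h, k, h1, h2, h3⟩ := hn
        exact (ih _ h1).tail ⟨k, h2, h3⟩
  rw [this]
  exact .iUnion hS

/-- If each orbit meets finitely many distinguished classes of the factors of a free product
decomposition, then the decomposition is inessential on the orbits where there are any. -/
theorem exists_section_of_finite_cosets [Nonempty ι] (heq : ∀ i, Equivalence (r i))
    (hrm : ∀ i, MeasurableSet {p : Y × Y | r i p.1 p.2})
    (hrH : ∀ i y y', r i y y' → ∃ h : H, h • y = y') (hr : IndepRel r)
    (hgen : ∀ y (h : H), Relation.EqvGen (fun a b => ∃ i, r i a b) y (h • y))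
    {W : ι → Set Y} (hWm : ∀ i, MeasurableSet (W i))
    (hW : ∀ i y y', r i y y' → y ∈ W i → y' ∈ W i)
    (hfin : ∀ y, ∃ T : Set (ι × Y), T.Finite ∧
      ∀ i (h : H), h • y ∈ W i → ∃ z, (i, z) ∈ T ∧ r i z (h • y)) :
    ∃ U : ι → Set Y, (∀ i, MeasurableSet (U i)) ∧
      (∀ i j y (h : H), y ∈ U i → h • y ∈ U j → i = j ∧ r i y (h • y)) ∧
      ∀ y, (∃ (h : H) (i : ι), h • y ∈ W i) → ∃ (h : H) (i : ι), h • y ∈ U i := by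
  classical
  obtain ⟨i₀⟩ := ‹Nonempty ι›
  obtain ⟨f, hf⟩ := exists_measurableEmbedding_real Y
  have hm : ∀ h : H, Measurable fun y : Y => h • y := fun h => measurable_const_smul h
  let Q : Set Y := {y | ∀ (h k : H) (i j : ι), h • y ∈ W i → k • y ∈ W j →
    i = j ∧ r i (h • y) (k • y)}
  have hQm : MeasurableSet Q := by
    have : Q = ⋂ (h : H), ⋂ (k : H), ⋂ (i : ι), ⋂ (j : ι), (((fun y => h • y) ⁻¹' W i ∩
        (fun y => k • y) ⁻¹' W j) ∩ ({_y | i = j} ∩ {y | r i (h • y) (k • y)})ᶜ)ᶜ := by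
      ext y
      simp only [Q, Set.mem_ofPred_eq, Set.mem_iInter, Set.mem_compl_iff, Set.mem_inter_iff,
        Set.mem_preimage]
      exact forall₄_congr fun h k i j => by tauto
    rw [this]
    exact .iInter fun h => .iInter fun k => .iInter fun i => .iInter fun j =>
      (((hm h (hWm i)).inter (hm k (hWm j))).inter
        ((MeasurableSet.const _).inter (measurableSet_rel (hrm i) (hm h) (hm k))).compl).compl
  have hQinv : ∀ y (h : H), y ∈ Q → h • y ∈ Q := by
    intro y h hy h₁ h₂ i j h1 h2
    rw [← mul_smul] at h1 h2
    simpa only [mul_smul] using hy (h₁ * h) (h₂ * h) i j h1 h2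
  let P : Set Y := {x | ∃ (i j : ι) (h : H), x ∈ W i ∧ h • x ∈ W j ∧ ¬ (j = i ∧ r i x (h • x)) ∧
    Relation.ReflTransGen (AvoidingStep r i x) x (h • x)}
  have hPm : MeasurableSet P := by
    have : P = ⋃ (i : ι), ⋃ (j : ι), ⋃ (h : H), W i ∩ ((fun y => h • y) ⁻¹' W j ∩
        (({_y | j = i} ∩ {x | r i x (h • x)})ᶜ ∩
          (fun x => (x, h • x)) ⁻¹'
            {p : Y × Y | Relation.ReflTransGen (AvoidingStep r i p.1) p.1 p.2})) := by
      ext y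
      simp [P]
    rw [this]
    exact .iUnion fun i => .iUnion fun j => .iUnion fun h => (hWm i).inter <|
      (hm h (hWm j)).inter <|
        ((MeasurableSet.const _).inter (measurableSet_rel (hrm i) measurable_id (hm h))).compl.inter
          (measurable_id.prodMk (hm h) (measurableSet_avoiding hrm hrH heq i))
  let M : Set Y := {x | x ∈ P ∧ ∀ h : H, h • x ∈ P → f x ≤ f (h • x)}
  have hMm : MeasurableSet M := by
    have : M = P ∩ ⋂ h : H, ((fun x => h • x) ⁻¹' P ∩ {x | f x ≤ f (h • x)}ᶜ)ᶜ := by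
      ext x
      simp only [M, Set.mem_ofPred_eq, Set.mem_inter_iff, Set.mem_iInter, Set.mem_compl_iff,
        Set.mem_preimage]
      exact and_congr_right fun _ => forall_congr' fun h => by tauto
    rw [this]
    exact hPm.inter (.iInter fun h => ((hm h hPm).inter
      (measurableSet_le hf.measurable (hf.measurable.comp (hm h))).compl).compl)
  have hPfin : ∀ y, {x | x ∈ P ∧ ∃ h : H, h • y = x}.Finite := by
    intro y
    obtain ⟨T, hT, hTy⟩ := hfin y
    refine ((hT.prod hT).biUnion (t := fun q => {x | r q.1.1 q.1.2 x ∧ ∃ z, r q.2.1 q.2.2 z ∧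
      ¬ (q.2.1 = q.1.1 ∧ r q.1.1 x z) ∧ Relation.ReflTransGen (AvoidingStep r q.1.1 x) x z})
      fun q _ => Set.Subsingleton.finite ?_).subset ?_
    · rintro x ⟨hx, z, hz, hne, hp⟩ x' ⟨hx', z', hz', -, hp'⟩
      exact hr.eq_of_avoiding heq ((heq _).trans ((heq _).symm hx) hx')
        ((heq _).trans ((heq _).symm hz) hz') hne hp hp'
    · rintro _ ⟨⟨i, j, k, hxi, hxj, hne, hp⟩, h, rfl⟩
      obtain ⟨z, hz, hzx⟩ := hTy i h hxi
      obtain ⟨z', hz', hzx'⟩ := hTy j (k * h) (by rwa [mul_smul])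
      rw [mul_smul] at hzx'
      exact Set.mem_biUnion (x := ((i, z), (j, z'))) ⟨hz, hz'⟩ ⟨hzx, _, hzx', hne, hp⟩
  refine ⟨fun i => (W i ∩ Q) ∪ {x | (x ∈ M ∧ x ∉ Q) ∧ i = i₀}, fun i => ((hWm i).inter hQm).union
    ((hMm.inter hQm.compl).inter (.const _)), ?_, ?_⟩
  · rintro i j y h (⟨hy, hyQ⟩ | ⟨⟨hyM, hyQ⟩, rfl⟩) (⟨hy', hyQ'⟩ | ⟨⟨hyM', hyQ'⟩, rfl⟩)
    · simpa using hyQ 1 h i j (by simpa using hy) hy'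
    · exact absurd (hQinv y h hyQ) hyQ'
    · exact absurd (by simpa using hQinv _ h⁻¹ hyQ') hyQ
    · refine ⟨rfl, ?_⟩
      have h1 := hyM.2 h hyM'.1
      have h2 := hyM'.2 h⁻¹ (by simpa using hyM.1)
      rw [inv_smul_smul] at h2
      rw [← hf.injective (le_antisymm h1 h2)]
      exact (heq _).refl y
  · rintro y ⟨h, i, hy⟩
    by_cases hyQ : y ∈ Q
    · exact ⟨h, i, .inl ⟨hy, hQinv y h hyQ⟩⟩
    have hne : {x | x ∈ P ∧ ∃ h : H, h • y = x}.Nonempty := by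
      have hyQ' := hyQ
      simp only [Q, Set.mem_ofPred_eq] at hyQ'
      push Not at hyQ'
      obtain ⟨h₁, h₂, i, j, h1, h2, h3⟩ := hyQ'
      obtain ⟨x', hx', hp⟩ := exists_exit_point heq (x := h₁ • y) (z := h₂ • y) i (by
        have h4 := hgen (h₁ • y) (h₂ * h₁⁻¹)
        rwa [mul_smul, inv_smul_smul] at h4)
      obtain ⟨k, rfl⟩ := hrH i _ _ hx'
      have h5 : (h₂ * h₁⁻¹ * k⁻¹) • k • h₁ • y = h₂ • y := by simp [mul_smul]
      refine ⟨k • h₁ • y, ⟨i, j, h₂ * h₁⁻¹ * k⁻¹, hW i _ _ hx' h1, ?_⟩, k * h₁, mul_smul _ _ _⟩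
      rw [h5]
      exact ⟨h2, fun hcon => h3 hcon.1.symm ((heq i).trans hx' hcon.2), hp⟩
    obtain ⟨x, ⟨hxP, k, rfl⟩, hx⟩ := Set.exists_min_image _ f (hPfin y) hne
    refine ⟨k, i₀, .inr ⟨⟨⟨hxP, fun h' hh' => hx _ ⟨hh', h' * k, mul_smul _ _ _⟩⟩, fun hcon => ?_⟩,
      rfl⟩⟩
    exact hyQ (by simpa using hQinv _ k⁻¹ hcon)

end FiniteCosets

section Descent

open scoped Pointwise

variable {Ω Y G H ι : Type} [Group G] [Group H] [MulAction G Ω] [MulAction H Ω] [MulAction H Y]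

/-- The saturation of a subset of `Ω × Y` under `G` and the relation `e` on `Y`. -/
def fiberSaturation (G H : Type) [Group G] [Group H] [MulAction G Ω] [MulAction H Ω]
    [MulAction H Y] (e : Y → Y → Prop) (V : Set (Ω × Y)) : Set (Ω × Y) :=
  {t | ∃ (g : G) (h : H), e t.2 (h • t.2) ∧ (g • h • t.1, h • t.2) ∈ V}

theorem smul_smul_mem_fiberSaturation {e : Y → Y → Prop} (he : Equivalence e) {V : Set (Ω × Y)}
    {h : H} {ω : Ω} {y : Y} (hy : e y (h • y)) :
    (h • ω, h • y) ∈ fiberSaturation G H e V ↔ (ω, y) ∈ fiberSaturation G H e V := by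
  constructor
  · rintro ⟨g, k, h1, h2⟩
    refine ⟨g, k * h, ?_, ?_⟩
    · rw [mul_smul]
      exact he.trans hy h1
    · simpa only [mul_smul] using h2
  · rintro ⟨g, k, h1, h2⟩
    refine ⟨g, k * h⁻¹, ?_, ?_⟩
    · simp only [mul_smul, inv_smul_smul]
      exact he.trans (he.symm hy) h1
    · simpa only [mul_smul, inv_smul_smul] using h2

theorem measurableSet_fiberSaturation [MeasurableSpace Ω] [MeasurableSpace Y]
    [MeasurableConstSMul G Ω] [MeasurableConstSMul H Ω] [MeasurableConstSMul H Y] [Countable G]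
    [Countable H] {e : Y → Y → Prop}
    (hem : MeasurableSet {p : Y × Y | e p.1 p.2}) {V : Set (Ω × Y)} (hV : MeasurableSet V) :
    MeasurableSet (fiberSaturation G H e V) := by
  have : fiberSaturation G H e V = ⋃ (g : G), ⋃ (h : H), {t | e t.2 (h • t.2)} ∩
      (fun t : Ω × Y => (g • h • t.1, h • t.2)) ⁻¹' V := by
    ext t
    simp [fiberSaturation]
  rw [this]
  have h2 : ∀ h : H, Measurable fun t : Ω × Y => h • t.2 := fun h =>
    (measurable_const_smul h).comp measurable_snd
  exact .iUnion fun g => .iUnion fun h => (measurableSet_rel hem measurable_snd (h2 h)).inter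
    ((((measurable_const_smul g).comp ((measurable_const_smul h).comp measurable_fst)).prodMk
      (h2 h)) hV)

variable [SMulCommClass G H Ω]

theorem smul_mem_fiberSaturation {e : Y → Y → Prop} {V : Set (Ω × Y)} (g : G) {ω : Ω} {y : Y} :
    (g • ω, y) ∈ fiberSaturation G H e V ↔ (ω, y) ∈ fiberSaturation G H e V := by
  constructor
  · rintro ⟨g', h, h1, h2⟩
    refine ⟨g' * g, h, h1, ?_⟩
    rwa [mul_smul, smul_comm g h]
  · rintro ⟨g', h, h1, h2⟩
    refine ⟨g' * g⁻¹, h, h1, ?_⟩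
    change ((g' * g⁻¹) • h • g • ω, h • y) ∈ V
    rwa [mul_smul, smul_comm g⁻¹ h, inv_smul_smul]

theorem fiberSaturation_unique {r : ι → Y → Y → Prop} (heq : ∀ i, Equivalence (r i))
    {V : ι → Set (Ω × Y)}
    (hV : ∀ i j ω y (g : G) (h : H), (ω, y) ∈ V i → (g • h • ω, h • y) ∈ V j →
      i = j ∧ r i y (h • y)) {i j : ι} {ω : Ω} {y : Y} {h : H}
    (h1 : (ω, y) ∈ fiberSaturation G H (r i) (V i))
    (h2 : (h • ω, h • y) ∈ fiberSaturation G H (r j) (V j)) : i = j ∧ r i y (h • y) := by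
  obtain ⟨g, k, h3, h4⟩ := h1
  obtain ⟨g', k', h5, h6⟩ := h2
  simp only at h3 h4 h5 h6
  obtain ⟨rfl, h7⟩ := hV i j _ _ (g' * g⁻¹) (k' * h * k⁻¹) h4 (by
    simpa only [mul_smul, smul_comm g k⁻¹, smul_comm g⁻¹, inv_smul_smul] using h6)
  simp only [mul_smul, inv_smul_smul] at h7
  exact ⟨rfl, (heq i).trans h3 ((heq i).trans h7 ((heq i).symm h5))⟩

variable [MeasurableSpace Ω] [MeasurableSpace Y] [MeasurableConstSMul G Ω]
  [MeasurableConstSMul H Ω] [MeasurableConstSMul H Y] [Countable G] [Countable H]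
  (ν : Measure Ω) [SigmaFinite ν] [SMulInvariantMeasure G Ω ν] [SMulInvariantMeasure H Ω ν]
  (μ : Measure Y) [SigmaFinite μ]

/-- A trivialization of the decomposition lifted to `Ω × Y` descends to `Y`. -/
theorem exists_trivialization_of_product [StandardBorelSpace Y] [Countable ι] [Nonempty ι]
    {D : Set Ω} (hD : IsFundamentalDomain G D ν) (hDm : MeasurableSet D) (hpos : ν D ≠ 0)
    (hfin : ν D ≠ ⊤)
    {r : ι → Y → Y → Prop} (heq : ∀ i, Equivalence (r i))
    (hrm : ∀ i, MeasurableSet {p : Y × Y | r i p.1 p.2})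
    (hrH : ∀ i y y', r i y y' → ∃ h : H, h • y = y') (hr : IndepRel r)
    (hgen : ∀ y (h : H), Relation.EqvGen (fun a b => ∃ i, r i a b) y (h • y))
    {V : ι → Set (Ω × Y)} (hVm : ∀ i, MeasurableSet (V i))
    (hV : ∀ i j ω y (g : G) (h : H), (ω, y) ∈ V i → (g • h • ω, h • y) ∈ V j →
      i = j ∧ r i y (h • y))
    (hVae : ∀ᵐ t ∂ν.prod μ, ∃ (g : G) (h : H) (i : ι), (g • h • t.1, h • t.2) ∈ V i) :
    ∃ U : ι → Set Y, (∀ i, MeasurableSet (U i)) ∧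
      (∀ i j y (h : H), y ∈ U i → h • y ∈ U j → i = j ∧ r i y (h • y)) ∧
      ∀ᵐ y ∂μ, ∃ (h : H) (i : ι), h • y ∈ U i := by
  let S : ι → Set (Ω × Y) := fun i => fiberSaturation G H (r i) (V i)
  have hSm : ∀ i, MeasurableSet (S i) := fun i => measurableSet_fiberSaturation (hrm i) (hVm i)
  let B : ι → Y → Set Ω := fun i y => {ω | (ω, y) ∈ S i}
  have hBm : ∀ i y, MeasurableSet (B i y) := fun i y => measurable_prodMk_right (hSm i)
  let w : ι → Y → ENNReal := fun i y => ν (B i y ∩ D)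
  have hwm : ∀ i, Measurable (w i) := by
    intro i
    have h1 := measurable_measure_prodMk_right (μ := ν) ((hSm i).inter (measurable_fst hDm))
    exact h1
  have hshift : ∀ i (h : H) y, ν ((fun ω => h • ω) ⁻¹' B i (h • y) ∩ D) = w i (h • y) := by
    intro i h y
    have := SMulCommClass.symm G H Ω
    have h1 := hD.measure_set_eq (hD.smul_of_comm h) (hBm i (h • y))
      (fun g => Set.ext fun ω => smul_mem_fiberSaturation g)
    change _ = ν (B i (h • y) ∩ D)
    rw [h1, ← measure_preimage_smul ν h (B i (h • y) ∩ h • D)]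
    congr 1
    ext ω
    simp [Set.smul_mem_smul_set_iff]
  have hwinv : ∀ i y y', r i y y' → w i y = w i y' := by
    intro i y y' hy
    obtain ⟨h, rfl⟩ := hrH i y y' hy
    rw [← hshift]
    refine congrArg (fun T => ν (T ∩ D)) (Set.ext fun ω => ?_)
    exact (smul_smul_mem_fiberSaturation (heq i) hy).symm
  let ε : ℕ → ENNReal := fun n => ((n : ENNReal) + 1)⁻¹
  have hε : ∀ n, 0 < ε n := fun n => by simp [ε]
  let W : ι → Set Y := fun i => {y | ∃ n, ε n ≤ w i y ∧ ∀ m < n, ∀ (h : H) j, ¬ ε m ≤ w j (h • y)}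
  have hWm : ∀ i, MeasurableSet (W i) := by
    intro i
    have : W i = ⋃ n, {y | ε n ≤ w i y} ∩ ⋂ m, ⋂ (_ : m < n), ⋂ (h : H), ⋂ j,
        {y | ε m ≤ w j (h • y)}ᶜ := by
      ext y
      simp [W]
    rw [this]
    exact .iUnion fun n => (measurableSet_le measurable_const (hwm i)).inter <|
      .iInter fun m => .iInter fun _ => .iInter fun h => .iInter fun j =>
        (measurableSet_le measurable_const ((hwm j).comp (measurable_const_smul h))).compl
  obtain ⟨U, hUm, hU, hUW⟩ := exists_section_of_finite_cosets heq hrm hrH hr hgen hWm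
    (by
      rintro i y y' hy ⟨n, hn, hn'⟩
      refine ⟨n, hwinv i y y' hy ▸ hn, fun m hm h j => ?_⟩
      obtain ⟨k, rfl⟩ := hrH i y y' hy
      rw [← mul_smul]
      exact hn' m hm _ j)
    (by
      intro y
      by_cases hy : ∃ n, ∃ (h : H) (i : ι), ε n ≤ w i (h • y)
      swap
      · refine ⟨∅, Set.finite_empty, fun i h hi => ?_⟩
        obtain ⟨n, hn, -⟩ := hi
        exact absurd ⟨n, h, i, hn⟩ hy
      obtain ⟨n, ⟨h₀, i₀, hn₀⟩, hmin⟩ := exists_least_nat hy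
      let s : Setoid (ι × H) :=
        { r := fun p q => p.1 = q.1 ∧ r p.1 (p.2 • y) (q.2 • y)
          iseqv :=
            { refl := fun p => ⟨rfl, (heq _).refl _⟩
              symm := by
                rintro ⟨i, h⟩ ⟨j, k⟩ ⟨rfl, h1⟩
                exact ⟨rfl, (heq _).symm h1⟩
              trans := by
                rintro ⟨i, h⟩ ⟨j, k⟩ ⟨l, k'⟩ ⟨rfl, h1⟩ ⟨rfl, h2⟩
                exact ⟨rfl, (heq _).trans h1 h2⟩ } }
      let A : Quotient s → Set Ω := fun q =>
        (fun ω => q.out.2 • ω) ⁻¹' B q.out.1 (q.out.2 • y) ∩ D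
      have hAfin := Measure.finite_const_le_meas_of_disjoint_iUnion ν (hε n) (As := A)
        (fun q => ((measurable_const_smul q.out.2) (hBm _ _)).inter hDm)
        (by
          intro q q' hqq'
          refine Set.disjoint_left.mpr fun ω h1 h2 => hqq' ?_
          rw [← Quotient.out_equiv_out]
          have h3 := fiberSaturation_unique heq hV (i := q.out.1) (j := q'.out.1)
            (ω := q.out.2 • ω) (y := q.out.2 • y) (h := q'.out.2 * q.out.2⁻¹) h1.1 (by
              simp only [mul_smul, inv_smul_smul]
              exact h2.1)
          simp only [mul_smul, inv_smul_smul] at h3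
          exact h3)
        (ne_top_of_le_ne_top hfin
          (measure_mono (Set.iUnion_subset fun q => Set.inter_subset_right)))
      refine ⟨(fun q : Quotient s => (q.out.1, q.out.2 • y)) '' {q | ε n ≤ ν (A q)},
        hAfin.image _, ?_⟩
      rintro i h ⟨n', hn', hmin'⟩
      have hle : n ≤ n' := by
        by_contra hcon
        exact hmin n' (by omega) ⟨h, i, hn'⟩
      have hge : n' ≤ n := by
        by_contra hcon
        refine hmin' n (by omega) (h₀ * h⁻¹) i₀ ?_
        rwa [mul_smul, inv_smul_smul]
      obtain rfl := le_antisymm hle hge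
      obtain ⟨h1, h2⟩ : s (⟦(i, h)⟧ : Quotient s).out (i, h) := Quotient.mk_out (i, h)
      refine ⟨(⟦(i, h)⟧ : Quotient s).out.2 • y, ⟨⟦(i, h)⟧, ?_, Prod.ext h1 rfl⟩, ?_⟩
      · change _ ≤ ν ((fun ω => (⟦(i, h)⟧ : Quotient s).out.2 • ω) ⁻¹' _ ∩ D)
        rw [hshift, hwinv _ _ _ h2]
        simpa only [h1] using hn'
      · simpa only [h1] using h2)
  refine ⟨U, hUm, hU, ?_⟩
  have hae : ∀ᵐ y ∂μ, ∀ᵐ ω ∂ν, ∃ (h : H) (i : ι), (h • ω, h • y) ∈ S i := by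
    have h1 : ∀ᵐ t ∂μ.prod ν, ∃ (g : G) (h : H) (i : ι), (g • h • t.2, h • t.1) ∈ V i :=
      Measure.measurePreserving_swap.quasiMeasurePreserving.ae hVae
    filter_upwards [Measure.ae_ae_of_ae_prod h1] with y hy
    filter_upwards [hy] with ω hω
    obtain ⟨g, h, i, hi⟩ := hω
    refine ⟨h, i, g, 1, ?_, ?_⟩
    · rw [one_smul]
      exact (heq i).refl _
    · simpa only [one_smul] using hi
  filter_upwards [hae] with y hy
  refine hUW y ?_
  have hex : ∃ (h : H) (i : ι), w i (h • y) ≠ 0 := by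
    by_contra! hcon
    refine hpos (measure_mono_null (t := {ω | ¬ ∃ (h : H) (i : ι), (h • ω, h • y) ∈ S i} ∪
      ⋃ (h : H), ⋃ (i : ι), (fun ω => h • ω) ⁻¹' B i (h • y) ∩ D) ?_ ?_)
    · intro ω hω
      by_cases hcase : ∃ (h : H) (i : ι), (h • ω, h • y) ∈ S i
      · obtain ⟨h, i, hi⟩ := hcase
        exact .inr (Set.mem_iUnion₂.mpr ⟨h, i, hi, hω⟩)
      · exact .inl hcase
    · refine measure_union_null hy (measure_iUnion_null fun h => measure_iUnion_null fun i => ?_)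
      rw [hshift, hcon]
  have hex' : ∃ n, ∃ (h : H) (i : ι), ε n ≤ w i (h • y) := by
    obtain ⟨h, i, hi⟩ := hex
    obtain ⟨n, hn⟩ := ENNReal.exists_inv_nat_lt hi
    refine ⟨n, h, i, le_trans ?_ hn.le⟩
    simp only [ε]
    gcongr
    exact le_self_add
  obtain ⟨n, ⟨h, i, hn⟩, hmin⟩ := exists_least_nat hex'
  refine ⟨h, i, n, hn, fun m hm k j hcon => hmin m hm ⟨k * h, j, ?_⟩⟩
  rwa [mul_smul]

end Descent

/-- A trivialization of the family of the relations `Rf i` extended by equality outside their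
domains yields a trivialization of the family `Rf`. -/
theorem inessentialMod_of_extended {X ι : Type} [MeasurableSpace X] [Countable ι] {μ : Measure X}
    {R : CBER X} {Rf : ι → CBER X} (hsub : ∀ i x y, (Rf i).rel x y → R.rel x y)
    (hRdom : R.dom = Set.univ) (hdom : ∀ x, ∃ i, x ∈ (Rf i).dom) {U : ι → Set X}
    (hUm : ∀ i, MeasurableSet (U i))
    (hU : ∀ i j x y, x ∈ U i → y ∈ U j → R.rel x y → i = j ∧ (x = y ∨ (Rf i).rel x y))
    {C : Set X} (hCm : MeasurableSet C) (hC : μ Cᶜ = 0)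
    (hUC : ∀ x ∈ C, ∃ i, ∃ y ∈ U i, R.rel x y) : InessentialMod μ R Rf := by
  rcases isEmpty_or_nonempty X with hX | ⟨⟨x₀⟩⟩
  · exact ⟨fun _ => ∅, ∅, by simp, by simp, fun i j _ => by simp, by simp, by
      simp [Set.eq_empty_of_isEmpty, μ.eq_zero_of_isEmpty], by simp, by simp, by simp⟩
  have : Nonempty ι := ⟨(hdom x₀).choose⟩
  obtain ⟨s, hsm, hs, -⟩ := exists_measurable_selection (fun i => (Rf i).dom)
    (fun i => (Rf i).dom_meas)
  have hRrefl : ∀ x, R.rel x x := fun x => R.refl x (hRdom ▸ trivial)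
  let U' : ι → Set X := fun j => (U j ∩ (Rf j).dom) ∪ ({x | s x = j} ∩ ⋃ i, U i \ (Rf i).dom)
  have hU'dom : ∀ j, ∀ x ∈ U' j, x ∈ (Rf j).dom := by
    rintro j x (hx | ⟨rfl, -⟩)
    · exact hx.2
    · exact hs x (hdom x)
  have hmem : ∀ {j x}, x ∈ U' j → ∃ i, x ∈ U i ∧ (x ∈ (Rf i).dom → i = j) ∧
      (x ∉ (Rf i).dom → s x = j) := by
    rintro j x (hx | ⟨hx, hx'⟩)
    · exact ⟨j, hx.1, fun _ => rfl, fun h => absurd hx.2 h⟩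
    · obtain ⟨i, hi⟩ := Set.mem_iUnion.mp hx'
      exact ⟨i, hi.1, fun h => absurd h hi.2, fun _ => hx⟩
  have hkey : ∀ i j x y, x ∈ U' i → y ∈ U' j → R.rel x y → i = j ∧ (Rf i).rel x y := by
    intro i j x y hx hy hxy
    obtain ⟨a, hxa, hxa', hxs⟩ := hmem hx
    obtain ⟨b, hyb, hyb', hys⟩ := hmem hy
    obtain ⟨rfl, rfl | hab⟩ := hU a b x y hxa hyb hxy
    · have hij : i = j := by
        by_cases h : x ∈ (Rf a).dom
        · rw [← hxa' h, ← hyb' h]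
        · rw [← hxs h, ← hys h]
      exact ⟨hij, (Rf i).refl x (hU'dom i x hx)⟩
    · obtain ⟨h1, h2⟩ := (Rf a).rel_dom hab
      obtain rfl := hxa' h1
      exact ⟨hyb' h2, hab⟩
  refine ⟨U', C, fun j => ?_, fun j x _ => hRdom ▸ trivial, fun i j hij => ?_, hCm, hC, ?_, ?_, ?_⟩
  · exact ((hUm j).inter (Rf j).dom_meas).union
      ((hsm j).inter (.iUnion fun i => (hUm i).diff (Rf i).dom_meas))
  · exact Set.disjoint_left.mpr fun x hx hx' => hij (hkey i j x x hx hx' (hRrefl x)).1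
  · rintro x ⟨-, hx⟩
    obtain ⟨i, y, hy, hxy⟩ := hUC x hx
    refine ⟨y, ?_, hxy⟩
    by_cases h : y ∈ (Rf i).dom
    · exact Set.mem_iUnion.mpr ⟨i, .inl ⟨hy, h⟩⟩
    · exact Set.mem_iUnion.mpr ⟨s y, .inr ⟨rfl, Set.mem_iUnion.mpr ⟨i, hy, h⟩⟩⟩
  · exact fun i j x hx y hy hxy => (hkey i j x y hx.1 hy.1 hxy).1
  · exact fun j x hx y hy => ⟨fun h => (hkey j j x y hx.1 hy.1 h).2, hsub j x y⟩

theorem IsFundamentalDomainFor.ae_eq_one {G Ω : Type} [Group G] [Countable G] [MeasurableSpace Ω]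
    {ν : Measure Ω} {a : G → Ω → Ω} {D : Set Ω} (h : IsFundamentalDomainFor ν a D) :
    ∀ᵐ ω ∂ν, ∀ g : G, ω ∈ D → a g ω ∈ D → g = 1 := by
  refine ae_all_iff.mpr fun g => ?_
  by_cases hg : g = 1
  · simp [hg]
  · filter_upwards [measure_eq_zero_iff_ae_notMem.mp (h.2.2 g hg)] with ω hω h1 h2
    exact absurd ⟨h1, h2⟩ hω

theorem MFI.of_coupling {G H : Type} [Group G] [Countable G] [Group H] [Countable H]
    (c : MECoupling G H) (hMFI : MFI G) : MFI H := by
  intro X _ _ μ _ α R hfree horb ι _ Rf hprod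
  obtain ⟨Ω, ν, hσ, aG, aH, DG, DH, aG_one, aG_mul, aH_one, aH_mul, hcomm, mp_aG, mp_aH, free_aG,
    free_aH, fund_DG, fund_DH, DG_pos, DG_fin, DH_pos, DH_fin⟩ := c
  let _ : MulAction G Ω := { smul := aG, one_smul := aG_one, mul_smul := aG_mul }
  let _ : MulAction H Ω := { smul := aH, one_smul := aH_one, mul_smul := aH_mul }
  let _ : MulAction H X := { smul := α.act, one_smul := α.act_one, mul_smul := α.act_mul }
  have : SMulCommClass G H Ω := ⟨hcomm⟩
  have : MeasurableConstSMul G Ω := ⟨fun g => (mp_aG g).measurable⟩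
  have : MeasurableConstSMul H Ω := ⟨fun h => (mp_aH h).measurable⟩
  have : MeasurableConstSMul H X := ⟨fun h => (α.measurePreserving h).measurable⟩
  have : SMulInvariantMeasure G Ω ν :=
    ⟨fun g s hs => (mp_aG g).measure_preimage hs.nullMeasurableSet⟩
  have : SMulInvariantMeasure H Ω ν :=
    ⟨fun h s hs => (mp_aH h).measure_preimage hs.nullMeasurableSet⟩
  have : SMulInvariantMeasure H X μ :=
    ⟨fun h s hs => (α.measurePreserving h).measure_preimage hs.nullMeasurableSet⟩
  obtain ⟨hindep, hdomU, hgenR⟩ := hprod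
  obtain ⟨hRdom, hRorb⟩ := horb
  have hdom : ∀ x, ∃ i, x ∈ (Rf i).dom := fun x =>
    Set.mem_iUnion.mp (hdomU ▸ hRdom ▸ Set.mem_univ x)
  have : Nonempty ι := ⟨(hdom (μ.nonempty_of_neZero).some).choose⟩
  have hRiff : ∀ x y, R.rel x y ↔ ∃ h : H, h • x = y := fun x y =>
    (hRorb x y).trans ⟨fun ⟨h, _, hh⟩ => ⟨h, hh⟩, fun ⟨h, hh⟩ => ⟨h, trivial, hh⟩⟩
  have hsub : ∀ i x y, (Rf i).rel x y → R.rel x y := fun i x y hxy =>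
    (hgenR x y).mpr ⟨hRdom ▸ trivial, .rel _ _ ⟨i, hxy⟩⟩
  let r : ι → X → X → Prop := fun i x y => x = y ∨ (Rf i).rel x y
  have heq : ∀ i, Equivalence (r i) := fun i =>
    { refl := fun x => .inl rfl
      symm := by
        rintro x y (rfl | h)
        · exact .inl rfl
        · exact .inr ((Rf i).symm h)
      trans := by
        rintro x y z (rfl | h) (rfl | h')
        · exact .inl rfl
        · exact .inr h'
        · exact .inr h
        · exact .inr ((Rf i).trans h h') }
  have hrm : ∀ i, MeasurableSet {p : X × X | r i p.1 p.2} := fun i =>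
    (measurableSet_eq_fun measurable_fst measurable_snd).union (Rf i).rel_meas
  have hrH : ∀ i x y, r i x y → ∃ h : H, h • x = y := by
    rintro i x y (rfl | h)
    · exact ⟨1, one_smul _ _⟩
    · exact (hRiff x y).mp (hsub i x y h)
  have hr : IndepRel r := fun n x i hn hx hne hstep =>
    hindep n x i hn hx hne fun j hj => (hstep j hj).resolve_left (hne j hj)
  have hgen : ∀ x (h : H), Relation.EqvGen (fun a b => ∃ i, r i a b) x (h • x) := fun x h =>
    Relation.EqvGen.mono (fun _ _ ⟨i, hi⟩ => ⟨i, .inr hi⟩) _ _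
      ((hgenR x (h • x)).mp ((hRiff _ _).mpr ⟨h, rfl⟩)).2
  obtain ⟨V, hVm, hV, hVae⟩ := exists_product_trivialization ν μ hMFI fund_DG.1 fund_DH.1 free_aG
    hfree fund_DG.2.1 fund_DG.ae_eq_one fund_DH.2.1 fund_DH.ae_eq_one DH_pos.ne' DH_fin.ne heq hrm
    hrH hr hgen
  have hD : IsFundamentalDomain G DG ν := by
    refine .mk'' fund_DG.1.nullMeasurableSet fund_DG.2.1 (fun g hg => ?_)
      fun g => (measurePreserving_smul g ν).quasiMeasurePreserving
    change ν (_ ∩ _) = 0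
    rw [Set.inter_comm, ← inv_inv g, ← Set.preimage_smul]
    exact fund_DG.2.2 g⁻¹ (inv_ne_one.mpr hg)
  obtain ⟨U, hUm, hU, hUae⟩ := exists_trivialization_of_product ν μ hD fund_DG.1 DG_pos.ne'
    DG_fin.ne heq hrm hrH hr hgen hVm hV hVae
  refine inessentialMod_of_extended (C := {x | ∃ (h : H) (i : ι), h • x ∈ U i}) hsub hRdom hdom hUm
    ?_ ?_ hUae ?_
  · intro i j x y hx hy hxy
    obtain ⟨h, rfl⟩ := (hRiff x y).mp hxy
    exact hU i j x h hx hy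
  · have : {x | ∃ (h : H) (i : ι), h • x ∈ U i} =
        ⋃ (h : H), ⋃ (i : ι), (fun x => h • x) ⁻¹' U i := by
      ext x
      simp
    rw [this]
    exact .iUnion fun h => .iUnion fun i => measurable_const_smul h (hUm i)
  · rintro x ⟨h, i, hi⟩
    exact ⟨i, h • x, hi, (hRiff _ _).mpr ⟨h, rfl⟩⟩

/-- The coupling with the roles of the two groups exchanged. -/
def MECoupling.swap {G H : Type} [Group G] [Group H] (c : MECoupling G H) : MECoupling H G where
  Ω := c.Ω
  mΩ := c.mΩ
  sbΩ := c.sbΩ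
  ν := c.ν
  sigmaFinite := c.sigmaFinite
  aG := c.aH
  aH := c.aG
  DG := c.DH
  DH := c.DG
  aG_one := c.aH_one
  aG_mul := c.aH_mul
  aH_one := c.aG_one
  aH_mul := c.aG_mul
  comm h g x := (c.comm g h x).symm
  mp_aG := c.mp_aH
  mp_aH := c.mp_aG
  free_aG := c.free_aH
  free_aH := c.free_aG
  fund_DG := c.fund_DH
  fund_DH := c.fund_DG
  DG_pos := c.DH_pos
  DG_fin := c.DH_fin
  DH_pos := c.DG_pos
  DH_fin := c.DG_fin

/-- Measurable free indecomposability is a measure equivalence invariant. -/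
theorem MFI_ME_invariant
    {G H : Type} [Group G] [Countable G] [Group H] [Countable H]
    (hME : MeasureEquivalent G H) : MFI G ↔ MFI H := by
  obtain ⟨c⟩ := hME
  exact ⟨MFI.of_coupling c, MFI.of_coupling c.swap⟩
end

section
/- Let G₁, G₂, G'₁, G'₂ be nontrivial groups, each freely indecomposable in the classical sense (not isomorphic to a free product of two nontrivial groups) and not isomorphic to the infinite cyclic group ℤ. If Θ : G₁ * G₂ → G'₁ * G'₂ is an isomorphism between the free products, then there exist a permutation σ of {1, 2} and elements w₁, w₂ ∈ G'₁ * G'₂ such that Θ(G_i) = w_i G'_{σ(i)} w_i⁻¹ for i = 1, 2, where each factor is identified with its canonical image in the corresponding free product. -/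
/-- A group is freely indecomposable in the classical sense: it is not isomorphic to a
free product of two nontrivial groups. -/
def ClassicallyFreelyIndecomposable (G : Type) [Group G] : Prop :=
  ∀ (H₁ H₂ : Type) [Group H₁] [Group H₂],
    Nontrivial H₁ → Nontrivial H₂ → IsEmpty (G ≃* Monoid.Coprod H₁ H₂)

/-- The group `G` is the (internal) free product of the family of subgroups `S`. -/
structure IsInternalFreeProduct {ι G : Type} [Group G] (S : ι → Subgroup G) : Prop where
  iSup_eq_top : ⨆ i, S i = ⊤
  exists_lift : ∀ (K : Type) [Group K] (f : ∀ i, S i →* K),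
    ∃ F : G →* K, ∀ i (s : S i), F s = f i s

namespace IsInternalFreeProduct

variable {ι G : Type} [Group G] {S : ι → Subgroup G}

/-- Cocycles on the free factors, with values in `K`, extend to a cocycle on the free product. -/
theorem exists_cocycle (hS : IsInternalFreeProduct S) {X K : Type} [MulAction G X] [Group K]
    (c : ∀ i, S i → X → K)
    (hc : ∀ i (a b : S i) x, c i (a * b) x = c i a ((b : G) • x) * c i b x) :
    ∃ C : G → X → K, (∀ a b x, C (a * b) x = C a (b • x) * C b x) ∧
      ∀ i (s : S i) x, C s x = c i s x := by
  have hone : ∀ i x, c i 1 x = 1 := by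
    intro i x
    have := hc i 1 1 x
    simpa using this
  let f : ∀ i, S i →* SemidirectProduct (X → K) G mulAutArrow := fun i =>
    { toFun := fun a => ⟨fun x => c i a ((a : G)⁻¹ • x), a⟩
      map_one' := by
        ext x
        · simp [hone]
        · simp
      map_mul' := by
        intro a b
        ext x
        · rw [SemidirectProduct.mul_left, Pi.mul_apply, mulAutArrow_apply_apply]
          simp only [hc, Subgroup.coe_mul, mul_inv_rev, mul_smul, smul_inv_smul]
          rfl
        · simp }
  obtain ⟨F, hF⟩ := hS.exists_lift _ f
  have hright : ∀ g, (F g).right = g := by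
    have h : ⊤ ≤ (SemidirectProduct.rightHom.comp F).eqLocus (MonoidHom.id G) := by
      rw [← hS.iSup_eq_top, iSup_le_iff]
      intro i s hs
      change (F s).right = s
      rw [hF i ⟨s, hs⟩]
      rfl
    exact fun g => h (Subgroup.mem_top g)
  refine ⟨fun g x => (F g).left (g • x), ?_, ?_⟩
  · intro a b x
    have h : mulAutArrow a (F b).left (a • b • x) = (F b).left (a⁻¹ • a • b • x) := rfl
    simp only [map_mul, SemidirectProduct.mul_left, Pi.mul_apply, hright, mul_smul]
    rw [h, inv_smul_smul]
  · intro i s x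
    simp [hF, f]

end IsInternalFreeProduct

/-- Compatible orbit representatives and transversal for the action of the subgroups `S i` on a
pointed `G`-set: `r i x` is the representative of the `S i`-orbit of `x`, reached from it by
`α i x`, and `s` is a transversal for the base point. -/
structure KuroshSystem {ι G : Type} [Group G] (S : ι → Subgroup G) (X : Type) [MulAction G X]
    (x₀ : X) where
  r : ι → X → X
  α : ι → X → G
  s : X → G
  α_mem : ∀ i x, α i x ∈ S i
  α_smul : ∀ i x, α i x • r i x = x
  α_eq_one : ∀ i x, r i x = x → α i x = 1
  r_smul : ∀ i g, g ∈ S i → ∀ x, r i (g • x) = r i x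
  s_base : s x₀ = 1
  s_smul : ∀ x, s x • x₀ = x
  induction_on : ∀ p : X → Prop, p x₀ →
    (∀ i x, s x = α i x * s (r i x) → p (r i x) → p x) → ∀ x, p x

namespace KuroshSystem

variable {ι G : Type} [Group G] {S : ι → Subgroup G} {X : Type} [MulAction G X] {x₀ : X}

theorem exists_distance (hS : ⨆ i, S i = ⊤) [MulAction.IsPretransitive G X] (x₀ : X) :
    ∃ d : X → ℕ, ∀ x, x ≠ x₀ → ∃ i, ∃ g ∈ S i, d (g • x) < d x := by
  classical
  let R : ℕ → Set X := fun n => Nat.rec {x₀} (fun _ A => {x | ∃ i, ∃ g ∈ S i, g • x ∈ A}) n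
  have hR : ∀ g : G, ∀ x, (∃ n, x ∈ R n) → ∃ n, g • x ∈ R n := by
    intro g
    have hg : g ∈ ⨆ i, S i := hS ▸ Subgroup.mem_top g
    induction hg using Subgroup.iSup_induction' with
    | hp i g hg =>
      rintro x ⟨n, hn⟩
      exact ⟨n + 1, i, g⁻¹, inv_mem hg, by simpa using hn⟩
    | h1 => simp
    | hmul a b _ _ ha hb =>
      intro x hx
      rw [mul_smul]
      exact ha _ (hb _ hx)
  have hex : ∀ x, ∃ n, x ∈ R n := by
    intro x
    obtain ⟨g, rfl⟩ := MulAction.exists_smul_eq G x₀ x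
    exact hR g x₀ ⟨0, rfl⟩
  let d : X → ℕ := fun x => sInf {n | x ∈ R n}
  have hd : ∀ x, x ∈ R (d x) := fun x => Nat.sInf_mem (hex x)
  have hd_le : ∀ x n, x ∈ R n → d x ≤ n := fun x n h => Nat.sInf_le h
  clear_value d
  refine ⟨d, fun x hx => ?_⟩
  have hspec := hd x
  cases hn : d x with
  | zero =>
    rw [hn] at hspec
    exact absurd hspec hx
  | succ n =>
    rw [hn] at hspec
    obtain ⟨i, g, hg, h⟩ := hspec
    exact ⟨i, g, hg, Nat.lt_succ_of_le (hd_le _ _ h)⟩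

theorem exists_transversal {X : Type} (d : X → ℕ) (x₀ : X) (a : X → G) (p : X → X)
    (hp : ∀ x, x ≠ x₀ → d (p x) < d x) :
    ∃ s : X → G, s x₀ = 1 ∧ ∀ x, x ≠ x₀ → s x = a x * s (p x) := by
  classical
  let s : X → G := (measure d).wf.fix fun x rec =>
    if h : x = x₀ then 1 else a x * rec (p x) (hp x h)
  have hs : ∀ x, s x = if h : x = x₀ then 1 else a x * s (p x) := fun x =>
    WellFounded.fix_eq _ _ x
  exact ⟨s, by simp [hs x₀], fun x hx => by rw [hs x, dif_neg hx]⟩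

theorem nonempty [Nonempty ι] (hS : ⨆ i, S i = ⊤) [MulAction.IsPretransitive G X] (x₀ : X) :
    Nonempty (KuroshSystem S X x₀) := by
  classical
  obtain ⟨d, hd⟩ := exists_distance (S := S) hS x₀
  have hm : ∀ O : Set X, ∃ y, O.Nonempty → y ∈ O ∧ ∀ z ∈ O, d y ≤ d z := by
    intro O
    by_cases hO : O.Nonempty
    · exact ⟨Function.argminOn d O hO, fun _ => ⟨Function.argminOn_mem d O hO,
        fun z hz => Function.argminOn_le d O hz⟩⟩
    · exact ⟨x₀, fun h => absurd h hO⟩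
  choose m hm using hm
  let r : ι → X → X := fun i x => m {y | ∃ g ∈ S i, y = g • x}
  have hr : ∀ i x, (∃ g ∈ S i, r i x = g • x) ∧ ∀ g ∈ S i, d (r i x) ≤ d (g • x) := by
    intro i x
    obtain ⟨h₁, h₂⟩ := hm {y | ∃ g ∈ S i, y = g • x} ⟨x, 1, one_mem _, (one_smul _ _).symm⟩
    exact ⟨h₁, fun g hg => h₂ _ ⟨g, hg, rfl⟩⟩
  have hα : ∀ i x, ∃ g ∈ S i, g • r i x = x ∧ (r i x = x → g = 1) := by
    intro i x
    by_cases h : r i x = x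
    · exact ⟨1, one_mem _, by simpa using h, fun _ => rfl⟩
    · obtain ⟨⟨g, hg, hgx⟩, -⟩ := hr i x
      exact ⟨g⁻¹, inv_mem hg, by simp [hgx], fun h' => absurd h' h⟩
  choose α hα_mem hα_smul hα_one using hα
  have hi : ∀ x, ∃ i, x ≠ x₀ → d (r i x) < d x := by
    intro x
    by_cases hx : x = x₀
    · exact ⟨Classical.arbitrary ι, fun h => absurd hx h⟩
    · obtain ⟨i, g, hg, h⟩ := hd x hx
      exact ⟨i, fun _ => ((hr i x).2 g hg).trans_lt h⟩
  choose i hi using hi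
  obtain ⟨s, hs₀, hs⟩ := exists_transversal d x₀ (fun x => α (i x) x) (fun x => r (i x) x) hi
  have hind : ∀ p : X → Prop, p x₀ →
      (∀ i x, s x = α i x * s (r i x) → p (r i x) → p x) → ∀ x, p x := by
    intro p h₀ h x
    induction hn : d x using Nat.strong_induction_on generalizing x with
    | _ n ih =>
      by_cases hx : x = x₀
      · exact hx ▸ h₀
      · exact h (i x) x (hs x hx) (ih _ (hn ▸ hi x hx) _ rfl)
  refine ⟨⟨r, α, s, hα_mem, hα_smul, hα_one, ?_, hs₀, ?_, hind⟩⟩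
  · intro i g hg x
    change m _ = m _
    congr 1
    ext y
    constructor
    · rintro ⟨k, hk, rfl⟩
      exact ⟨k * g, mul_mem hk hg, (mul_smul _ _ _).symm⟩
    · rintro ⟨k, hk, rfl⟩
      exact ⟨k * g⁻¹, mul_mem hk (inv_mem hg), by simp [smul_smul]⟩
  · refine hind _ (by simp [hs₀]) ?_
    intro i x h hrx
    rw [h, mul_smul, hrx, hα_smul]


/-- The vertex groups of a Kurosh system: the stabilizer, in the corresponding factor, of an orbit
representative. -/
abbrev VertexGroup (A : KuroshSystem S X x₀) (p : {p : ι × X // A.r p.1 p.2 = p.2}) : Type :=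
  ↥(S p.1.1 ⊓ MulAction.stabilizer G p.1.2)

/-- The free generators of a Kurosh system. -/
abbrev Edge (A : KuroshSystem S X x₀) : Type :=
  {p : ι × X // A.s p.2 ≠ A.α p.1 p.2 * A.s (A.r p.1 p.2)}

/-- The free product of the vertex groups and of the free group on the edges. -/
abbrev Model (A : KuroshSystem S X x₀) : Type :=
  Monoid.Coprod (Monoid.CoprodI A.VertexGroup) (FreeGroup A.Edge)

/-- Kurosh subgroup theorem: the stabilizer of the base point is the free product of conjugates
of the vertex groups and of a free group. -/
theorem exists_mulEquiv (hS : IsInternalFreeProduct S) (A : KuroshSystem S X x₀) :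
    ∃ e : A.Model ≃* MulAction.stabilizer G x₀,
      ∀ p t, (e (.inl (.of (i := p) t)) : G) = (A.s p.1.2)⁻¹ * t * A.s p.1.2 := by
  classical
  have hr : ∀ i x, A.r i (A.r i x) = A.r i x := by
    intro i x
    conv_rhs => rw [← A.α_smul i x]
    exact (A.r_smul i _ (A.α_mem i x) _).symm
  let u : ι → X → A.Model := fun i x =>
    if h : A.s x ≠ A.α i x * A.s (A.r i x) then .inr (.of ⟨(i, x), h⟩) else 1
  have hu : ∀ i x, A.s x = A.α i x * A.s (A.r i x) → u i x = 1 := fun i x h =>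
    dif_neg (not_not.mpr h)
  have hu_rep : ∀ i x, A.r i x = x → u i x = 1 := fun i x h => hu i x (by
    rw [A.α_eq_one i x h, h, one_mul])
  let η : ι → X → G → A.Model := fun i y t =>
    if h : A.r i y = y ∧ t ∈ S i ⊓ MulAction.stabilizer G y then
      .inl (.of (i := ⟨(i, y), h.1⟩) ⟨t, h.2⟩)
    else 1
  have hη : ∀ i y t (h : A.r i y = y ∧ t ∈ S i ⊓ MulAction.stabilizer G y), η i y t =
      .inl (.of (i := ⟨(i, y), h.1⟩)
        ⟨t, h.2⟩) := fun i y t h => dif_pos h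
  have hη_mul : ∀ i y, A.r i y = y → ∀ a ∈ S i ⊓ MulAction.stabilizer G y,
      ∀ b ∈ S i ⊓ MulAction.stabilizer G y, η i y (a * b) = η i y a * η i y b := by
    intro i y hy a ha b hb
    rw [hη i y _ ⟨hy, mul_mem ha hb⟩, hη i y _ ⟨hy, ha⟩, hη i y _ ⟨hy, hb⟩, ← map_mul, ← map_mul]
    rfl
  have hη_one : ∀ i y, A.r i y = y → η i y 1 = 1 := by
    intro i y hy
    simpa using hη_mul i y hy 1 (one_mem _) 1 (one_mem _)
  have hmem : ∀ i g, g ∈ S i → ∀ x, (A.α i (g • x))⁻¹ * g * A.α i x ∈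
      S i ⊓ MulAction.stabilizer G (A.r i x) := by
    intro i g hg x
    refine Subgroup.mem_inf.mpr
      ⟨mul_mem (mul_mem (inv_mem (A.α_mem _ _)) hg) (A.α_mem _ _), ?_⟩
    rw [MulAction.mem_stabilizer_iff, mul_smul, mul_smul, A.α_smul, inv_smul_eq_iff,
      ← A.r_smul i g hg x, A.α_smul]
  obtain ⟨C, hC_mul, hC⟩ := hS.exists_cocycle 
    (fun i g x => u i ((g : G) • x) * η i (A.r i x) ((A.α i ((g : G) • x))⁻¹ * g * A.α i x) *
      (u i x)⁻¹) (by
    intro i a b x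
    have h₁ := hmem i a a.2 ((b : G) • x)
    rw [A.r_smul i b b.2] at h₁
    have h := hη_mul i (A.r i x) (hr i x) _ h₁ _ (hmem i b b.2 x)
    have h₂ : (A.α i ((a : G) • (b : G) • x))⁻¹ * a * A.α i ((b : G) • x) *
        ((A.α i ((b : G) • x))⁻¹ * b * A.α i x) =
        (A.α i ((a : G) • (b : G) • x))⁻¹ * (a * b) * A.α i x := by group
    rw [h₂] at h
    rw [Subgroup.coe_mul, mul_smul, h, A.r_smul i b b.2]
    group)
  have hC_one : ∀ x, C 1 x = 1 := by
    intro x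
    simpa using hC_mul 1 1 x
  have hC_inv : ∀ a x, C a⁻¹ (a • x) = (C a x)⁻¹ := by
    intro a x
    rw [eq_inv_iff_mul_eq_one, ← hC_mul, inv_mul_cancel, hC_one]
  have hCα : ∀ i x, C (A.α i x) (A.r i x) = u i x := by
    intro i x
    rw [hC i ⟨_, A.α_mem i x⟩]
    simp only [A.α_smul, hr, A.α_eq_one i _ (hr i x), hu_rep i _ (hr i x)]
    simp [hη_one i _ (hr i x)]
  have hCs : ∀ x, C (A.s x) x₀ = 1 := by
    refine A.induction_on _ (by rw [A.s_base, hC_one]) ?_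
    intro i x h hx
    rw [h, hC_mul, hx, A.s_smul, hCα, hu i x h, mul_one]
  have hCη : ∀ i y t, A.r i y = y → t ∈ S i ⊓ MulAction.stabilizer G y → C t y = η i y t := by
    intro i y t hy ht
    have hty : t • y = y := ht.2
    rw [hC i ⟨t, ht.1⟩]
    simp [hty, hy, hu_rep i y hy, A.α_eq_one i y hy]
  let ψ : MulAction.stabilizer G x₀ →* A.Model :=
    { toFun := fun h => C h x₀
      map_one' := hC_one x₀
      map_mul' := fun a b => by
        rw [Subgroup.coe_mul, hC_mul, MulAction.mem_stabilizer_iff.mp b.2] }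
  have hconj : ∀ (p : {p : ι × X // A.r p.1 p.2 = p.2}) (t : A.VertexGroup p),
      MulAut.conj (A.s p.1.2)⁻¹ t.1 ∈ MulAction.stabilizer G x₀ := by
    intro p t
    have ht : t.1 • p.1.2 = p.1.2 := t.2.2
    rw [MulAction.mem_stabilizer_iff, MulAut.conj_apply, inv_inv, mul_smul, mul_smul, A.s_smul, ht,
      inv_smul_eq_iff, A.s_smul]
  let φ : A.Model →* MulAction.stabilizer G x₀ := Monoid.Coprod.lift
    (Monoid.CoprodI.lift fun p =>
      ((MulAut.conj (A.s p.1.2)⁻¹).toMonoidHom.comp (Subgroup.subtype _)).codRestrict _ (hconj p))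
    (FreeGroup.lift fun e =>
      ⟨(A.s e.1.2)⁻¹ * A.α e.1.1 e.1.2 * A.s (A.r e.1.1 e.1.2), by
        rw [MulAction.mem_stabilizer_iff, mul_smul, mul_smul, A.s_smul, A.α_smul,
          inv_smul_eq_iff, A.s_smul]⟩)
  have hφ_of : ∀ p (t : A.VertexGroup p),
      (φ (.inl (.of t)) : G) = (A.s p.1.2)⁻¹ * t.1 * A.s p.1.2 := by
    intro p t
    simp [φ]
  have hφη : ∀ i y t, A.r i y = y → t ∈ S i ⊓ MulAction.stabilizer G y →
      (φ (η i y t) : G) = (A.s y)⁻¹ * t * A.s y := by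
    intro i y t hy ht
    rw [hη i y t ⟨hy, ht⟩, hφ_of]
  have hφu : ∀ i x, (φ (u i x) : G) = (A.s x)⁻¹ * A.α i x * A.s (A.r i x) := by
    intro i x
    by_cases h : A.s x = A.α i x * A.s (A.r i x)
    · rw [hu i x h, map_one, mul_assoc, ← h]
      simp
    · simp [u, h, φ]
  have hφC : ∀ g x, (φ (C g x) : G) = (A.s (g • x))⁻¹ * g * A.s x := by
    intro g
    have hg : g ∈ ⨆ i, S i := hS.iSup_eq_top ▸ Subgroup.mem_top g
    induction hg using Subgroup.iSup_induction' with
    | hp i g hg =>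
      intro x
      rw [hC i ⟨g, hg⟩]
      simp only [map_mul, map_inv, Subgroup.coe_mul, Subgroup.coe_inv, hφu,
        hφη i _ _ (hr i x) (hmem i g hg x), A.r_smul i g hg]
      group
    | h1 => simp [hC_one]
    | hmul a b _ _ ha hb =>
      intro x
      rw [hC_mul, map_mul, Subgroup.coe_mul, ha, hb, mul_smul]
      group
  have hψ_conj : ∀ (h : MulAction.stabilizer G x₀) (g : G) (x y : X), g • x = y →
      (h : G) = (A.s y)⁻¹ * g * A.s x → ψ h = C g x := by
    intro h g x y hgx hh
    change C h x₀ = _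
    have h₁ := hC_inv (A.s y) x₀
    rw [A.s_smul, hCs] at h₁
    rw [hh, hC_mul, A.s_smul, hC_mul, hgx, hCs, h₁]
    simp
  refine ⟨MonoidHom.toMulEquiv φ ψ ?_ ?_, hφ_of⟩
  · refine Monoid.Coprod.hom_ext (Monoid.CoprodI.ext_hom _ _ fun p => ?_) ?_
    · ext t
      have ht : t.1 • p.1.2 = p.1.2 := t.2.2
      change ψ (φ (.inl (.of t))) = .inl (.of t)
      rw [hψ_conj _ _ _ _ ht (hφ_of p t), hCη p.1.1 _ _ p.2 t.2, hη _ _ _ ⟨p.2, t.2⟩]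
    · ext e
      have he : u e.1.1 e.1.2 = .inr (.of e) := dif_pos e.2
      change ψ (φ (.inr (.of e))) = .inr (.of e)
      rw [← he, hψ_conj _ _ _ _ (A.α_smul _ _) (hφu e.1.1 e.1.2), hCα]
  · ext h
    have := hφC h x₀
    rw [MulAction.mem_stabilizer_iff.mp h.2, A.s_base] at this
    rw [inv_one, one_mul, mul_one] at this
    exact this

end KuroshSystem

theorem ClassicallyFreelyIndecomposable.of_mulEquiv {G H : Type} [Group G] [Group H]
    (hG : ClassicallyFreelyIndecomposable G) (e : G ≃* H) : ClassicallyFreelyIndecomposable H :=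
  fun H₁ H₂ _ _ h₁ h₂ => ⟨fun f => (hG H₁ H₂ h₁ h₂).false (e.trans f)⟩

theorem ClassicallyFreelyIndecomposable.subsingleton_or_subsingleton {G H₁ H₂ : Type} [Group G]
    [Group H₁] [Group H₂] (hG : ClassicallyFreelyIndecomposable G)
    (e : G ≃* Monoid.Coprod H₁ H₂) : Subsingleton H₁ ∨ Subsingleton H₂ := by
  by_contra! h
  exact (hG H₁ H₂ h.1 h.2).false e

/-- A free product splits as the free product of one factor and of all the other ones. -/
theorem Monoid.CoprodI.nonempty_mulEquiv_coprod {ι : Type} (N : ι → Type) [∀ i, Group (N i)]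
    (i : ι) :
    Nonempty (Monoid.CoprodI N ≃*
      Monoid.Coprod (N i) (Monoid.CoprodI fun j : {j // j ≠ i} => N j)) := by
  classical
  let f : ∀ j, N j →* Monoid.Coprod (N i) (Monoid.CoprodI fun j : {j // j ≠ i} => N j) :=
    fun j => if h : j = i then h ▸ Monoid.Coprod.inl else
      Monoid.Coprod.inr.comp (Monoid.CoprodI.of (M := fun j : {j // j ≠ i} => N j) (i := ⟨j, h⟩))
  have hf : f i = Monoid.Coprod.inl := by simp [f]
  have hf' : ∀ j : {j // j ≠ i}, f j =
      Monoid.Coprod.inr.comp (Monoid.CoprodI.of (M := fun j : {j // j ≠ i} => N j) (i := j)) :=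
    fun j => by simp [f, j.2]
  refine ⟨MonoidHom.toMulEquiv (Monoid.CoprodI.lift f)
    (Monoid.Coprod.lift Monoid.CoprodI.of (Monoid.CoprodI.lift fun j => Monoid.CoprodI.of))
    (Monoid.CoprodI.ext_hom _ _ fun j => ?_)
    (Monoid.Coprod.hom_ext ?_ (Monoid.CoprodI.ext_hom _ _ fun j => ?_))⟩
  · by_cases h : j = i
    · subst h
      ext x
      simp [hf]
    · ext x
      simp [hf' ⟨j, h⟩]
  · ext x
    simp [hf]
  · ext x
    simp [hf' j]

/-- A freely indecomposable free product reduces to one of its factors. -/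
theorem ClassicallyFreelyIndecomposable.exists_of_surjective {ι : Type} {N : ι → Type}
    [∀ i, Group (N i)] [Nontrivial (Monoid.CoprodI N)]
    (h : ClassicallyFreelyIndecomposable (Monoid.CoprodI N)) :
    ∃ i, Function.Surjective (Monoid.CoprodI.of : N i →* Monoid.CoprodI N) := by
  have hex : ∃ i, Nontrivial (N i) := by
    by_contra! hN
    have : MonoidHom.id (Monoid.CoprodI N) = 1 := Monoid.CoprodI.ext_hom _ _ fun i => by
      ext x
      simp [Subsingleton.elim x 1]
    obtain ⟨x, hx⟩ := exists_ne (1 : Monoid.CoprodI N)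
    exact hx (DFunLike.congr_fun this x)
  obtain ⟨i, hi⟩ := hex
  obtain ⟨e⟩ := Monoid.CoprodI.nonempty_mulEquiv_coprod N i
  have hsub := (h.subsingleton_or_subsingleton e).resolve_left
    (not_subsingleton_iff_nontrivial.mpr hi)
  refine ⟨i, MonoidHom.range_eq_top.mp (eq_top_iff.mpr ?_)⟩
  have hlift : (Monoid.CoprodI.lift fun j => (Monoid.CoprodI.of : N j →* Monoid.CoprodI N)).range ≤
      (Monoid.CoprodI.of : N i →* Monoid.CoprodI N).range := by
    rw [Monoid.CoprodI.range_eq_iSup, iSup_le_iff]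
    rintro j _ ⟨x, rfl⟩
    by_cases hj : j = i
    · subst hj
      exact ⟨x, rfl⟩
    · have hx : x = 1 :=
        Monoid.CoprodI.of_injective (M := fun j : {j // j ≠ i} => N j) ⟨j, hj⟩
          (Subsingleton.elim _ _)
      simp [hx]
  rw [Monoid.CoprodI.lift_of'] at hlift
  exact fun x _ => hlift ⟨x, rfl⟩

namespace IsInternalFreeProduct

variable {ι G : Type} [Group G] {S : ι → Subgroup G}

theorem exists_stabilizer_conj_mem [Nonempty ι] (hS : IsInternalFreeProduct S) {X : Type}
    [MulAction G X] [MulAction.IsPretransitive G X] (x₀ : X)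
    [Nontrivial (MulAction.stabilizer G x₀)]
    (hH : ClassicallyFreelyIndecomposable (MulAction.stabilizer G x₀))
    (hz : IsEmpty (MulAction.stabilizer G x₀ ≃* Multiplicative ℤ)) :
    ∃ i w, ∀ x ∈ MulAction.stabilizer G x₀, w⁻¹ * x * w ∈ S i := by
  obtain ⟨A⟩ := KuroshSystem.nonempty hS.iSup_eq_top x₀
  obtain ⟨e, he⟩ := A.exists_mulEquiv hS
  rcases hH.subsingleton_or_subsingleton e.symm with h | h
  · have hinr : Function.Bijective (Monoid.Coprod.inr : _ →* A.Model) := by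
      refine ⟨Monoid.Coprod.inr_injective, ?_⟩
      rw [← MonoidHom.range_eq_top, eq_top_iff, ← Monoid.Coprod.range_inl_sup_range_inr, sup_le_iff]
      refine ⟨?_, le_rfl⟩
      rintro _ ⟨x, rfl⟩
      simp [Subsingleton.elim x 1]
    let f := ((MulEquiv.ofBijective _ hinr).trans e).symm.trans freeGroupEquivCoprodI
    have : Nontrivial (Monoid.CoprodI fun _ : A.Edge => FreeGroup Unit) :=
      f.symm.toEquiv.nontrivial
    obtain ⟨i, hi⟩ := (hH.of_mulEquiv f).exists_of_surjective
    let g := MulEquiv.ofBijective _ ⟨Monoid.CoprodI.of_injective i, hi⟩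
    exact (hz.false (f.trans (g.symm.trans FreeGroup.mulEquivIntOfUnique))).elim
  · have hinl : Function.Bijective (Monoid.Coprod.inl : _ →* A.Model) := by
      refine ⟨Monoid.Coprod.inl_injective, ?_⟩
      rw [← MonoidHom.range_eq_top, eq_top_iff, ← Monoid.Coprod.range_inl_sup_range_inr, sup_le_iff]
      refine ⟨le_rfl, ?_⟩
      rintro _ ⟨x, rfl⟩
      simp [Subsingleton.elim x 1]
    let f := (MulEquiv.ofBijective _ hinl).trans e
    have : Nontrivial (Monoid.CoprodI A.VertexGroup) := f.toEquiv.nontrivial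
    obtain ⟨p, hp⟩ := (hH.of_mulEquiv f.symm).exists_of_surjective
    refine ⟨p.1.1, (A.s p.1.2)⁻¹, fun x hx => ?_⟩
    obtain ⟨y, hy⟩ := f.surjective ⟨x, hx⟩
    obtain ⟨t, rfl⟩ := hp y
    have hx' : x = (A.s p.1.2)⁻¹ * t * A.s p.1.2 := (congrArg Subtype.val hy).symm.trans (he p t)
    rw [hx']
    simpa [mul_assoc] using t.2.1

/-- A freely indecomposable subgroup of a free product that is not infinite cyclic is conjugate
into one of the factors. -/
theorem exists_conj_mem [Nonempty ι] (hS : IsInternalFreeProduct S) (H : Subgroup G) [Nontrivial H]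
    (hH : ClassicallyFreelyIndecomposable H) (hz : IsEmpty (H ≃* Multiplicative ℤ)) :
    ∃ i w, ∀ x ∈ H, w⁻¹ * x * w ∈ S i := by
  have h : MulAction.stabilizer G ((1 : G) : G ⧸ H) = H := MulAction.stabilizer_quotient H
  rw [← h] at hH hz ‹Nontrivial H›
  obtain ⟨i, w, hw⟩ := hS.exists_stabilizer_conj_mem _ hH hz
  exact ⟨i, w, fun x hx => hw x (h.symm ▸ hx)⟩

theorem eq_and_conj_mem (hS : IsInternalFreeProduct S) {i k : ι} [Nontrivial (S i)] {g : G}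
    (hg : ∀ x ∈ S i, g⁻¹ * x * g ∈ S k) : k = i ∧ ∀ y ∈ S i, g * y * g⁻¹ ∈ S i := by
  classical
  obtain ⟨p, hp⟩ := hS.exists_lift (S i) fun j =>
    if h : j = i then Subgroup.inclusion (h ▸ le_rfl) else 1
  have hpi : ∀ x : S i, p x = x := fun x => by
    rw [hp, dif_pos rfl]
    rfl
  have hpk : ∀ j, j ≠ i → ∀ x ∈ S j, p x = 1 := fun j hj x hx => by
    rw [hp j ⟨x, hx⟩, dif_neg hj]
    rfl
  have hk : k = i := by
    by_contra hk
    obtain ⟨x, hx⟩ := exists_ne (1 : S i)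
    have := hpk k hk _ (hg x x.2)
    rw [map_mul, map_mul, hpi, map_inv, mul_assoc, inv_mul_eq_one, eq_comm] at this
    exact hx (by simpa using this)
  subst hk
  refine ⟨rfl, fun y hy => ?_⟩
  have hmem := hg _ (p g * ⟨y, hy⟩ * (p g)⁻¹).2
  have hy' : (⟨_, hmem⟩ : S k) = ⟨y, hy⟩ := by
    rw [← hpi ⟨_, hmem⟩]
    simp only [map_mul, map_inv, hpi]
    group
  have hy'' : g⁻¹ * (p g * ⟨y, hy⟩ * (p g)⁻¹ : S k) * g = y := congrArg Subtype.val hy'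
  have : g * y * g⁻¹ = (p g * ⟨y, hy⟩ * (p g)⁻¹ : S k) := by
    rw [mul_inv_eq_iff_eq_mul, ← eq_inv_mul_iff_mul_eq, ← mul_assoc]
    exact hy''.symm
  rw [this]
  exact Subtype.property _

/-- An isomorphism between free products of nontrivial freely indecomposable groups, none of them
infinite cyclic, matches the factors up to conjugation. -/
theorem exists_perm_map_eq_conj [Nonempty ι] (hS : IsInternalFreeProduct S) {G' : Type} [Group G']
    {S' : ι → Subgroup G'} (hS' : IsInternalFreeProduct S')
    (h : ∀ i, Nontrivial (S i) ∧ ClassicallyFreelyIndecomposable (S i) ∧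
      IsEmpty (S i ≃* Multiplicative ℤ))
    (h' : ∀ i, Nontrivial (S' i) ∧ ClassicallyFreelyIndecomposable (S' i) ∧
      IsEmpty (S' i ≃* Multiplicative ℤ))
    (Θ : G ≃* G') :
    ∃ (σ : Equiv.Perm ι) (w : ι → G'), ∀ i, (S i).map Θ.toMonoidHom =
      (S' (σ i)).map (MulAut.conj (w i)).toMonoidHom := by
  have key : ∀ {A B : Type} [Group A] [Group B] {U : ι → Subgroup A} {V : ι → Subgroup B},
      IsInternalFreeProduct V → (∀ i, Nontrivial (U i) ∧ ClassicallyFreelyIndecomposable (U i) ∧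
        IsEmpty (U i ≃* Multiplicative ℤ)) → ∀ (f : A ≃* B) i, ∃ k w, ∀ x ∈ U i,
          w⁻¹ * f x * w ∈ V k := by
    intro A B _ _ U V hV hU f i
    obtain ⟨h₁, h₂, h₃⟩ := hU i
    let e := f.subgroupMap (U i)
    have : Nontrivial ((U i).map (f : A →* B)) := e.symm.toEquiv.nontrivial
    obtain ⟨k, w, hw⟩ := hV.exists_conj_mem _ (h₂.of_mulEquiv e) ⟨fun g => h₃.false (e.trans g)⟩
    exact ⟨k, w, fun x hx => hw _ ⟨x, hx, rfl⟩⟩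
  have round : ∀ {A B : Type} [Group A] [Group B] {U : ι → Subgroup A} {V : ι → Subgroup B},
      IsInternalFreeProduct U → (∀ i, Nontrivial (U i)) → ∀ (f : A ≃* B) (σ τ : ι → ι)
        (w : ι → B) (v : ι → A), (∀ i, ∀ x ∈ U i, (w i)⁻¹ * f x * w i ∈ V (σ i)) →
        (∀ j, ∀ y ∈ V j, (v j)⁻¹ * f.symm y * v j ∈ U (τ j)) → ∀ i, τ (σ i) = i ∧
          ∀ y ∈ V (σ i), w i * y * (w i)⁻¹ ∈ (U i).map f.toMonoidHom := by
    intro A B _ _ U V hU hn f σ τ w v hw hv i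
    have := hn i
    obtain ⟨hi, hc⟩ := hU.eq_and_conj_mem (i := i) (k := τ (σ i))
      (g := f.symm (w i) * v (σ i)) fun x hx => by
        simpa [mul_assoc] using hv _ _ (hw i x hx)
    refine ⟨hi, fun y hy => ⟨f.symm (w i * y * (w i)⁻¹), ?_, by simp⟩⟩
    have hy' := hv _ y hy
    rw [hi] at hy'
    simpa [mul_assoc] using hc _ hy'
  choose σ w hw using key (U := S) hS' h Θ
  choose τ v hv using key (U := S') hS h' Θ.symm
  have h₁ := round hS (fun i => (h i).1) Θ σ τ w v hw hv
  have h₂ := round hS' (fun i => (h' i).1) Θ.symm τ σ v w hv hw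
  refine ⟨⟨σ, τ, fun i => (h₁ i).1, fun i => (h₂ i).1⟩, w, fun i => le_antisymm ?_ ?_⟩
  · rintro _ ⟨x, hx, rfl⟩
    exact ⟨_, hw i x hx, by simp [mul_assoc]⟩
  · rintro _ ⟨y, hy, rfl⟩
    exact (h₁ i).2 y hy

end IsInternalFreeProduct

theorem isInternalFreeProduct_range_inl_range_inr (A B : Type) [Group A] [Group B] :
    IsInternalFreeProduct ![(Monoid.Coprod.inl : A →* Monoid.Coprod A B).range,
      (Monoid.Coprod.inr : B →* Monoid.Coprod A B).range] where
  iSup_eq_top := by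
    rw [eq_top_iff, ← Monoid.Coprod.range_inl_sup_range_inr]
    exact sup_le (le_iSup (![_, _] : Fin 2 → Subgroup _) 0)
      (le_iSup (![_, _] : Fin 2 → Subgroup _) 1)
  exists_lift K _ f := by
    refine ⟨Monoid.Coprod.lift ((f 0).comp (MonoidHom.rangeRestrict _))
      ((f 1).comp (MonoidHom.rangeRestrict _)), Fin.forall_fin_two.mpr ⟨?_, ?_⟩⟩
    · rintro ⟨_, x, rfl⟩
      rfl
    · rintro ⟨_, x, rfl⟩
      rfl

/-- An isomorphism between free products of nontrivial freely indecomposable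
groups (none isomorphic to ℤ) matches the factors up to a permutation and conjugation. -/
theorem free_product_iso_conjugates_factors
    {G₁ G₂ G₁' G₂' : Type}
    [Group G₁] [Group G₂] [Group G₁'] [Group G₂']
    [Nontrivial G₁] [Nontrivial G₂] [Nontrivial G₁'] [Nontrivial G₂']
    (h₁ : ClassicallyFreelyIndecomposable G₁)
    (h₂ : ClassicallyFreelyIndecomposable G₂)
    (h₁' : ClassicallyFreelyIndecomposable G₁')
    (h₂' : ClassicallyFreelyIndecomposable G₂')
    (hz₁ : IsEmpty (G₁ ≃* Multiplicative ℤ)) (hz₂ : IsEmpty (G₂ ≃* Multiplicative ℤ))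
    (hz₁' : IsEmpty (G₁' ≃* Multiplicative ℤ)) (hz₂' : IsEmpty (G₂' ≃* Multiplicative ℤ))
    (Θ : Monoid.Coprod G₁ G₂ ≃* Monoid.Coprod G₁' G₂') :
    ∃ (σ : Equiv.Perm (Fin 2)) (w : Fin 2 → Monoid.Coprod G₁' G₂'),
      ∀ i : Fin 2,
        Subgroup.map Θ.toMonoidHom
            (![(Monoid.Coprod.inl : G₁ →* Monoid.Coprod G₁ G₂).range,
               (Monoid.Coprod.inr : G₂ →* Monoid.Coprod G₁ G₂).range] i) =
          Subgroup.map (MulAut.conj (w i)).toMonoidHom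
            (![(Monoid.Coprod.inl : G₁' →* Monoid.Coprod G₁' G₂').range,
               (Monoid.Coprod.inr : G₂' →* Monoid.Coprod G₁' G₂').range] (σ i)) := by
  have hS := isInternalFreeProduct_range_inl_range_inr G₁ G₂
  have hS' := isInternalFreeProduct_range_inl_range_inr G₁' G₂'
  have e₁ := MonoidHom.ofInjective (Monoid.Coprod.inl_injective (M := G₁) (N := G₂))
  have e₂ := MonoidHom.ofInjective (Monoid.Coprod.inr_injective (M := G₁) (N := G₂))
  have e₁' := MonoidHom.ofInjective (Monoid.Coprod.inl_injective (M := G₁') (N := G₂'))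
  have e₂' := MonoidHom.ofInjective (Monoid.Coprod.inr_injective (M := G₁') (N := G₂'))
  refine hS.exists_perm_map_eq_conj hS' (Fin.forall_fin_two.mpr ⟨?_, ?_⟩)
    (Fin.forall_fin_two.mpr ⟨?_, ?_⟩) Θ
  · exact ⟨e₁.symm.toEquiv.nontrivial, h₁.of_mulEquiv e₁, ⟨fun f => hz₁.false (e₁.trans f)⟩⟩
  · exact ⟨e₂.symm.toEquiv.nontrivial, h₂.of_mulEquiv e₂, ⟨fun f => hz₂.false (e₂.trans f)⟩⟩
  · exact ⟨e₁'.symm.toEquiv.nontrivial, h₁'.of_mulEquiv e₁', ⟨fun f => hz₁'.false (e₁'.trans f)⟩⟩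
  · exact ⟨e₂'.symm.toEquiv.nontrivial, h₂'.of_mulEquiv e₂', ⟨fun f => hz₂'.false (e₂'.trans f)⟩⟩
end
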